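/- Let n ≥ 2 and let G be a closed subgroup of the orthogonal group O(n). Then the real vector space Val^G of continuous translation-invariant valuations μ on ℝⁿ satisfying μ(gK) = μ(K) for all g ∈ G is finite-dimensional if and only if G acts transitively on the unit sphere S^{n−1}. -/

import Mathlib

open MeasureTheory Pointwise
open scoped NNReal ENNReal

noncomputable section

/-- Euclidean `n`-space `ℝⁿ`. -/
abbrev Eucl (n : ℕ) : Type := EuclideanSpace ℝ (Fin n)

section Generic

variable {V : Type*} [NormedAddCommGroup V] [NormedSpace ℝ V]

/-- `μ` is a valuation: whenever the union of two convex bodies `K`, `L` is again a convex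
body `M` (with intersection the convex body `I`), one has `μ M + μ I = μ K + μ L`. -/
def IsValuation (μ : ConvexBody V → ℝ) : Prop :=
  ∀ K L M I : ConvexBody V,
    (M : Set V) = (K : Set V) ∪ (L : Set V) → (I : Set V) = (K : Set V) ∩ (L : Set V) →
      μ M + μ I = μ K + μ L

/-- The translate `K + x` of a convex body. -/
def ConvexBody.translate (K : ConvexBody V) (x : V) : ConvexBody V :=
  ⟨(K : Set V) + {x}, K.convex.add (convex_singleton x),
    K.isCompact.add isCompact_singleton, K.nonempty.add (Set.singleton_nonempty x)⟩

/-- Translation invariance of a valuation. -/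
def TransInv (μ : ConvexBody V → ℝ) : Prop :=
  ∀ (K : ConvexBody V) (x : V), μ (K.translate x) = μ K

/-- The dilate `t • K` of a convex body. -/
def ConvexBody.dilate (t : ℝ) (K : ConvexBody V) : ConvexBody V :=
  ⟨t • (K : Set V), K.convex.smul t, K.isCompact.smul t, K.nonempty.smul_set⟩

/-- Homogeneity of degree `k` of a valuation: `μ (t • K) = t ^ k * μ K` for `t > 0`. -/
def Homog (k : ℕ) (μ : ConvexBody V → ℝ) : Prop :=
  ∀ (K : ConvexBody V) (t : ℝ), 0 < t → μ (ConvexBody.dilate t K) = t ^ k * μ K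

/-- The reflection `-K` of a convex body. -/
def ConvexBody.reflect (K : ConvexBody V) : ConvexBody V :=
  ⟨-(K : Set V), K.convex.neg, K.isCompact.neg, K.nonempty.neg⟩

/-- Even valuations: `μ (-K) = μ K`. -/
def EvenVal (μ : ConvexBody V → ℝ) : Prop := ∀ K : ConvexBody V, μ K.reflect = μ K

/-- Odd valuations: `μ (-K) = -μ K`. -/
def OddVal (μ : ConvexBody V → ℝ) : Prop := ∀ K : ConvexBody V, μ K.reflect = -μ K

end Generic

/-- The image of a convex body under the linear map of `ℝⁿ` given by a real `n × n` matrix. -/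
def matBody {n : ℕ} (A : Matrix (Fin n) (Fin n) ℝ) (K : ConvexBody (Eucl n)) :
    ConvexBody (Eucl n) :=
  ⟨Matrix.toEuclideanLin A '' (K : Set (Eucl n)),
    K.convex.linear_image (Matrix.toEuclideanLin A),
    K.isCompact.image (Matrix.toEuclideanLin A).continuous_of_finiteDimensional,
    K.nonempty.image _⟩

/-- `G` is a closed subgroup of the orthogonal group `O(n)` (a set of orthogonal matrices
containing the identity, closed under multiplication and inverse, and topologically
closed). -/
def IsClosedSubgroupO {n : ℕ} (G : Set (Matrix (Fin n) (Fin n) ℝ)) : Prop :=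
  (∀ A ∈ G, A ∈ Matrix.orthogonalGroup (Fin n) ℝ) ∧ (1 : Matrix (Fin n) (Fin n) ℝ) ∈ G ∧
    (∀ A ∈ G, ∀ B ∈ G, A * B ∈ G) ∧ (∀ A ∈ G, A⁻¹ ∈ G) ∧ IsClosed G

/-- `G` acts transitively on the unit sphere of `ℝⁿ`. -/
def ActsTransitively {n : ℕ} (G : Set (Matrix (Fin n) (Fin n) ℝ)) : Prop :=
  ∀ u v : Eucl n, ‖u‖ = 1 → ‖v‖ = 1 → ∃ A ∈ G, Matrix.toEuclideanLin A u = v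

/-- Invariance of a valuation under the subgroup `G`. -/
def GInv {n : ℕ} (G : Set (Matrix (Fin n) (Fin n) ℝ)) (μ : ConvexBody (Eucl n) → ℝ) : Prop :=
  ∀ A ∈ G, ∀ K : ConvexBody (Eucl n), μ (matBody A K) = μ K

section SupportFunction

variable {E : Type*} [NormedAddCommGroup E] [InnerProductSpace ℝ E]

/-- The support function of a convex body. -/
def supportFn (K : ConvexBody E) (x : E) : ℝ := sSup ((fun y => inner ℝ x y) '' (K : Set E))

/-- Positively homogeneous subadditive functions. -/
structure IsSublinear (f : E → ℝ) : Prop where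
  add_le : ∀ x y, f (x + y) ≤ f x + f y
  map_smul : ∀ (t : ℝ) (x : E), 0 ≤ t → f (t • x) = t * f x

theorem isCompact_inner_image (K : ConvexBody E) (x : E) :
    IsCompact ((fun y => inner ℝ x y) '' (K : Set E)) :=
  K.isCompact.image (by fun_prop)

theorem inner_le_supportFn {K : ConvexBody E} {y : E} (hy : y ∈ K) (x : E) :
    inner ℝ x y ≤ supportFn K x :=
  le_csSup (isCompact_inner_image K x).bddAbove ⟨y, hy, rfl⟩

theorem exists_inner_eq_supportFn (K : ConvexBody E) (x : E) :
    ∃ y ∈ K, inner ℝ x y = supportFn K x :=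
  (isCompact_inner_image K x).sSup_mem (K.nonempty.image _)

theorem supportFn_le {K : ConvexBody E} {x : E} {c : ℝ} (h : ∀ y ∈ K, inner ℝ x y ≤ c) :
    supportFn K x ≤ c := by
  obtain ⟨y, hy, h'⟩ := exists_inner_eq_supportFn K x
  exact h' ▸ h y hy

theorem isSublinear_supportFn (K : ConvexBody E) : IsSublinear (supportFn K) where
  add_le x y := supportFn_le fun z hz => by
    rw [inner_add_left]
    exact add_le_add (inner_le_supportFn hz x) (inner_le_supportFn hz y)
  map_smul t x ht := by
    refine le_antisymm (supportFn_le fun z hz => ?_) ?_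
    · rw [real_inner_smul_left]
      exact mul_le_mul_of_nonneg_left (inner_le_supportFn hz x) ht
    · obtain ⟨y, hy, h'⟩ := exists_inner_eq_supportFn K x
      rw [← h', ← real_inner_smul_left]
      exact inner_le_supportFn hy _

theorem mem_of_forall_inner_le [CompleteSpace E] {K : ConvexBody E} {y : E}
    (h : ∀ x, inner ℝ x y ≤ supportFn K x) : y ∈ K := by
  by_contra hy
  obtain ⟨f, u, hu, hyu⟩ := geometric_hahn_banach_closed_point K.convex K.isClosed hy
  set x := (InnerProductSpace.toDual ℝ E).symm f with hx
  have hf : ∀ z, f z = inner ℝ x z := fun z => by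
    rw [hx, InnerProductSpace.toDual_symm_apply]
  obtain ⟨z, hz, h'⟩ := exists_inner_eq_supportFn K x
  have h1 := h x
  have h2 := hu z hz
  rw [hf] at h2 hyu
  linarith

theorem supportFn_mono {K L : ConvexBody E} (h : (K : Set E) ⊆ L) (x : E) :
    supportFn K x ≤ supportFn L x :=
  supportFn_le fun _ hy => inner_le_supportFn (h hy) x

theorem subset_of_supportFn_le [CompleteSpace E] {K L : ConvexBody E}
    (h : ∀ x, supportFn K x ≤ supportFn L x) : (K : Set E) ⊆ L :=
  fun _ hy => mem_of_forall_inner_le fun x => (inner_le_supportFn hy x).trans (h x)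

theorem supportFn_injective [CompleteSpace E] :
    Function.Injective (supportFn : ConvexBody E → E → ℝ) := fun _ _ h =>
  ConvexBody.ext (Set.Subset.antisymm (subset_of_supportFn_le fun x => (congrFun h x).le)
    (subset_of_supportFn_le fun x => (congrFun h x).ge))

theorem supportFn_add (K L : ConvexBody E) (x : E) :
    supportFn (K + L) x = supportFn K x + supportFn L x := by
  refine le_antisymm (supportFn_le ?_) ?_
  · rintro _ ⟨a, ha, b, hb, rfl⟩
    simp only [inner_add_right]
    exact add_le_add (inner_le_supportFn ha x) (inner_le_supportFn hb x)
  · obtain ⟨a, ha, h1⟩ := exists_inner_eq_supportFn K x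
    obtain ⟨b, hb, h2⟩ := exists_inner_eq_supportFn L x
    rw [← h1, ← h2, ← inner_add_right]
    exact inner_le_supportFn (Set.add_mem_add ha hb) x

theorem supportFn_smul {t : ℝ} (ht : 0 ≤ t) (K : ConvexBody E) (x : E) :
    supportFn (t • K) x = t * supportFn K x := by
  refine le_antisymm (supportFn_le ?_) ?_
  · rintro _ ⟨a, ha, rfl⟩
    simp only [real_inner_smul_right]
    exact mul_le_mul_of_nonneg_left (inner_le_supportFn ha x) ht
  · obtain ⟨a, ha, h1⟩ := exists_inner_eq_supportFn K x
    rw [← h1, ← real_inner_smul_right]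
    exact inner_le_supportFn (Set.smul_mem_smul_set ha) x

theorem IsSublinear.map_zero {f : E → ℝ} (hf : IsSublinear f) : f 0 = 0 := by
  simpa using hf.map_smul 0 0 le_rfl

theorem IsSublinear.add {f g : E → ℝ} (hf : IsSublinear f) (hg : IsSublinear g) :
    IsSublinear (fun x => f x + g x) where
  add_le x y := by linarith [hf.add_le x y, hg.add_le x y]
  map_smul t x ht := by rw [hf.map_smul t x ht, hg.map_smul t x ht]; ring

theorem IsSublinear.const_mul {f : E → ℝ} (hf : IsSublinear f) {c : ℝ} (hc : 0 ≤ c) :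
    IsSublinear (fun x => c * f x) where
  add_le x y := by nlinarith [hf.add_le x y]
  map_smul t x ht := by rw [hf.map_smul t x ht]; ring

theorem isSublinear_norm : IsSublinear (fun x : E => ‖x‖) where
  add_le := norm_add_le
  map_smul t x ht := by rw [norm_smul, Real.norm_of_nonneg ht]

theorem IsSublinear.exists_bound [FiniteDimensional ℝ E] {f : E → ℝ} (hf : IsSublinear f) :
    ∃ c, 0 ≤ c ∧ ∀ x, f x ≤ c * ‖x‖ := by
  let b := stdOrthonormalBasis ℝ E
  refine ⟨∑ i, (|f (b i)| + |f (-(b i))|), by positivity, fun x => ?_⟩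
  have key : ∀ s : Finset (Fin (Module.finrank ℝ E)), ∀ v : Fin (Module.finrank ℝ E) → E,
      f (∑ i ∈ s, v i) ≤ ∑ i ∈ s, f (v i) := by
    intro s v
    induction s using Finset.induction_on with
    | empty => simp [hf.map_zero]
    | insert a s ha ih =>
      rw [Finset.sum_insert ha, Finset.sum_insert ha]
      exact (hf.add_le _ _).trans (by linarith)
  calc f x = f (∑ i, b.repr x i • b i) := by rw [b.sum_repr]
    _ ≤ ∑ i, f (b.repr x i • b i) := key _ _
    _ ≤ ∑ i, (|f (b i)| + |f (-(b i))|) * ‖x‖ := by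
        refine Finset.sum_le_sum fun i _ => ?_
        have hx : |b.repr x i| ≤ ‖x‖ := by
          rw [b.repr_apply_apply]
          simpa using abs_real_inner_le_norm (b i) x
        rcases le_total 0 (b.repr x i) with h | h
        · rw [hf.map_smul _ _ h]
          rw [abs_of_nonneg h] at hx
          calc b.repr x i * f (b i) ≤ b.repr x i * |f (b i)| := by gcongr; exact le_abs_self _
            _ ≤ ‖x‖ * (|f (b i)| + |f (-(b i))|) := by
              gcongr; linarith [abs_nonneg (f (-(b i)))]
            _ = _ := mul_comm _ _
        · rw [show b.repr x i • b i = (-(b.repr x i)) • (-(b i)) by simp,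
            hf.map_smul _ _ (by linarith)]
          rw [abs_of_nonpos h] at hx
          calc -(b.repr x i) * f (-(b i)) ≤ -(b.repr x i) * |f (-(b i))| :=
                mul_le_mul_of_nonneg_left (le_abs_self _) (by linarith)
            _ ≤ ‖x‖ * (|f (b i)| + |f (-(b i))|) := by
              gcongr; linarith [abs_nonneg (f ((b i)))]
            _ = _ := mul_comm _ _
    _ = _ := by rw [Finset.sum_mul]

/-- Every sublinear function is the support function of a convex body. -/
theorem IsSublinear.exists_supportFn_eq [FiniteDimensional ℝ E] {f : E → ℝ}
    (hf : IsSublinear f) : ∃ K : ConvexBody E, supportFn K = f := by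
  have key : ∀ x, ∃ y, (∀ z, inner ℝ z y ≤ f z) ∧ inner ℝ x y = f x := by
    intro x
    have hneg : -f (-x) ≤ f x := by
      have := hf.add_le x (-x)
      rw [add_neg_cancel, hf.map_zero] at this
      linarith
    have hsmul : ∀ c : ℝ, c * f x ≤ f (c • x) := by
      intro c
      rcases le_total 0 c with h | h
      · rw [hf.map_smul _ _ h]
      · rw [show c • x = (-c) • (-x) by simp, hf.map_smul _ _ (by linarith)]
        nlinarith
    let p : E →ₗ.[ℝ] ℝ := LinearPMap.mkSpanSingleton' x (f x) (by
      intro c hc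
      have h1 := hsmul c
      have h2 := hsmul (-c)
      rw [neg_smul, hc, neg_zero, hf.map_zero] at h2
      rw [hc, hf.map_zero] at h1
      simp only [smul_eq_mul, RingHom.id_apply]
      linarith)
    obtain ⟨g, hg1, hg2⟩ := exists_extension_of_le_sublinear p f
      (fun c hc z => hf.map_smul c z hc.le) hf.add_le (by
        rintro ⟨z, hz⟩
        obtain ⟨c, rfl⟩ := Submodule.mem_span_singleton.1 hz
        simp only [p]
        rw [LinearPMap.mkSpanSingleton'_apply]
        exact hsmul c)
    have hgx : g x = f x := by
      have hx : x ∈ p.domain := Submodule.mem_span_singleton_self x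
      rw [hg1 ⟨x, hx⟩]
      exact LinearPMap.mkSpanSingleton'_apply_self _ _ _ _
    refine ⟨(InnerProductSpace.toDual ℝ E).symm (LinearMap.toContinuousLinearMap g),
      fun z => ?_, ?_⟩
    · rw [real_inner_comm, InnerProductSpace.toDual_symm_apply]; exact hg2 z
    · rw [real_inner_comm, InnerProductSpace.toDual_symm_apply]; exact hgx
  obtain ⟨c, hc0, hc⟩ := hf.exists_bound
  have hset : {y : E | ∀ z, inner ℝ z y ≤ f z} = ⋂ z, {y : E | inner ℝ z y ≤ f z} := by
    ext; simp
  refine ⟨⟨{y | ∀ z, inner ℝ z y ≤ f z}, ?_, ?_, ?_⟩, ?_⟩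
  · intro a ha b hb s t hs ht hst z
    rw [inner_add_right, real_inner_smul_right, real_inner_smul_right]
    calc s * inner ℝ z a + t * inner ℝ z b ≤ s * f z + t * f z := by
          gcongr; exacts [ha z, hb z]
      _ = f z := by rw [← add_mul, hst, one_mul]
  · refine Metric.isCompact_of_isClosed_isBounded ?_ ?_
    · rw [hset]
      exact isClosed_iInter fun z => isClosed_le (by fun_prop) continuous_const
    · refine (Metric.isBounded_closedBall (x := (0 : E)) (r := c)).subset fun y hy => ?_
      rw [mem_closedBall_zero_iff]
      have h1 := (hy y).trans (hc y)
      rw [real_inner_self_eq_norm_sq] at h1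
      by_contra h
      push Not at h
      nlinarith [norm_nonneg y]
  · obtain ⟨y, hy, -⟩ := key 0
    exact ⟨y, hy⟩
  · funext x
    refine le_antisymm (supportFn_le fun y hy => hy x) ?_
    obtain ⟨y, hy, h⟩ := key x
    rw [← h]
    exact inner_le_supportFn (K := ⟨{y | ∀ z, inner ℝ z y ≤ f z}, _, _, _⟩) (y := y) hy x

theorem abs_supportFn_sub_le (K L : ConvexBody E) (x : E) :
    |supportFn K x - supportFn L x| ≤ dist K L * ‖x‖ := by
  have key : ∀ K L : ConvexBody E, supportFn K x ≤ supportFn L x + dist K L * ‖x‖ := by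
    intro K L
    refine supportFn_le fun y hy => ?_
    obtain ⟨z, hz, hyz⟩ := L.isCompact.exists_infDist_eq_dist L.nonempty y
    have h1 : dist y z ≤ dist K L := by
      rw [← hyz, ← ConvexBody.hausdorffDist_coe]
      exact Metric.infDist_le_hausdorffDist_of_mem hy ConvexBody.hausdorffEDist_ne_top
    have h2 : inner ℝ x y = inner ℝ x z + inner ℝ x (y - z) := by
      rw [← inner_add_right, add_sub_cancel]
    rw [h2]
    refine add_le_add (inner_le_supportFn hz x) ((real_inner_le_norm _ _).trans ?_)
    rw [mul_comm, ← dist_eq_norm]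
    gcongr
  rw [abs_le]
  constructor
  · linarith [dist_comm K L ▸ key L K]
  · linarith [key K L]

theorem dist_le_of_abs_supportFn_sub_le [CompleteSpace E] {K L : ConvexBody E} {r : ℝ}
    (hr : 0 ≤ r) (h : ∀ x, |supportFn K x - supportFn L x| ≤ r * ‖x‖) : dist K L ≤ r := by
  have key : ∀ K L : ConvexBody E, (∀ x, supportFn K x ≤ supportFn L x + r * ‖x‖) →
      ∀ y ∈ K, ∃ z ∈ L, dist y z ≤ r := by
    intro K L h y hy
    obtain ⟨z, hz, hyz⟩ := L.isCompact.exists_infDist_eq_dist L.nonempty y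
    refine ⟨z, hz, ?_⟩
    have hproj : ∀ w ∈ L, inner ℝ (y - z) (w - z) ≤ 0 := by
      refine (norm_eq_iInf_iff_real_inner_le_zero L.convex hz).1 ?_
      rw [← dist_eq_norm, ← hyz, Metric.infDist_eq_iInf]
      simp only [dist_eq_norm]
    have h1 : supportFn L (y - z) ≤ inner ℝ (y - z) z := supportFn_le fun w hw => by
      have := hproj w hw
      rw [inner_sub_right] at this
      linarith
    have h2 := inner_le_supportFn hy (y - z)
    have h3 := h (y - z)
    have h4 : inner ℝ (y - z) y - inner ℝ (y - z) z = ‖y - z‖ ^ 2 := by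
      rw [← inner_sub_right, real_inner_self_eq_norm_sq]
    rw [dist_eq_norm]
    by_contra hlt
    push Not at hlt
    nlinarith [norm_nonneg (y - z)]
  rw [← ConvexBody.hausdorffDist_coe]
  refine Metric.hausdorffDist_le_of_mem_dist hr
    (key K L fun x => by linarith [(abs_le.1 (h x)).2])
    (key L K fun x => by linarith [(abs_le.1 (h x)).1])

theorem exists_mem_inter_segment {K L M : ConvexBody E}
    (hM : (M : Set E) = (K : Set E) ∪ (L : Set E)) {a b : E} (ha : a ∈ K) (hb : b ∈ L) :
    ∃ c ∈ segment ℝ a b, c ∈ K ∧ c ∈ L := by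
  have hseg : segment ℝ a b ⊆ (K : Set E) ∪ L := by
    rw [← hM]
    exact M.convex.segment_subset (hM ▸ Or.inl ha) (hM ▸ Or.inr hb)
  have hconn : IsPreconnected (segment ℝ a b) := (convex_segment a b).isPreconnected
  obtain ⟨c, hc, h1, h2⟩ := (isPreconnected_closed_iff.1 hconn) K L K.isClosed L.isClosed hseg
    ⟨a, left_mem_segment ℝ a b, ha⟩ ⟨b, right_mem_segment ℝ a b, hb⟩
  exact ⟨c, hc, h1, h2⟩

theorem supportFn_union_inter {K L M I : ConvexBody E}
    (hM : (M : Set E) = (K : Set E) ∪ (L : Set E)) (hI : (I : Set E) = (K : Set E) ∩ L) (x : E) :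
    supportFn M x = max (supportFn K x) (supportFn L x) ∧
      supportFn I x = min (supportFn K x) (supportFn L x) := by
  have hmax : supportFn M x = max (supportFn K x) (supportFn L x) := by
    refine le_antisymm (supportFn_le fun y hy => ?_) (max_le ?_ ?_)
    · have : y ∈ (K : Set E) ∪ L := hM ▸ hy
      rcases this with h | h
      · exact le_max_of_le_left (inner_le_supportFn h x)
      · exact le_max_of_le_right (inner_le_supportFn h x)
    · exact supportFn_mono (hM ▸ Set.subset_union_left) x
    · exact supportFn_mono (hM ▸ Set.subset_union_right) x
  have hmin : supportFn I x = min (supportFn K x) (supportFn L x) := by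
    refine le_antisymm (le_min ?_ ?_) ?_
    · exact supportFn_mono (hI ▸ Set.inter_subset_left) x
    · exact supportFn_mono (hI ▸ Set.inter_subset_right) x
    · obtain ⟨a, ha, h1⟩ := exists_inner_eq_supportFn K x
      obtain ⟨b, hb, h2⟩ := exists_inner_eq_supportFn L x
      obtain ⟨c, ⟨s, t, hs, ht, hst, rfl⟩, hcK, hcL⟩ := exists_mem_inter_segment hM ha hb
      have hc : s • a + t • b ∈ I := by
        have : s • a + t • b ∈ (K : Set E) ∩ L := ⟨hcK, hcL⟩
        rw [← hI] at this
        exact this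
      refine le_trans ?_ (inner_le_supportFn hc x)
      rw [inner_add_right, real_inner_smul_right, real_inner_smul_right, h1, h2]
      calc min (supportFn K x) (supportFn L x)
          = s * min (supportFn K x) (supportFn L x) + t * min (supportFn K x) (supportFn L x) := by
            rw [← add_mul, hst, one_mul]
        _ ≤ _ := by gcongr; exacts [min_le_left _ _, min_le_right _ _]
  exact ⟨hmax, hmin⟩

/-- The support function is itself a (vector-valued) valuation. -/
theorem supportFn_union_add_inter {K L M I : ConvexBody E}
    (hM : (M : Set E) = (K : Set E) ∪ (L : Set E)) (hI : (I : Set E) = (K : Set E) ∩ L) (x : E) :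
    supportFn M x + supportFn I x = supportFn K x + supportFn L x := by
  rw [(supportFn_union_inter hM hI x).1, (supportFn_union_inter hM hI x).2, max_add_min]

theorem continuous_supportFn (K : ConvexBody E) : Continuous (supportFn K) := by
  obtain ⟨C, hC⟩ := K.isBounded.exists_norm_le
  have : LipschitzWith (Real.toNNReal C) (supportFn K) := by
    have aux : ∀ a b, supportFn K a - supportFn K b ≤ C * ‖a - b‖ := fun a b => by
      obtain ⟨y, hy, h⟩ := exists_inner_eq_supportFn K a
      have h3 := inner_le_supportFn hy b
      have h4 : inner ℝ a y - inner ℝ b y ≤ ‖a - b‖ * ‖y‖ := by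
        rw [← inner_sub_left]; exact real_inner_le_norm _ _
      nlinarith [hC y hy, norm_nonneg (a - b)]
    refine LipschitzWith.of_dist_le_mul fun a b => ?_
    rw [Real.dist_eq, dist_eq_norm, abs_le]
    have hC0 : 0 ≤ C := by
      obtain ⟨y, hy⟩ := K.nonempty
      exact (norm_nonneg y).trans (hC y hy)
    rw [Real.coe_toNNReal _ hC0]
    constructor
    · have := aux b a
      rw [norm_sub_rev] at this
      linarith
    · exact aux a b
  exact this.continuous

/-- If the maximum and minimum of two support functions are support functions, then these belong
to the union and the intersection. -/
theorem union_inter_of_supportFn_max_min [CompleteSpace E] {K L M I : ConvexBody E}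
    (hM : ∀ x, supportFn M x = max (supportFn K x) (supportFn L x))
    (hI : ∀ x, supportFn I x = min (supportFn K x) (supportFn L x)) :
    (M : Set E) = (K : Set E) ∪ L ∧ (I : Set E) = (K : Set E) ∩ L := by
  constructor
  · refine Set.Subset.antisymm (fun z hz => ?_) (Set.union_subset
      (subset_of_supportFn_le fun x => hM x ▸ le_max_left _ _)
      (subset_of_supportFn_le fun x => hM x ▸ le_max_right _ _))
    by_contra hcon
    rw [Set.mem_union, not_or] at hcon
    have h1 : ∃ u, supportFn K u < inner ℝ u z := by
      by_contra h; push Not at h; exact hcon.1 (mem_of_forall_inner_le h)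
    have h2 : ∃ u, supportFn L u < inner ℝ u z := by
      by_contra h; push Not at h; exact hcon.2 (mem_of_forall_inner_le h)
    obtain ⟨u, hu⟩ := h1
    obtain ⟨v, hv⟩ := h2
    have hcont : ∀ K : ConvexBody E, Continuous fun w => supportFn K w - inner ℝ w z := fun K =>
      (continuous_supportFn K).sub (by fun_prop)
    have hconn : IsPreconnected (segment ℝ u v) := (convex_segment u v).isPreconnected
    have hMz : ∀ w, inner ℝ w z ≤ max (supportFn K w) (supportFn L w) := fun w =>
      hM w ▸ inner_le_supportFn hz w
    have hint := isPreconnected_closed_iff.1 hconn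
      {w | 0 ≤ supportFn K w - inner ℝ w z} {w | 0 ≤ supportFn L w - inner ℝ w z}
      (isClosed_le continuous_const (hcont K)) (isClosed_le continuous_const (hcont L))
      (fun w _ => by
        rcases le_max_iff.1 (hMz w) with h | h
        · left; simpa using h
        · right; simpa using h)
      ⟨v, right_mem_segment ℝ u v, by
        rcases le_max_iff.1 (hMz v) with h | h
        · simpa using h
        · linarith⟩
      ⟨u, left_mem_segment ℝ u v, by
        rcases le_max_iff.1 (hMz u) with h | h
        · linarith
        · simpa using h⟩
    obtain ⟨w, ⟨s, t, hs, ht, hst, rfl⟩, hw1, hw2⟩ := hint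
    simp only [Set.mem_ofPred_eq, sub_nonneg] at hw1 hw2
    have hIw : inner ℝ (s • u + t • v) z ≤ supportFn I (s • u + t • v) := by
      rw [hI]; exact le_min hw1 hw2
    have hIs := (isSublinear_supportFn I)
    have h5 := hIs.add_le (s • u) (t • v)
    rw [hIs.map_smul s u hs, hIs.map_smul t v ht] at h5
    have h6 : supportFn I u < inner ℝ u z := (hI u ▸ min_le_left _ _).trans_lt hu
    have h7 : supportFn I v < inner ℝ v z := (hI v ▸ min_le_right _ _).trans_lt hv
    rw [inner_add_left, real_inner_smul_left, real_inner_smul_left] at hIw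
    have h8 : s * (inner ℝ u z - supportFn I u) + t * (inner ℝ v z - supportFn I v) ≤ 0 := by
      linarith
    rcases hs.eq_or_lt with h | h
    · have : t = 1 := by linarith
      subst h; subst this
      linarith
    · nlinarith [mul_pos h (sub_pos.2 h6), mul_nonneg ht (sub_pos.2 h7).le]
  · refine Set.Subset.antisymm (Set.subset_inter
      (subset_of_supportFn_le fun x => hI x ▸ min_le_left _ _)
      (subset_of_supportFn_le fun x => hI x ▸ min_le_right _ _)) ?_
    rintro z ⟨hz1, hz2⟩
    refine mem_of_forall_inner_le fun x => ?_
    rw [hI]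
    exact le_min (inner_le_supportFn hz1 x) (inner_le_supportFn hz2 x)

end SupportFunction

section Valuations

variable {E : Type*} [NormedAddCommGroup E] [NormedSpace ℝ E]

/-- Continuous translation invariant valuations. -/
structure IsVal (μ : ConvexBody E → ℝ) : Prop where
  val : IsValuation μ
  cont : Continuous μ
  trans : TransInv μ

open Classical in
/-- A function on convex bodies as a function on all sets, zero on sets that are not bodies. -/
def setExt (μ : ConvexBody E → ℝ) (A : Set E) : ℝ :=
  if h : Convex ℝ A ∧ IsCompact A ∧ A.Nonempty then μ ⟨A, h.1, h.2.1, h.2.2⟩ else 0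

theorem setExt_coe (μ : ConvexBody E → ℝ) (K : ConvexBody E) : setExt μ (K : Set E) = μ K := by
  rw [setExt, dif_pos ⟨K.convex, K.isCompact, K.nonempty⟩]
  rfl

theorem setExt_eq (μ : ConvexBody E → ℝ) {A : Set E} (K : ConvexBody E) (h : A = K) :
    setExt μ A = μ K := by
  rw [h, setExt_coe]

theorem setExt_empty (μ : ConvexBody E → ℝ) : setExt μ ∅ = 0 := by
  rw [setExt, dif_neg]
  simp

theorem setExt_image_cut {V : Type*} [NormedAddCommGroup V] [NormedSpace ℝ V]
    {μ : ConvexBody E → ℝ} (hμ : IsValuation μ) (p : V →L[ℝ] E) (l : V →L[ℝ] ℝ) (c : ℝ)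
    {A : Set V} (hA : Convex ℝ A) (hA' : IsCompact A) :
    setExt μ (p '' A) + setExt μ (p '' (A ∩ {x | l x = c})) =
      setExt μ (p '' (A ∩ {x | l x ≤ c})) + setExt μ (p '' (A ∩ {x | c ≤ l x})) := by
  rcases (A ∩ {x | l x ≤ c}).eq_empty_or_nonempty with h1 | h1
  · have h2 : A ∩ {x | l x = c} = ∅ := by
      refine Set.subset_empty_iff.1 (h1 ▸ ?_)
      exact Set.inter_subset_inter_right _ fun x hx => le_of_eq hx
    have h3 : A ∩ {x | c ≤ l x} = A := by
      refine Set.inter_eq_left.2 fun x hx => ?_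
      by_contra h
      exact Set.notMem_empty x (h1 ▸ ⟨hx, by rw [Set.mem_ofPred_eq] at h ⊢; exact (not_le.1 h).le⟩)
    rw [h1, h2, h3, Set.image_empty, setExt_empty]; ring
  rcases (A ∩ {x | c ≤ l x}).eq_empty_or_nonempty with h4 | h4
  · have h2 : A ∩ {x | l x = c} = ∅ := by
      refine Set.subset_empty_iff.1 (h4 ▸ ?_)
      exact Set.inter_subset_inter_right _ fun x hx => ge_of_eq hx
    have h3 : A ∩ {x | l x ≤ c} = A := by
      refine Set.inter_eq_left.2 fun x hx => ?_
      by_contra h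
      exact Set.notMem_empty x (h4 ▸ ⟨hx, by rw [Set.mem_ofPred_eq] at h ⊢; exact (not_le.1 h).le⟩)
    rw [h4, h2, h3, Set.image_empty, setExt_empty]
  have cross : ∀ a ∈ A ∩ {x | l x ≤ c}, ∀ b ∈ A ∩ {x | c ≤ l x},
      ∃ z ∈ segment ℝ a b, z ∈ A ∧ l z = c := by
    rintro a ⟨ha, ha'⟩ b ⟨hb, hb'⟩
    have hc : IsPreconnected (segment ℝ a b) := (convex_segment a b).isPreconnected
    obtain ⟨z, hz, hz'⟩ := hc.intermediate_value (left_mem_segment ℝ a b)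
      (right_mem_segment ℝ a b) l.continuous.continuousOn ⟨ha', hb'⟩
    exact ⟨z, hz, hA.segment_subset ha hb hz, hz'⟩
  have h5 : (A ∩ {x | l x = c}).Nonempty := by
    obtain ⟨a, ha⟩ := h1
    obtain ⟨b, hb⟩ := h4
    obtain ⟨z, -, hz⟩ := cross a ha b hb
    exact ⟨z, hz⟩
  have hle : Convex ℝ (A ∩ {x | l x ≤ c}) :=
    hA.inter (convex_halfSpace_le l.isBoundedLinearMap.toIsLinearMap c)
  have hge : Convex ℝ (A ∩ {x | c ≤ l x}) :=
    hA.inter (convex_halfSpace_ge l.isBoundedLinearMap.toIsLinearMap c)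
  have heq : Convex ℝ (A ∩ {x | l x = c}) :=
    hA.inter (convex_hyperplane l.isBoundedLinearMap.toIsLinearMap c)
  have kle : IsCompact (A ∩ {x | l x ≤ c}) :=
    hA'.inter_right (isClosed_le l.continuous continuous_const)
  have kge : IsCompact (A ∩ {x | c ≤ l x}) :=
    hA'.inter_right (isClosed_le continuous_const l.continuous)
  have keq : IsCompact (A ∩ {x | l x = c}) :=
    hA'.inter_right (isClosed_eq l.continuous continuous_const)
  have img : ∀ B : Set V, Convex ℝ B → IsCompact B → B.Nonempty →
      Convex ℝ (p '' B) ∧ IsCompact (p '' B) ∧ (p '' B).Nonempty := fun B h1 h2 h3 =>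
    ⟨h1.linear_image p.toLinearMap, h2.image p.continuous, h3.image _⟩
  have iA := img A hA hA' (h1.mono Set.inter_subset_left)
  have ile := img _ hle kle h1
  have ige := img _ hge kge h4
  have ieq := img _ heq keq h5
  rw [setExt, setExt, setExt, setExt, dif_pos iA, dif_pos ieq, dif_pos ile, dif_pos ige]
  refine hμ _ _ _ _ ?_ ?_
  · change p '' A = p '' _ ∪ p '' _
    rw [← Set.image_union, ← Set.inter_union_distrib_left]
    congr 1
    refine (Set.inter_eq_left.2 fun x _ => ?_).symm
    exact le_total (l x) c
  · change p '' _ = p '' _ ∩ p '' _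
    refine Set.Subset.antisymm (Set.subset_inter ?_ ?_) ?_
    · exact Set.image_mono (Set.inter_subset_inter_right _ fun x hx => le_of_eq hx)
    · exact Set.image_mono (Set.inter_subset_inter_right _ fun x hx => ge_of_eq hx)
    · rintro y ⟨⟨a, ha, rfl⟩, ⟨b, hb, hab⟩⟩
      obtain ⟨z, ⟨s, t, hs, ht, hst, rfl⟩, hz⟩ := cross a ha b hb
      refine ⟨_, hz, ?_⟩
      rw [map_add, map_smul, map_smul, hab, ← add_smul, hst, one_smul]

/-- Inclusion-exclusion over the cuts of a body by the hyperplanes `x i = 1`. -/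
theorem sum_powerset_cut {N : ℕ} {μ : ConvexBody E → ℝ} (hμ : IsValuation μ)
    (p : (Fin N → ℝ) →L[ℝ] E) (T : Finset (Fin N)) :
    ∀ A : Set (Fin N → ℝ), Convex ℝ A → IsCompact A →
      ∑ S ∈ T.powerset, (-1 : ℝ) ^ S.card * setExt μ (p '' (A ∩ {x | ∀ i ∈ S, 1 ≤ x i})) =
      ∑ S ∈ T.powerset, (-1 : ℝ) ^ S.card *
        setExt μ (p '' (A ∩ {x | (∀ i ∈ T, x i ≤ 1) ∧ ∀ i ∈ S, x i = 1})) := by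
  induction T using Finset.induction_on with
  | empty => intro A _ _; simp
  | insert j T hj ih =>
    intro A hA hA'
    let l : (Fin N → ℝ) →L[ℝ] ℝ := ContinuousLinearMap.proj j
    have hge : Convex ℝ (A ∩ {x | 1 ≤ l x}) :=
      hA.inter (convex_halfSpace_ge l.isBoundedLinearMap.toIsLinearMap 1)
    have kge : IsCompact (A ∩ {x | 1 ≤ l x}) :=
      hA'.inter_right (isClosed_le continuous_const l.continuous)
    rw [Finset.sum_powerset_insert hj, Finset.sum_powerset_insert hj]
    have h1 : ∑ S ∈ T.powerset, (-1 : ℝ) ^ (insert j S).card *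
          setExt μ (p '' (A ∩ {x | ∀ i ∈ insert j S, 1 ≤ x i})) =
        -∑ S ∈ T.powerset, (-1 : ℝ) ^ S.card *
          setExt μ (p '' (A ∩ {x | 1 ≤ l x} ∩ {x | ∀ i ∈ S, 1 ≤ x i})) := by
      rw [← Finset.sum_neg_distrib]
      refine Finset.sum_congr rfl fun S hS => ?_
      rw [Finset.card_insert_of_notMem fun h => hj (Finset.mem_powerset.1 hS h), pow_succ]
      have : A ∩ {x | ∀ i ∈ insert j S, 1 ≤ x i} =
          A ∩ {x | 1 ≤ l x} ∩ {x | ∀ i ∈ S, 1 ≤ x i} := by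
        ext x; simp [l, and_assoc]
      rw [this]; ring
    rw [h1, ih A hA hA', ih _ hge kge, ← sub_eq_add_neg, ← Finset.sum_sub_distrib,
      ← Finset.sum_add_distrib]
    refine Finset.sum_congr rfl fun S hS => ?_
    rw [Finset.card_insert_of_notMem fun h => hj (Finset.mem_powerset.1 hS h), pow_succ]
    set B := A ∩ {x | (∀ i ∈ T, x i ≤ 1) ∧ ∀ i ∈ S, x i = 1} with hB
    have hset : {x : Fin N → ℝ | (∀ i ∈ T, x i ≤ 1) ∧ ∀ i ∈ S, x i = 1} =
        (⋂ i ∈ T, {x | x i ≤ 1}) ∩ ⋂ i ∈ S, {x | x i = 1} := by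
      ext x; simp
    have hBc : Convex ℝ B := by
      refine hA.inter ?_
      rw [hset]
      refine (convex_iInter₂ fun i _ => ?_).inter (convex_iInter₂ fun i _ => ?_)
      · exact convex_halfSpace_le (LinearMap.proj i : (Fin N → ℝ) →ₗ[ℝ] ℝ).isLinear 1
      · exact convex_hyperplane (LinearMap.proj i : (Fin N → ℝ) →ₗ[ℝ] ℝ).isLinear 1
    have hBk : IsCompact B := by
      refine hA'.inter_right ?_
      rw [hset]
      refine (isClosed_biInter fun i _ => ?_).inter (isClosed_biInter fun i _ => ?_)
      · exact isClosed_le (continuous_apply i) continuous_const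
      · exact isClosed_eq (continuous_apply i) continuous_const
    have key := setExt_image_cut hμ p l 1 hBc hBk
    have e1 : A ∩ {x | 1 ≤ l x} ∩ {x | (∀ i ∈ T, x i ≤ 1) ∧ ∀ i ∈ S, x i = 1} =
        B ∩ {x | 1 ≤ l x} := by
      rw [hB, Set.inter_right_comm]
    have e2 : A ∩ {x | (∀ i ∈ insert j T, x i ≤ 1) ∧ ∀ i ∈ S, x i = 1} =
        B ∩ {x | l x ≤ 1} := by
      ext x; simp [l, hB]; tauto
    have e3 : A ∩ {x | (∀ i ∈ insert j T, x i ≤ 1) ∧ ∀ i ∈ insert j S, x i = 1} =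
        B ∩ {x | l x = 1} := by
      ext x; simp only [l, hB, Set.mem_inter_iff, Set.mem_ofPred_eq, Finset.forall_mem_insert,
          ContinuousLinearMap.proj_apply]
      constructor
      · tauto
      · rintro ⟨⟨h1, h2, h3⟩, h4⟩
        exact ⟨h1, ⟨h4.le, h2⟩, h4, h3⟩
    rw [e1, e2, e3]
    linear_combination (-1 : ℝ) ^ S.card * key

end Valuations

section Polytopes

variable {E : Type*} [NormedAddCommGroup E] [NormedSpace ℝ E]

/-- The linear map sending the `i`-th basis vector to `v i`. -/
def combMap {N : ℕ} (v : Fin N → E) : (Fin N → ℝ) →L[ℝ] E :=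
  ∑ i, (ContinuousLinearMap.proj i : (Fin N → ℝ) →L[ℝ] ℝ).smulRight (v i)

theorem combMap_apply {N : ℕ} (v : Fin N → E) (x : Fin N → ℝ) :
    combMap v x = ∑ i, x i • v i := by
  simp [combMap]

/-- The polytope spanned by finitely many points. -/
def polyBody {N : ℕ} [NeZero N] (v : Fin N → E) : ConvexBody E :=
  ⟨combMap v '' stdSimplex ℝ (Fin N),
    (convex_stdSimplex ℝ (Fin N)).linear_image (combMap v).toLinearMap,
    (isCompact_stdSimplex ℝ (Fin N)).image (combMap v).continuous,
    Set.Nonempty.image _ ⟨_, single_mem_stdSimplex ℝ (0 : Fin N)⟩⟩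

theorem coe_polyBody {N : ℕ} [NeZero N] (v : Fin N → E) :
    (polyBody v : Set E) = combMap v '' stdSimplex ℝ (Fin N) := rfl

theorem coe_polyBody_eq_convexHull {N : ℕ} [NeZero N] (v : Fin N → E) :
    (polyBody v : Set E) = convexHull ℝ (Set.range v) := by
  rw [coe_polyBody, ← convexHull_basis_eq_stdSimplex]
  refine (LinearMap.image_convexHull (combMap v).toLinearMap _).trans ?_
  congr 1
  rw [← Set.range_comp]
  congr 1
  funext i
  simp [combMap_apply]

/-- The dilated standard simplex. -/
def simplexAt (N : ℕ) (t : ℝ) : Set (Fin N → ℝ) := {x | (∀ i, 0 ≤ x i) ∧ ∑ i, x i = t}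

theorem image_simplexAt {N : ℕ} [NeZero N] (v : Fin N → E) {t : ℝ} (ht : 0 ≤ t) :
    combMap v '' simplexAt N t = ((t • polyBody v : ConvexBody E) : Set E) := by
  rw [ConvexBody.coe_smul, coe_polyBody]
  ext y
  rw [Set.mem_smul_set]
  constructor
  · rintro ⟨x, ⟨hx, hxt⟩, rfl⟩
    rcases ht.eq_or_lt with rfl | ht
    · have : x = 0 := by
        funext i
        exact (Finset.sum_eq_zero_iff_of_nonneg fun i _ => hx i).1 hxt i (Finset.mem_univ i)
      exact ⟨_, ⟨_, single_mem_stdSimplex ℝ (0 : Fin N), rfl⟩, by simp [this]⟩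
    · refine ⟨_, ⟨t⁻¹ • x, ⟨fun i => ?_, ?_⟩, rfl⟩, ?_⟩
      · exact mul_nonneg (inv_nonneg.2 ht.le) (hx i)
      · simp only [Pi.smul_apply, smul_eq_mul]
        rw [← Finset.mul_sum, hxt, inv_mul_cancel₀ ht.ne']
      · rw [map_smul, smul_smul, mul_inv_cancel₀ ht.ne', one_smul]
  · rintro ⟨_, ⟨x, ⟨hx, hx1⟩, rfl⟩, rfl⟩
    refine ⟨t • x, ⟨fun i => mul_nonneg ht (hx i), ?_⟩, by rw [map_smul]⟩
    simp only [Pi.smul_apply, smul_eq_mul]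
    rw [← Finset.mul_sum, hx1, mul_one]

theorem isCompact_simplexAt (N : ℕ) (t : ℝ) : IsCompact (simplexAt N t) := by
  refine Metric.isCompact_of_isClosed_isBounded ?_ ?_
  · have : simplexAt N t = (⋂ i, {x | 0 ≤ x i}) ∩ {x | ∑ i, x i = t} := by
      ext x; simp [simplexAt]
    rw [this]
    exact (isClosed_iInter fun i => isClosed_le continuous_const (continuous_apply i)).inter
      (isClosed_eq (by fun_prop) continuous_const)
  · refine (Metric.isBounded_closedBall (x := (0 : Fin N → ℝ)) (r := |t|)).subset ?_
    rintro x ⟨hx, hxt⟩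
    rw [mem_closedBall_zero_iff, pi_norm_le_iff_of_nonneg (abs_nonneg t)]
    intro i
    rw [Real.norm_of_nonneg (hx i)]
    exact (Finset.single_le_sum (fun i _ => hx i) (Finset.mem_univ i)).trans
      (hxt ▸ le_abs_self _)

theorem convex_simplexAt (N : ℕ) (t : ℝ) : Convex ℝ (simplexAt N t) := by
  rintro x ⟨hx, hxt⟩ y ⟨hy, hyt⟩ a b ha hb hab
  refine ⟨fun i => add_nonneg (mul_nonneg ha (hx i)) (mul_nonneg hb (hy i)), ?_⟩
  simp only [Pi.add_apply, Pi.smul_apply, smul_eq_mul]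
  rw [Finset.sum_add_distrib, ← Finset.mul_sum, ← Finset.mul_sum, hxt, hyt, ← add_mul, hab,
    one_mul]

theorem sum_choose_mul_polyBody {μ : ConvexBody E → ℝ} (hμ : IsValuation μ) (hμ' : TransInv μ)
    {N : ℕ} [NeZero N] (v : Fin N → E) {m : ℕ} (hm : N ≤ m) :
    ∑ k ∈ Finset.range (N + 1),
      (N.choose k : ℝ) * ((-1) ^ k * μ (((m - k : ℕ) : ℝ) • polyBody v)) = 0 := by
  have key := sum_powerset_cut hμ (combMap v) Finset.univ (simplexAt N m)
    (convex_simplexAt N m) (isCompact_simplexAt N m)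
  have h1 : ∀ S ∈ (Finset.univ : Finset (Fin N)).powerset,
      simplexAt N m ∩ {x | (∀ i ∈ Finset.univ, x i ≤ 1) ∧ ∀ i ∈ S, x i = 1} =
        simplexAt N m ∩ {x | ∀ i, x i ≤ 1} := by
    intro S _
    ext x
    simp only [Set.mem_inter_iff, Set.mem_ofPred_eq, Finset.mem_univ, true_implies]
    refine ⟨fun h => ⟨h.1, h.2.1⟩, fun h => ⟨h.1, h.2, ?_⟩⟩
    have h2 : ∑ i, (1 - x i) = (N : ℝ) - m := by
      rw [Finset.sum_sub_distrib, h.1.2]; simp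
    have h3 : ∑ i, (1 - x i) = 0 := by
      refine le_antisymm ?_ (Finset.sum_nonneg fun i _ => sub_nonneg.2 (h.2 i))
      rw [h2, sub_nonpos]; exact_mod_cast hm
    intro i _
    have := (Finset.sum_eq_zero_iff_of_nonneg fun i _ => sub_nonneg.2 (h.2 i)).1 h3 i
      (Finset.mem_univ i)
    linarith
  have h2 : ∑ S ∈ (Finset.univ : Finset (Fin N)).powerset, (-1 : ℝ) ^ S.card *
        setExt μ (combMap v '' (simplexAt N m ∩
          {x | (∀ i ∈ Finset.univ, x i ≤ 1) ∧ ∀ i ∈ S, x i = 1})) = 0 := by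
    rw [Finset.sum_congr rfl fun S hS => by rw [h1 S hS], ← Finset.sum_mul]
    have := Finset.sum_powerset_neg_one_pow_card_of_nonempty
      (x := (Finset.univ : Finset (Fin N))) Finset.univ_nonempty
    have h3 : ∑ S ∈ (Finset.univ : Finset (Fin N)).powerset, (-1 : ℝ) ^ S.card = 0 := by
      exact_mod_cast this
    rw [h3, zero_mul]
  have h3 : ∀ S ∈ (Finset.univ : Finset (Fin N)).powerset,
      (-1 : ℝ) ^ S.card * setExt μ (combMap v '' (simplexAt N m ∩ {x | ∀ i ∈ S, 1 ≤ x i})) =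
      (-1) ^ S.card * μ (((m - S.card : ℕ) : ℝ) • polyBody v) := by
    intro S _
    have hS : S.card ≤ m := ((Finset.card_le_univ S).trans (by simp)).trans hm
    congr 1
    rw [← hμ' _ (∑ i ∈ S, v i)]
    apply setExt_eq
    change _ = ((((m - S.card : ℕ) : ℝ) • polyBody v : ConvexBody E) : Set E) + {∑ i ∈ S, v i}
    rw [← image_simplexAt v (Nat.cast_nonneg _), Nat.cast_sub hS]
    let e : Fin N → ℝ := fun i => if i ∈ S then 1 else 0
    have he : combMap v e = ∑ i ∈ S, v i := by
      rw [combMap_apply]; simp [e, Finset.sum_ite_mem]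
    have hes : ∑ i, e i = S.card := by simp [e, Finset.sum_ite_mem]
    rw [← he, ← Set.image_singleton, ← Set.image_add]
    congr 1
    ext x
    rw [Set.add_singleton, Set.mem_image]
    constructor
    · rintro ⟨⟨hx, hxm⟩, hxS⟩
      rw [Set.mem_ofPred_eq] at hxS
      refine ⟨x - e, ⟨fun i => ?_, ?_⟩, by simp⟩
      · by_cases h : i ∈ S
        · simpa [e, h] using hxS i h
        · simpa [e, h] using hx i
      · simp only [Pi.sub_apply]
        rw [Finset.sum_sub_distrib, hxm, hes]
    · rintro ⟨y, ⟨hy, hym⟩, rfl⟩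
      refine ⟨⟨fun i => add_nonneg (hy i) (by simp only [e]; split_ifs <;> norm_num), ?_⟩, ?_⟩
      · simp only [Pi.add_apply]
        rw [Finset.sum_add_distrib, hym, hes]; ring
      · rw [Set.mem_ofPred_eq]
        intro i hi
        simpa [e, hi] using hy i
  rw [h2, Finset.sum_congr rfl h3,
    Finset.sum_powerset_apply_card
      (fun k => (-1 : ℝ) ^ k * μ (((m - k : ℕ) : ℝ) • polyBody v))] at key
  simpa using key

theorem exists_polynomial_of_fwdDiff_iter_eq_zero (F : ℕ → ℝ) (N : ℕ)
    (h : ∀ y, (fwdDiff 1)^[N] F y = 0) : ∃ p : Polynomial ℝ, ∀ j : ℕ, F j = p.eval (j : ℝ) := by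
  have h0 : ∀ k, N ≤ k → (fwdDiff 1)^[k] F 0 = 0 := by
    intro k hk
    obtain ⟨r, rfl⟩ := Nat.exists_eq_add_of_le' hk
    rw [Function.iterate_add_apply]
    have : (fwdDiff 1)^[N] F = fun _ => 0 := funext h
    rw [this]
    have : ∀ r : ℕ, (fwdDiff 1)^[r] (fun _ : ℕ => (0 : ℝ)) = fun _ => 0 := by
      intro r
      induction r with
      | zero => rfl
      | succ r ih => rw [Function.iterate_succ_apply', ih]; funext y; simp [fwdDiff]
    rw [this]
  refine ⟨∑ k ∈ Finset.range N,
    Polynomial.C ((fwdDiff 1)^[k] F 0 / (k.factorial : ℝ)) * descPochhammer ℝ k, fun j => ?_⟩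
  have h1 := shift_eq_sum_fwdDiff_iter (1 : ℕ) F j 0
  simp only [smul_eq_mul, mul_one, zero_add, nsmul_eq_mul] at h1
  rw [h1, Polynomial.eval_finsetSum]
  have h2 : ∀ k, (Polynomial.C ((fwdDiff 1)^[k] F 0 / (k.factorial : ℝ)) *
      descPochhammer ℝ k).eval (j : ℝ) = (j.choose k : ℝ) * (fwdDiff 1)^[k] F 0 := by
    intro k
    rw [Polynomial.eval_mul, Polynomial.eval_C, descPochhammer_eval_eq_descFactorial,
      Nat.descFactorial_eq_factorial_mul_choose]
    have : (k.factorial : ℝ) ≠ 0 := by positivity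
    push_cast
    field_simp
  simp only [h2]
  have h3 : ∀ M, ∑ k ∈ Finset.range (max (j + 1) M), (j.choose k : ℝ) * (fwdDiff 1)^[k] F 0 =
      ∑ k ∈ Finset.range (j + 1), (j.choose k : ℝ) * (fwdDiff 1)^[k] F 0 := by
    intro M
    refine (Finset.sum_subset (Finset.range_mono (le_max_left _ _)) fun k _ hk => ?_).symm
    rw [Nat.choose_eq_zero_of_lt (by simpa using hk)]; simp
  have h4 : ∑ k ∈ Finset.range (max (j + 1) N), (j.choose k : ℝ) * (fwdDiff 1)^[k] F 0 =
      ∑ k ∈ Finset.range N, (j.choose k : ℝ) * (fwdDiff 1)^[k] F 0 := by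
    refine (Finset.sum_subset (Finset.range_mono (le_max_right _ _)) fun k _ hk => ?_).symm
    rw [h0 k (by simpa using hk), mul_zero]
  rw [← h3 N, h4]

theorem exists_polynomial_polyBody {μ : ConvexBody E → ℝ} (hμ : IsValuation μ)
    (hμ' : TransInv μ) {N : ℕ} [NeZero N] (v : Fin N → E) :
    ∃ p : Polynomial ℝ, ∀ j : ℕ, μ ((j : ℝ) • polyBody v) = p.eval (j : ℝ) := by
  refine exists_polynomial_of_fwdDiff_iter_eq_zero (fun j : ℕ => μ ((j : ℝ) • polyBody v)) N
    fun y => ?_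
  rw [fwdDiff_iter_eq_sum_shift]
  have key := sum_choose_mul_polyBody hμ hμ' v (m := y + N) (by omega)
  rw [← Finset.sum_range_reflect] at key
  rw [← key]
  refine Finset.sum_congr rfl fun k hk => ?_
  have hk : k ≤ N := by simpa [Nat.lt_succ_iff] using hk
  rw [show N + 1 - 1 - k = N - k by omega, Nat.choose_symm hk,
    show y + N - (N - k) = y + k by omega]
  simp only [smul_eq_mul, mul_one, zsmul_eq_mul]
  push_cast
  ring

end Polytopes

section Compactness

variable {E : Type*} [NormedAddCommGroup E] [NormedSpace ℝ E]

/-- Blaschke selection: the bodies in a compact set form a compact set. -/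
theorem isCompact_setOf_body_subset {C : Set E} (hC : IsCompact C) :
    IsCompact {K : ConvexBody E | (K : Set E) ⊆ C} := by
  let ι : ConvexBody E → TopologicalSpace.NonemptyCompacts E := fun K =>
    ⟨⟨K, K.isCompact⟩, K.nonempty⟩
  have hdist : ∀ K L, dist (ι K) (ι L) = dist K L := by
    intro K L
    rw [Metric.NonemptyCompacts.dist_eq, ← ConvexBody.hausdorffDist_coe]
    rfl
  rw [isCompact_iff_isSeqCompact]
  intro K hK
  obtain ⟨L, hL, φ, hφ, hlim⟩ :=
    (TopologicalSpace.NonemptyCompacts.isCompact_subsets_of_isCompact hC).isSeqCompact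
      (x := fun j => ι (K j)) (fun j => hK j)
  have happ : ∀ ε > 0, ∃ j, dist (ι (K j)) L < ε := by
    intro ε hε
    obtain ⟨j, hj⟩ := (Metric.tendsto_atTop.1 hlim ε hε)
    exact ⟨φ j, hj j le_rfl⟩
  have hne : ∀ A B : TopologicalSpace.NonemptyCompacts E,
      Metric.hausdorffEDist (A : Set E) B ≠ ⊤ := fun A B =>
    Metric.hausdorffEDist_ne_top_of_nonempty_of_bounded A.nonempty B.nonempty
      A.isCompact.isBounded B.isCompact.isBounded
  have hconv : Convex ℝ (L : Set E) := by
    intro x hx y hy a b ha hb hab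
    have hcl : IsClosed (L : Set E) := L.isCompact.isClosed
    rw [← hcl.closure_eq, Metric.mem_closure_iff]
    intro ε hε
    obtain ⟨j, hj⟩ := happ (ε / 2) (by positivity)
    rw [Metric.NonemptyCompacts.dist_eq] at hj
    obtain ⟨x', hx', hxx⟩ := Metric.exists_dist_lt_of_hausdorffDist_lt' hx hj (hne _ _)
    obtain ⟨y', hy', hyy⟩ := Metric.exists_dist_lt_of_hausdorffDist_lt' hy hj (hne _ _)
    have hz : a • x' + b • y' ∈ (ι (K j) : Set E) := (K j).convex hx' hy' ha hb hab
    obtain ⟨z, hz', hzz⟩ := Metric.exists_dist_lt_of_hausdorffDist_lt hz hj (hne _ _)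
    refine ⟨z, hz', ?_⟩
    calc dist (a • x + b • y) z
        ≤ dist (a • x + b • y) (a • x' + b • y') + dist (a • x' + b • y') z :=
          dist_triangle _ _ _
      _ ≤ (dist (a • x) (a • x') + dist (b • y) (b • y')) + dist (a • x' + b • y') z := by
          gcongr; exact dist_add_add_le _ _ _ _
      _ = (a * dist x' x + b * dist y' y) + dist (a • x' + b • y') z := by
          rw [dist_smul₀, dist_smul₀, Real.norm_of_nonneg ha, Real.norm_of_nonneg hb,
            dist_comm x, dist_comm y]
      _ < (a * (ε / 2) + b * (ε / 2)) + ε / 2 := by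
          refine add_lt_add_of_le_of_lt (by gcongr) hzz
      _ = ε := by rw [← add_mul, hab]; ring
  refine ⟨⟨L, hconv, L.isCompact, L.nonempty⟩, hL, φ, hφ, ?_⟩
  rw [tendsto_iff_dist_tendsto_zero] at hlim ⊢
  refine hlim.congr fun j => ?_
  rw [← hdist]
  rfl

theorem exists_bound_of_subset_compact {μ : ConvexBody E → ℝ} (hμ : Continuous μ) {C : Set E}
    (hC : IsCompact C) : ∃ b, 0 ≤ b ∧ ∀ K : ConvexBody E, (K : Set E) ⊆ C → |μ K| ≤ b := by
  obtain ⟨b, hb⟩ := (isCompact_setOf_body_subset hC).exists_bound_of_continuousOn hμ.continuousOn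
  exact ⟨max b 0, le_max_right _ _, fun K hK => (hb K hK).trans (le_max_left _ _)⟩

end Compactness

section Growth

variable {n : ℕ}

theorem exists_bound_of_mem_box {μ : ConvexBody (Eucl n) → ℝ} (hμ : IsVal μ) :
    ∃ C, 0 ≤ C ∧ ∀ (s : ℕ) (k : Fin n → ℕ), ∑ i, k i = s → ∀ (a : Fin n → ℝ)
      (A : Set (Eucl n)), Convex ℝ A → IsCompact A →
      (∀ x ∈ A, ∀ i, a i ≤ x i ∧ x i ≤ a i + 2 ^ k i) → |setExt μ A| ≤ C * 3 ^ s := by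
  obtain ⟨C, hC0, hC⟩ := exists_bound_of_subset_compact hμ.cont
    (isCompact_closedBall (0 : Eucl n) n)
  refine ⟨C, hC0, fun s => ?_⟩
  induction s with
  | zero =>
    intro k hk a A hA hA' hbox
    have hk0 : ∀ i, k i = 0 := by simpa using hk
    rcases A.eq_empty_or_nonempty with rfl | hne
    · rw [setExt_empty]; simpa using hC0
    rw [pow_zero, mul_one, setExt, dif_pos ⟨hA, hA', hne⟩,
      ← hμ.trans _ (-(WithLp.toLp 2 a : Eucl n))]
    apply hC
    rintro _ ⟨x, hx, y, hy, rfl⟩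
    rw [Set.mem_singleton_iff.1 hy, mem_closedBall_zero_iff]
    change ‖x + -(WithLp.toLp 2 a : Eucl n)‖ ≤ n
    rw [EuclideanSpace.norm_eq]
    refine Real.sqrt_le_iff.2 ⟨Nat.cast_nonneg n, ?_⟩
    calc ∑ i, ‖(x + -(WithLp.toLp 2 a : Eucl n)) i‖ ^ 2 ≤ ∑ i : Fin n, (1 : ℝ) := by
          refine Finset.sum_le_sum fun i _ => ?_
          have := hbox x hx i
          rw [hk0, pow_zero] at this
          have h1 : (x + -(WithLp.toLp 2 a : Eucl n)) i = x i - a i := by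
            simp [sub_eq_add_neg]
          rw [h1, Real.norm_of_nonneg (by linarith)]
          nlinarith
      _ = n := by simp
      _ ≤ (n : ℝ) ^ 2 := by
          norm_cast
          exact Nat.le_self_pow two_ne_zero n
  | succ s ih =>
    intro k hk a A hA hA' hbox
    obtain ⟨i, hi⟩ : ∃ i, k i ≠ 0 := by
      by_contra h
      push Not at h
      simp [h] at hk
    obtain ⟨r, hr⟩ := Nat.exists_eq_succ_of_ne_zero hi
    let k' := Function.update k i r
    have hk' : ∑ j, k' j = s := by
      have h1 := Finset.add_sum_erase Finset.univ k (Finset.mem_univ i)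
      have h2 := Finset.add_sum_erase Finset.univ k' (Finset.mem_univ i)
      have h3 : ∑ j ∈ Finset.univ.erase i, k' j = ∑ j ∈ Finset.univ.erase i, k j :=
        Finset.sum_congr rfl fun j hj => Function.update_of_ne (Finset.ne_of_mem_erase hj) _ _
      have h4 : k' i = r := Function.update_self _ _ _
      rw [hk] at h1
      rw [h3, h4] at h2
      omega
    let l : Eucl n →L[ℝ] ℝ := EuclideanSpace.proj i
    have hl : ∀ x, l x = x i := fun x => rfl
    let c := a i + 2 ^ r
    let a' := Function.update a i c
    have hge : Convex ℝ (A ∩ {x | c ≤ l x}) :=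
      hA.inter (convex_halfSpace_ge l.isBoundedLinearMap.toIsLinearMap c)
    have kge : IsCompact (A ∩ {x | c ≤ l x}) :=
      hA'.inter_right (isClosed_le continuous_const l.continuous)
    have hle : Convex ℝ (A ∩ {x | l x ≤ c}) :=
      hA.inter (convex_halfSpace_le l.isBoundedLinearMap.toIsLinearMap c)
    have kle : IsCompact (A ∩ {x | l x ≤ c}) :=
      hA'.inter_right (isClosed_le l.continuous continuous_const)
    have heq : Convex ℝ (A ∩ {x | l x = c}) :=
      hA.inter (convex_hyperplane l.isBoundedLinearMap.toIsLinearMap c)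
    have keq : IsCompact (A ∩ {x | l x = c}) :=
      hA'.inter_right (isClosed_eq l.continuous continuous_const)
    have key := setExt_image_cut hμ.val (ContinuousLinearMap.id ℝ (Eucl n)) l c hA hA'
    have hid : ∀ B : Set (Eucl n), ContinuousLinearMap.id ℝ (Eucl n) '' B = B := Set.image_id
    simp only [hid] at key
    have h2 : ∀ x ∈ A, x i ≤ c + 2 ^ r := by
      intro x hx
      have := (hbox x hx i).2
      rw [hr, pow_succ] at this
      simp only [c]
      linarith
    have b1 := ih k' hk' a _ hle kle (by
      rintro x ⟨hx, hx'⟩ j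
      rw [Set.mem_ofPred_eq, hl] at hx'
      by_cases hj : j = i
      · subst hj
        simp only [k', Function.update_self]
        exact ⟨(hbox x hx j).1, hx'⟩
      · simp only [k', Function.update_of_ne hj]
        exact hbox x hx j)
    have b2 := ih k' hk' a' _ hge kge (by
      rintro x ⟨hx, hx'⟩ j
      rw [Set.mem_ofPred_eq, hl] at hx'
      by_cases hj : j = i
      · subst hj
        simp only [k', a', Function.update_self]
        exact ⟨hx', h2 x hx⟩
      · simp only [k', a', Function.update_of_ne hj]
        exact hbox x hx j)
    have b3 := ih k' hk' a' _ heq keq (by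
      rintro x ⟨hx, hx'⟩ j
      rw [Set.mem_ofPred_eq, hl] at hx'
      by_cases hj : j = i
      · subst hj
        simp only [k', a', Function.update_self]
        exact ⟨hx'.ge, h2 x hx⟩
      · simp only [k', a', Function.update_of_ne hj]
        exact hbox x hx j)
    rw [abs_le] at b1 b2 b3 ⊢
    rw [pow_succ]
    constructor <;> linarith [b1.1, b1.2, b2.1, b2.2, b3.1, b3.2]

theorem exists_growth {μ : ConvexBody (Eucl n) → ℝ} (hμ : IsVal μ) (K : ConvexBody (Eucl n)) :
    ∃ C, ∀ j : ℕ, |μ (((2 ^ j : ℕ) : ℝ) • K)| ≤ C * (3 ^ n) ^ j := by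
  obtain ⟨C, hC0, hC⟩ := exists_bound_of_mem_box hμ
  obtain ⟨R, hR⟩ := K.isCompact.isBounded.exists_norm_le
  obtain ⟨r, hr⟩ := pow_unbounded_of_one_lt (2 * |R|) (one_lt_two (α := ℝ))
  refine ⟨C * (3 ^ n) ^ r, fun j => ?_⟩
  have h1 := hC _ (fun _ => r + j) rfl (fun _ => -(2 ^ j * |R|))
    (((2 ^ j : ℕ) : ℝ) • K : ConvexBody (Eucl n)) (ConvexBody.convex _) (ConvexBody.isCompact _) (by
      rintro x hx i
      rw [ConvexBody.coe_smul] at hx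
      obtain ⟨y, hy, rfl⟩ := hx
      have h2 : |y i| ≤ |R| := (PiLp.norm_apply_le y i).trans ((hR y hy).trans (le_abs_self R))
      have h3 : ((((2 ^ j : ℕ) : ℝ) • y : Eucl n) i) = 2 ^ j * y i := by simp
      change -(2 ^ j * |R|) ≤ (((2 ^ j : ℕ) : ℝ) • y : Eucl n) i ∧
        (((2 ^ j : ℕ) : ℝ) • y : Eucl n) i ≤ -(2 ^ j * |R|) + 2 ^ (r + j)
      rw [h3, pow_add]
      have h4 : (0 : ℝ) < 2 ^ j := by positivity
      rw [abs_le] at h2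
      constructor <;> nlinarith)
  rw [setExt_coe] at h1
  refine h1.trans_eq ?_
  simp only [Finset.sum_const, Finset.card_univ, Fintype.card_fin, smul_eq_mul]
  rw [← pow_mul, ← pow_mul, mul_assoc, ← pow_add]
  congr 2
  ring

open Filter Topology in
theorem natDegree_le_of_growth (p : Polynomial ℝ) (C : ℝ)
    (h : ∀ j : ℕ, |p.eval ((2 ^ j : ℕ) : ℝ)| ≤ C * (3 ^ n) ^ j) : p.natDegree ≤ 2 * n := by
  by_contra hlt
  push Not at hlt
  have hdeg : (Polynomial.X ^ (2 * n) : Polynomial ℝ).degree < p.degree := by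
    rw [Polynomial.degree_X_pow]
    refine lt_of_lt_of_le (by exact_mod_cast hlt) (Polynomial.degree_eq_natDegree ?_).ge
    rintro rfl
    simp at hlt
  have h1 := Polynomial.abs_div_tendsto_atTop_atTop_of_degree_gt p _ hdeg
    (pow_ne_zero _ Polynomial.X_ne_zero)
  have h2 : Tendsto (fun j : ℕ => ((2 ^ j : ℕ) : ℝ)) atTop atTop := by
    push_cast
    exact tendsto_pow_atTop_atTop_of_one_lt one_lt_two
  obtain ⟨j, hj⟩ := ((h1.comp h2).eventually_gt_atTop C).exists
  simp only [Function.comp, Polynomial.eval_pow, Polynomial.eval_X] at hj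
  have h3 : (0 : ℝ) < ((2 ^ j : ℕ) : ℝ) ^ (2 * n) := by positivity
  rw [abs_div, abs_of_pos h3, lt_div_iff₀ h3] at hj
  have hC : 0 ≤ C := by
    have := (abs_nonneg _).trans (h 0)
    simpa using this
  have h4 : ((3 : ℝ) ^ n) ^ j ≤ ((2 ^ j : ℕ) : ℝ) ^ (2 * n) := by
    push_cast
    rw [← pow_mul, ← pow_mul, show j * (2 * n) = 2 * (n * j) by ring, pow_mul 2 2]
    gcongr
    norm_num
  have := h j
  have : C * (3 ^ n) ^ j ≤ C * ((2 ^ j : ℕ) : ℝ) ^ (2 * n) := by gcongr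
  linarith

end Growth

section PolytopeDensity

variable {E : Type*} [NormedAddCommGroup E] [InnerProductSpace ℝ E]

theorem exists_polyBody_dist_le (K : ConvexBody E) {ε : ℝ} (hε : 0 < ε) :
    ∃ (N : ℕ) (_ : NeZero N) (v : Fin N → E), dist (polyBody v) K ≤ ε := by
  obtain ⟨t, htK, htfin, hcov⟩ := K.isCompact.finite_cover_balls hε
  obtain ⟨x0, hx0⟩ := K.nonempty
  have hne : t.Nonempty := by
    obtain ⟨i, hi, -⟩ := Set.mem_iUnion₂.1 (hcov hx0)
    exact ⟨i, hi⟩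
  obtain ⟨N, v, hv⟩ : ∃ (N : ℕ) (v : Fin N → E), Set.range v = t := by
    obtain ⟨N, v, -, hv⟩ := htfin.fin_param
    exact ⟨N, v, hv⟩
  have hN : NeZero N := by
    refine ⟨?_⟩
    rintro rfl
    rw [← hv, Set.range_eq_empty] at hne
    exact Set.not_nonempty_empty hne
  refine ⟨N, hN, v, ?_⟩
  rw [← ConvexBody.hausdorffDist_coe, coe_polyBody_eq_convexHull, hv]
  refine Metric.hausdorffDist_le_of_mem_dist hε.le (fun x hx => ?_) fun x hx => ?_
  · exact ⟨x, convexHull_min htK K.convex hx, by simpa using hε.le⟩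
  · obtain ⟨i, hi, hxi⟩ := Set.mem_iUnion₂.1 (hcov hx)
    exact ⟨i, subset_convexHull ℝ t hi, (Metric.mem_ball.1 hxi).le⟩

end PolytopeDensity

section BodyAlgebra

variable {E : Type*} [NormedAddCommGroup E] [InnerProductSpace ℝ E] [CompleteSpace E]

theorem dist_add_body_le (K L M : ConvexBody E) : dist (K + L) (K + M) ≤ dist L M :=
  dist_le_of_abs_supportFn_sub_le dist_nonneg fun x => by
    rw [supportFn_add, supportFn_add, add_sub_add_left_eq_sub]
    exact abs_supportFn_sub_le L M x

theorem continuous_add_body (K : ConvexBody E) : Continuous fun L => K + L :=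
  (LipschitzWith.of_dist_le_mul (K := 1) fun L M => by
    rw [NNReal.coe_one, one_mul]; exact dist_add_body_le K L M).continuous

theorem dist_smul_body_le {t : ℝ} (ht : 0 ≤ t) (K L : ConvexBody E) :
    dist (t • K) (t • L) ≤ t * dist K L :=
  dist_le_of_abs_supportFn_sub_le (by positivity) fun x => by
    rw [supportFn_smul ht, supportFn_smul ht, ← mul_sub, abs_mul, abs_of_nonneg ht, mul_assoc]
    gcongr
    exact abs_supportFn_sub_le K L x

theorem exists_dist_smul_body_le (K : ConvexBody E) :
    ∃ R, 0 ≤ R ∧ ∀ s t : ℝ, 0 ≤ s → 0 ≤ t → dist (s • K) (t • K) ≤ |s - t| * R := by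
  refine ⟨dist K 0, dist_nonneg, fun s t hs ht => ?_⟩
  refine dist_le_of_abs_supportFn_sub_le (by positivity) fun x => ?_
  rw [supportFn_smul hs, supportFn_smul ht, ← sub_mul, abs_mul, mul_assoc]
  gcongr
  have h0 : supportFn (0 : ConvexBody E) x = 0 := by
    have := supportFn_smul (le_refl (0 : ℝ)) (0 : ConvexBody E) x
    simpa using this
  have := abs_supportFn_sub_le K 0 x
  rwa [h0, sub_zero] at this

theorem IsVal.add_left {μ : ConvexBody E → ℝ} (hμ : IsVal μ) (K : ConvexBody E) :
    IsVal fun L => μ (K + L) where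
  val A B M I hM hI := by
    have h1 := union_inter_of_supportFn_max_min (K := K + A) (L := K + B) (M := K + M) (I := K + I)
      (fun x => by
        rw [supportFn_add, supportFn_add, supportFn_add, (supportFn_union_inter hM hI x).1,
          max_add_add_left])
      (fun x => by
        rw [supportFn_add, supportFn_add, supportFn_add, (supportFn_union_inter hM hI x).2,
          min_add_add_left])
    exact hμ.val _ _ _ _ h1.1 h1.2
  cont := hμ.cont.comp (continuous_add_body K)
  trans L x := by
    change μ (K + L.translate x) = μ (K + L)
    rw [← hμ.trans (K + L) x]
    congr 1
    apply ConvexBody.ext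
    change (K : Set E) + ((L : Set E) + {x}) = ((K + L : ConvexBody E) : Set E) + {x}
    rw [ConvexBody.coe_add, add_assoc]

end BodyAlgebra

section LagrangeForm

/-- Lagrange basis polynomials for the nodes `0, …, d`. -/
def lagBasis (d i : ℕ) : Polynomial ℝ :=
  Lagrange.basis (Finset.range (d + 1)) (fun j : ℕ => (j : ℝ)) i

theorem Polynomial.eval_eq_sum_lagBasis {p : Polynomial ℝ} {d : ℕ} (hp : p.natDegree ≤ d) (t : ℝ) :
    p.eval t = ∑ i ∈ Finset.range (d + 1), p.eval (i : ℝ) * (lagBasis d i).eval t := by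
  have h := Lagrange.eq_interpolate (s := Finset.range (d + 1)) (v := fun j : ℕ => (j : ℝ))
    (f := p) (Nat.cast_injective.injOn) (by
      rw [Finset.card_range]
      exact lt_of_le_of_lt Polynomial.degree_le_natDegree (by exact_mod_cast Nat.lt_succ_of_le hp))
  conv_lhs => rw [h]
  rw [Lagrange.interpolate_apply, Polynomial.eval_finsetSum]
  simp [lagBasis]

theorem natDegree_lagBasis_le (d i : ℕ) (hi : i ∈ Finset.range (d + 1)) :
    (lagBasis d i).natDegree ≤ d := by
  rw [lagBasis, Lagrange.natDegree_basis (Nat.cast_injective.injOn) hi]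
  simp

theorem lagBasis_eval_nat (d : ℕ) {i j : ℕ} (hj : j ∈ Finset.range (d + 1)) :
    (lagBasis d i).eval (j : ℝ) = if i = j then 1 else 0 := by
  split_ifs with h
  · subst h
    exact Lagrange.eval_basis_self (v := fun j : ℕ => (j : ℝ)) (Nat.cast_injective.injOn) hj
  · exact Lagrange.eval_basis_of_ne (v := fun j : ℕ => (j : ℝ)) h hj

end LagrangeForm

section Polynomiality

variable {n : ℕ}

theorem exists_polynomial_smul_polyBody {μ : ConvexBody (Eucl n) → ℝ} (hμ : IsVal μ)
    {N : ℕ} [NeZero N] (v : Fin N → Eucl n) :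
    ∃ p : Polynomial ℝ, p.natDegree ≤ 2 * n ∧
      ∀ j : ℕ, μ ((j : ℝ) • polyBody v) = p.eval (j : ℝ) := by
  obtain ⟨p, hp⟩ := exists_polynomial_polyBody hμ.val hμ.trans v
  obtain ⟨C, hC⟩ := exists_growth hμ (polyBody v)
  exact ⟨p, natDegree_le_of_growth p C fun j => hp (2 ^ j) ▸ hC j, hp⟩

theorem smul_polyBody {N : ℕ} [NeZero N] (c : ℝ) (v : Fin N → Eucl n) :
    c • polyBody v = polyBody fun i => c • v i := by
  apply ConvexBody.ext
  rw [ConvexBody.coe_smul, coe_polyBody, coe_polyBody, ← Set.image_smul, Set.image_image]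
  refine Set.image_congr fun x _ => ?_
  rw [combMap_apply, combMap_apply, Finset.smul_sum]
  exact Finset.sum_congr rfl fun i _ => smul_comm _ _ _

theorem continuousOn_smul_body {μ : ConvexBody (Eucl n) → ℝ} (hμ : Continuous μ)
    (K : ConvexBody (Eucl n)) : ContinuousOn (fun t : ℝ => μ (t • K)) (Set.Ici 0) := by
  refine hμ.comp_continuousOn ?_
  obtain ⟨R, hR, h⟩ := exists_dist_smul_body_le K
  refine LipschitzOnWith.continuousOn (K := ⟨R, hR⟩) (LipschitzOnWith.of_dist_le_mul ?_)
  intro s hs t ht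
  rw [mul_comm]
  exact h s t hs ht

theorem IsVal.smul_polyBody_eq {μ : ConvexBody (Eucl n) → ℝ} (hμ : IsVal μ)
    {N : ℕ} [NeZero N] (v : Fin N → Eucl n) {t : ℝ} (ht : 0 ≤ t) :
    μ (t • polyBody v) = ∑ i ∈ Finset.range (2 * n + 1),
      μ ((i : ℝ) • polyBody v) * (lagBasis (2 * n) i).eval t := by
  obtain ⟨p, hp, hpj⟩ := exists_polynomial_smul_polyBody hμ v
  have hrat : ∀ a b : ℕ, b ≠ 0 → μ (((a : ℝ) / b) • polyBody v) = p.eval ((a : ℝ) / b) := by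
    intro a b hb
    have hb' : (b : ℝ) ≠ 0 := by exact_mod_cast hb
    obtain ⟨q, hq, hqj⟩ := exists_polynomial_smul_polyBody hμ fun i => (b : ℝ)⁻¹ • v i
    simp only [← smul_polyBody, smul_smul] at hqj
    have hqp : q.comp (Polynomial.C (b : ℝ) * Polynomial.X) = p := by
      refine Polynomial.eq_of_infinite_eval_eq _ _ ?_
      refine (Set.infinite_range_of_injective (Nat.cast_injective (R := ℝ))).mono ?_
      rintro _ ⟨j, rfl⟩
      rw [Set.mem_ofPred_eq, Polynomial.eval_comp, Polynomial.eval_mul, Polynomial.eval_C,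
        Polynomial.eval_X, ← hpj, ← Nat.cast_mul, ← hqj]
      congr 2
      push_cast
      field_simp
    rw [div_eq_mul_inv, hqj, ← hqp, Polynomial.eval_comp, Polynomial.eval_mul, Polynomial.eval_C,
        Polynomial.eval_X]
    congr 1
    field_simp
  have hreal : ∀ t : ℝ, 0 ≤ t → μ (t • polyBody v) = p.eval t := by
    have h1 : Set.EqOn (fun t : ℝ => μ (t • polyBody v)) (fun t => p.eval t) (Set.Ici 0) := by
      refine Set.EqOn.of_subset_closure (s := Set.Ici 0 ∩ Set.range ((↑) : ℚ → ℝ)) ?_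
        (continuousOn_smul_body hμ.cont _) p.continuousOn Set.inter_subset_left ?_
      · rintro _ ⟨hq, ⟨q, rfl⟩⟩
        have hq : 0 ≤ q := by exact_mod_cast Set.mem_Ici.1 hq
        have h2 := hrat q.num.toNat q.den q.den_nz
        have h3 : ((q.num.toNat : ℝ) / (q.den : ℝ)) = (q : ℝ) := by
          have : ((q.num.toNat : ℤ) : ℝ) = (q.num : ℝ) := by
            rw [Int.toNat_of_nonneg (Rat.num_nonneg.2 hq)]
          rw [Int.cast_natCast] at this
          rw [this, Rat.cast_def]
        rw [h3] at h2
        exact h2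
      · intro x hx
        have hx : 0 ≤ x := hx
        rw [Metric.mem_closure_iff]
        intro ε hε
        obtain ⟨q, hq1, hq2⟩ := exists_rat_btwn (show x < x + ε by linarith)
        refine ⟨q, ⟨(hx.trans hq1.le), ⟨q, rfl⟩⟩, ?_⟩
        rw [Real.dist_eq, abs_lt]
        constructor <;> linarith
    exact fun t ht => h1 ht
  rw [hreal t ht, Polynomial.eval_eq_sum_lagBasis hp]
  exact Finset.sum_congr rfl fun i _ => by rw [hpj]

theorem IsVal.smul_eq {μ : ConvexBody (Eucl n) → ℝ} (hμ : IsVal μ) (K : ConvexBody (Eucl n))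
    {t : ℝ} (ht : 0 ≤ t) :
    μ (t • K) = ∑ i ∈ Finset.range (2 * n + 1),
      μ ((i : ℝ) • K) * (lagBasis (2 * n) i).eval t := by
  have hc : ∀ t : ℝ, 0 ≤ t → Continuous fun K : ConvexBody (Eucl n) => μ (t • K) := fun t ht =>
    hμ.cont.comp (LipschitzWith.of_dist_le_mul (K := ⟨t, ht⟩)
      fun K L => dist_smul_body_le ht K L).continuous
  have hcl : IsClosed {K : ConvexBody (Eucl n) | μ (t • K) = ∑ i ∈ Finset.range (2 * n + 1),
      μ ((i : ℝ) • K) * (lagBasis (2 * n) i).eval t} :=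
    isClosed_eq (hc t ht) (continuous_finsetSum _ fun i _ =>
      (hc i (Nat.cast_nonneg i)).mul continuous_const)
  have : K ∈ closure {K : ConvexBody (Eucl n) | μ (t • K) = ∑ i ∈ Finset.range (2 * n + 1),
      μ ((i : ℝ) • K) * (lagBasis (2 * n) i).eval t} := by
    rw [Metric.mem_closure_iff]
    intro ε hε
    obtain ⟨N, hN, v, hv⟩ := exists_polyBody_dist_le K (half_pos hε)
    exact ⟨polyBody v, hμ.smul_polyBody_eq v ht, by rw [dist_comm]; linarith⟩
  rwa [hcl.closure_eq] at this

theorem IsVal.add_smul_eq {μ : ConvexBody (Eucl n) → ℝ} (hμ : IsVal μ) (K L : ConvexBody (Eucl n))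
    {t : ℝ} (ht : 0 ≤ t) :
    μ (K + t • L) = ∑ i ∈ Finset.range (2 * n + 1),
      μ (K + (i : ℝ) • L) * (lagBasis (2 * n) i).eval t :=
  (hμ.add_left K).smul_eq L ht

end Polynomiality

section BodyOf

variable {E : Type*} [NormedAddCommGroup E] [InnerProductSpace ℝ E] [FiniteDimensional ℝ E]

open Classical in
/-- The convex body with a given sublinear support function. -/
def bodyOf (f : E → ℝ) : ConvexBody E :=
  if h : IsSublinear f then h.exists_supportFn_eq.choose else 0

theorem supportFn_bodyOf {f : E → ℝ} (h : IsSublinear f) : supportFn (bodyOf f) = f := by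
  rw [bodyOf, dif_pos h]
  exact h.exists_supportFn_eq.choose_spec

theorem bodyOf_supportFn (K : ConvexBody E) : bodyOf (supportFn K) = K :=
  supportFn_injective (supportFn_bodyOf (isSublinear_supportFn K))

theorem bodyOf_add {f g : E → ℝ} (hf : IsSublinear f) (hg : IsSublinear g) :
    bodyOf (fun x => f x + g x) = bodyOf f + bodyOf g := by
  refine supportFn_injective (funext fun x => ?_)
  rw [supportFn_bodyOf (hf.add hg), supportFn_add, supportFn_bodyOf hf, supportFn_bodyOf hg]

theorem bodyOf_mul {f : E → ℝ} (hf : IsSublinear f) {t : ℝ} (ht : 0 ≤ t) :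
    bodyOf (fun x => t * f x) = t • bodyOf f := by
  refine supportFn_injective (funext fun x => ?_)
  rw [supportFn_bodyOf (hf.const_mul ht), supportFn_smul ht, supportFn_bodyOf hf]

theorem dist_bodyOf_le {f g : E → ℝ} (hf : IsSublinear f) (hg : IsSublinear g) {r : ℝ}
    (hr : 0 ≤ r) (h : ∀ x, |f x - g x| ≤ r * ‖x‖) : dist (bodyOf f) (bodyOf g) ≤ r :=
  dist_le_of_abs_supportFn_sub_le hr fun x => by
    rw [supportFn_bodyOf hf, supportFn_bodyOf hg]; exact h x

theorem bodyOf_subset_closedBall {f : E → ℝ} (hf : IsSublinear f) {r : ℝ} (hr : 0 ≤ r)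
    (h : ∀ x, f x ≤ r * ‖x‖) : (bodyOf f : Set E) ⊆ Metric.closedBall 0 r := by
  intro y hy
  have h1 := inner_le_supportFn (K := bodyOf f) hy y
  rw [supportFn_bodyOf hf, real_inner_self_eq_norm_sq] at h1
  rw [mem_closedBall_zero_iff]
  by_contra hlt
  push Not at hlt
  nlinarith [h y, mul_lt_mul_of_pos_right hlt (hr.trans_lt hlt)]

end BodyOf

section NormBound

variable {E : Type*} [NormedAddCommGroup E] [InnerProductSpace ℝ E]

/-- `SemiSublinear f c` says that `f + c‖·‖` is sublinear. -/
def SemiSublinear (f : E → ℝ) (c : ℝ) : Prop := IsSublinear fun x => f x + c * ‖x‖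

theorem SemiSublinear.mono {f : E → ℝ} {c c' : ℝ} (h : SemiSublinear f c) (hc : c ≤ c') :
    SemiSublinear f c' := by
  have := IsSublinear.add h (isSublinear_norm.const_mul (sub_nonneg.2 hc))
  have e : (fun x => f x + c' * ‖x‖) = fun x => f x + c * ‖x‖ + (c' - c) * ‖x‖ := by
    funext x; ring
  rwa [SemiSublinear, e]

theorem SemiSublinear.add {f g : E → ℝ} {c c' : ℝ} (h : SemiSublinear f c)
    (h' : SemiSublinear g c') : SemiSublinear (f + g) (c + c') := by
  have := IsSublinear.add h h'
  have e : (fun x => (f + g) x + (c + c') * ‖x‖) =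
      fun x => f x + c * ‖x‖ + (g x + c' * ‖x‖) := by
    funext x; rw [Pi.add_apply]; ring
  rwa [SemiSublinear, e]

theorem SemiSublinear.smul {f : E → ℝ} {c t : ℝ} (h : SemiSublinear f c) (ht : 0 ≤ t) :
    SemiSublinear (t • f) (t * c) := by
  have := IsSublinear.const_mul h ht
  have e : (fun x => (t • f) x + t * c * ‖x‖) = fun x => t * (f x + c * ‖x‖) := by
    funext x; rw [Pi.smul_apply, smul_eq_mul]; ring
  rwa [SemiSublinear, e]

/-- `NormBound f c`: both `f` and `-f` become sublinear after adding `c‖·‖`, and `|f| ≤ c‖·‖`. -/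
structure NormBound (f : E → ℝ) (c : ℝ) : Prop where
  nonneg : 0 ≤ c
  bound : ∀ x, |f x| ≤ c * ‖x‖
  pos : SemiSublinear f c
  neg : SemiSublinear (-f) c

theorem NormBound.mono {f : E → ℝ} {c c' : ℝ} (h : NormBound f c) (hc : c ≤ c') :
    NormBound f c' :=
  ⟨h.nonneg.trans hc, fun x => (h.bound x).trans (by gcongr), h.pos.mono hc, h.neg.mono hc⟩

theorem NormBound.add {f g : E → ℝ} {c c' : ℝ} (h : NormBound f c) (h' : NormBound g c') :
    NormBound (f + g) (c + c') :=
  ⟨add_nonneg h.nonneg h'.nonneg,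
    fun x => (abs_add_le _ _).trans (by rw [add_mul]; exact add_le_add (h.bound x) (h'.bound x)),
    h.pos.add h'.pos, by rw [neg_add]; exact h.neg.add h'.neg⟩

theorem NormBound.neg' {f : E → ℝ} {c : ℝ} (h : NormBound f c) : NormBound (-f) c :=
  ⟨h.nonneg, fun x => by rw [Pi.neg_apply, abs_neg]; exact h.bound x, h.neg,
    by rw [neg_neg]; exact h.pos⟩

theorem NormBound.smul {f : E → ℝ} {c : ℝ} (h : NormBound f c) (t : ℝ) :
    NormBound (t • f) (|t| * c) := by
  wlog ht : 0 ≤ t generalizing t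
  · have := (this (-t) (by linarith)).neg'
    rwa [neg_smul, neg_neg, abs_neg] at this
  rw [abs_of_nonneg ht]
  refine ⟨mul_nonneg ht h.nonneg, fun x => ?_, h.pos.smul ht, ?_⟩
  · rw [Pi.smul_apply, smul_eq_mul, abs_mul, abs_of_nonneg ht, mul_assoc]
    exact mul_le_mul_of_nonneg_left (h.bound x) ht
  · rw [← smul_neg]; exact h.neg.smul ht

theorem normBound_zero : NormBound (0 : E → ℝ) 0 := by
  have : SemiSublinear (0 : E → ℝ) 0 := ⟨fun x y => by simp, fun t x _ => by simp⟩
  exact ⟨le_rfl, fun x => by simp, this, by rwa [neg_zero]⟩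

theorem NormBound.sum {ι : Type*} (s : Finset ι) {f : ι → E → ℝ} {c : ι → ℝ}
    (h : ∀ i ∈ s, NormBound (f i) (c i)) : NormBound (∑ i ∈ s, f i) (∑ i ∈ s, c i) := by
  classical
  induction s using Finset.induction_on with
  | empty => simpa using normBound_zero
  | insert a s ha ih =>
    rw [Finset.sum_insert ha, Finset.sum_insert ha]
    exact (h a (Finset.mem_insert_self a s)).add
      (ih fun i hi => h i (Finset.mem_insert_of_mem hi))

end NormBound

section Extension

variable {n : ℕ}

/-- The extension of a valuation to `f`, computed from the bodies with support functions
`f + (c + i)‖·‖`. -/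
def extValAt (μ : ConvexBody (Eucl n) → ℝ) (c : ℝ) (f : Eucl n → ℝ) : ℝ :=
  ∑ i ∈ Finset.range (2 * n + 1),
    μ (bodyOf fun x => f x + (c + i) * ‖x‖) * (lagBasis (2 * n) i).eval (-c)

open Classical in
/-- The polynomial extension of a valuation from support functions to all functions
`f` for which some `f + c‖·‖` is a support function. -/
def extVal (μ : ConvexBody (Eucl n) → ℝ) (f : Eucl n → ℝ) : ℝ :=
  if h : ∃ c, SemiSublinear f c then extValAt μ h.choose f else 0

variable {μ : ConvexBody (Eucl n) → ℝ}

theorem IsVal.bodyOf_add_eq (hμ : IsVal μ) {f : Eucl n → ℝ} {c t : ℝ} (h : SemiSublinear f c)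
    (ht : 0 ≤ t) : μ (bodyOf fun x => f x + (c + t) * ‖x‖) = ∑ i ∈ Finset.range (2 * n + 1),
      μ (bodyOf fun x => f x + (c + i) * ‖x‖) * (lagBasis (2 * n) i).eval t := by
  have key : ∀ t : ℝ, 0 ≤ t → (bodyOf fun x => f x + (c + t) * ‖x‖) =
      (bodyOf fun x => f x + c * ‖x‖) + t • bodyOf (fun x : Eucl n => ‖x‖) := by
    intro t ht
    rw [← bodyOf_mul isSublinear_norm ht, ← bodyOf_add h (isSublinear_norm.const_mul ht)]
    congr 1
    funext x
    ring
  rw [key t ht, hμ.add_smul_eq _ _ ht]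
  refine Finset.sum_congr rfl fun i _ => ?_
  rw [key i (Nat.cast_nonneg i)]

theorem IsVal.extValAt_eq (hμ : IsVal μ) {f : Eucl n → ℝ} {c c' : ℝ} (h : SemiSublinear f c)
    (hc : c ≤ c') : extValAt μ c' f = extValAt μ c f := by
  let p : Polynomial ℝ := ∑ i ∈ Finset.range (2 * n + 1),
      Polynomial.C (μ (bodyOf fun x => f x + (c + i) * ‖x‖)) * lagBasis (2 * n) i
  have hp : ∀ t, p.eval t = ∑ i ∈ Finset.range (2 * n + 1),
      μ (bodyOf fun x => f x + (c + i) * ‖x‖) * (lagBasis (2 * n) i).eval t := by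
    intro t; simp [p, Polynomial.eval_finsetSum]
  have hdeg : p.natDegree ≤ 2 * n :=
    Polynomial.natDegree_sum_le_of_forall_le _ _ fun i hi =>
      (Polynomial.natDegree_C_mul_le _ _).trans (natDegree_lagBasis_le _ _ hi)
  let q := p.comp (Polynomial.X + Polynomial.C (c' - c))
  have hq : q.natDegree ≤ 2 * n := by
    refine Polynomial.natDegree_comp_le.trans ?_
    rw [Polynomial.natDegree_X_add_C, mul_one]
    exact hdeg
  have hqe : ∀ t, q.eval t = p.eval (t + (c' - c)) := fun t => by
    simp [q, Polynomial.eval_comp]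
  have h1 : extValAt μ c f = p.eval (-c) := (hp _).symm
  have h2 : extValAt μ c' f = q.eval (-c') := by
    rw [Polynomial.eval_eq_sum_lagBasis hq, extValAt]
    refine Finset.sum_congr rfl fun i _ => ?_
    rw [hqe, hp, ← hμ.bodyOf_add_eq h (add_nonneg (Nat.cast_nonneg i) (sub_nonneg.2 hc))]
    congr 4
    funext x
    ring
  rw [h1, h2, hqe]
  congr 1
  ring

theorem IsVal.extVal_eq (hμ : IsVal μ) {f : Eucl n → ℝ} {c : ℝ} (h : SemiSublinear f c) :
    extVal μ f = extValAt μ c f := by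
  have hex : ∃ c, SemiSublinear f c := ⟨c, h⟩
  rw [extVal, dif_pos hex]
  rcases le_total c hex.choose with h' | h'
  · exact hμ.extValAt_eq h h'
  · exact (hμ.extValAt_eq hex.choose_spec h').symm

theorem IsVal.extVal_of_isSublinear (hμ : IsVal μ) {f : Eucl n → ℝ} (h : IsSublinear f) :
    extVal μ f = μ (bodyOf f) := by
  have h0 : SemiSublinear f 0 := by
    rw [SemiSublinear]; simpa using h
  rw [hμ.extVal_eq h0, extValAt, Finset.sum_eq_single 0]
  · rw [neg_zero, ← Nat.cast_zero (R := ℝ), lagBasis_eval_nat (j := 0) _ (by simp)]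
    simp
  · intro i hi hi0
    rw [neg_zero, ← Nat.cast_zero (R := ℝ), lagBasis_eval_nat (j := 0) _ (by simp),
      if_neg hi0, mul_zero, Nat.cast_zero]
  · simp

theorem IsVal.extVal_linear_combination {ι : Type*} (s : Finset ι)
    {ν : ι → ConvexBody (Eucl n) → ℝ} (hν : ∀ i ∈ s, IsVal (ν i)) (a : ι → ℝ)
    (hμ : IsVal fun K => ∑ i ∈ s, a i * ν i K) {f : Eucl n → ℝ} {c : ℝ} (h : SemiSublinear f c) :
    extVal (fun K => ∑ i ∈ s, a i * ν i K) f = ∑ i ∈ s, a i * extVal (ν i) f := by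
  rw [hμ.extVal_eq h, Finset.sum_congr rfl fun i hi => by rw [(hν i hi).extVal_eq h]]
  simp only [extValAt, Finset.mul_sum, Finset.sum_mul]
  rw [Finset.sum_comm]
  exact Finset.sum_congr rfl fun _ _ => Finset.sum_congr rfl fun _ _ => by ring

theorem IsVal.exists_bound_extVal (hμ : IsVal μ) (r : ℝ) :
    ∃ C, 0 ≤ C ∧ ∀ f, NormBound f r → |extVal μ f| ≤ C := by
  obtain ⟨b, hb0, hb⟩ := exists_bound_of_subset_compact hμ.cont
    (isCompact_closedBall (0 : Eucl n) (2 * r + 2 * n))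
  refine ⟨∑ i ∈ Finset.range (2 * n + 1), b * |(lagBasis (2 * n) i).eval (-r)|,
    by positivity, fun f hf => ?_⟩
  rw [hμ.extVal_eq hf.pos, extValAt]
  refine (Finset.abs_sum_le_sum_abs _ _).trans (Finset.sum_le_sum fun i hi => ?_)
  rw [abs_mul]
  gcongr
  apply hb
  apply bodyOf_subset_closedBall (hf.pos.mono (by linarith [(Nat.cast_nonneg i : (0 : ℝ) ≤ i)]))
    (by have := hf.nonneg; positivity)
  intro x
  have h1 := (abs_le.1 (hf.bound x)).2
  have h2 : (i : ℝ) ≤ 2 * n := by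
    have := Finset.mem_range.1 hi
    exact_mod_cast Nat.lt_succ_iff.1 this
  nlinarith [norm_nonneg x]

open Filter Topology in
theorem IsVal.tendsto_extVal (hμ : IsVal μ) {f : ℕ → Eucl n → ℝ} {g : Eucl n → ℝ} {c : ℝ}
    (hf : ∀ k, SemiSublinear (f k) c) (hg : SemiSublinear g c) {ε : ℕ → ℝ}
    (hε : Tendsto ε atTop (𝓝 0)) (h : ∀ k x, |f k x - g x| ≤ ε k * ‖x‖) :
    Tendsto (fun k => extVal μ (f k)) atTop (𝓝 (extVal μ g)) := by
  rw [hμ.extVal_eq hg]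
  simp only [fun k => hμ.extVal_eq (hf k)]
  refine tendsto_finsetSum _ fun i _ => Tendsto.mul_const _ ?_
  refine (hμ.cont.tendsto _).comp ?_
  rw [tendsto_iff_dist_tendsto_zero]
  have hi : c ≤ c + i := by linarith [(Nat.cast_nonneg i : (0 : ℝ) ≤ i)]
  refine squeeze_zero (fun _ => dist_nonneg) (fun k => ?_) (hε.abs.trans (by simp))
  refine dist_bodyOf_le ((hf k).mono hi) (hg.mono hi) (abs_nonneg _) fun x => ?_
  rw [add_sub_add_right_eq_sub]
  exact (h k x).trans (by gcongr; exact le_abs_self _)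

theorem IsVal.extVal_add_add (hμ : IsVal μ) {f φ R : Eucl n → ℝ} {c : ℝ}
    (h0 : SemiSublinear f c) (h1 : SemiSublinear (f + φ) c) (h2 : SemiSublinear (f + R) c)
    (h3 : SemiSublinear (f + φ + R) c) (hφ : ∀ x, 0 ≤ φ x) (hR : ∀ x, 0 ≤ R x)
    (hφR : ∀ x, φ x = 0 ∨ R x = 0) :
    extVal μ (f + φ + R) + extVal μ f = extVal μ (f + φ) + extVal μ (f + R) := by
  rw [hμ.extVal_eq h0, hμ.extVal_eq h1, hμ.extVal_eq h2, hμ.extVal_eq h3]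
  simp only [extValAt]
  rw [← Finset.sum_add_distrib, ← Finset.sum_add_distrib]
  refine Finset.sum_congr rfl fun i _ => ?_
  rw [← add_mul, ← add_mul]
  congr 1
  have hi : c ≤ c + i := by linarith [(Nat.cast_nonneg i : (0 : ℝ) ≤ i)]
  have key := union_inter_of_supportFn_max_min
    (K := bodyOf fun x => (f + φ) x + (c + i) * ‖x‖)
    (L := bodyOf fun x => (f + R) x + (c + i) * ‖x‖)
    (M := bodyOf fun x => (f + φ + R) x + (c + i) * ‖x‖) (I := bodyOf fun x => f x + (c + i) * ‖x‖)
    (fun x => by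
      rw [supportFn_bodyOf (h1.mono hi), supportFn_bodyOf (h2.mono hi),
          supportFn_bodyOf (h3.mono hi)]
      simp only [Pi.add_apply]
      rcases hφR x with h | h
      · rw [h, max_eq_right]
        · ring
        · linarith [hR x]
      · rw [h, max_eq_left]
        · ring
        · linarith [hφ x])
    (fun x => by
      rw [supportFn_bodyOf (h1.mono hi), supportFn_bodyOf (h2.mono hi),
          supportFn_bodyOf (h0.mono hi)]
      simp only [Pi.add_apply]
      rcases hφR x with h | h
      · rw [h, min_eq_left]
        · ring
        · linarith [hR x]
      · rw [h, min_eq_right]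
        · ring
        · linarith [hφ x])
  exact hμ.val _ _ _ _ key.1 key.2

end Extension

section Derivative

variable {n : ℕ} {μ : ConvexBody (Eucl n) → ℝ}

theorem Polynomial.eq_of_eval_eq_of_nonneg {p q : Polynomial ℝ}
    (h : ∀ t : ℝ, 0 ≤ t → p.eval t = q.eval t) : p = q :=
  Polynomial.eq_of_infinite_eval_eq p q
    ((Set.Ici_infinite (0 : ℝ)).mono fun t ht => h t ht)

theorem IsVal.exists_polynomial_extVal_of_nonneg (hμ : IsVal μ) {f g : Eucl n → ℝ} {c c' : ℝ}
    (hf : SemiSublinear f c) (hg : SemiSublinear g c') :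
    ∃ p : Polynomial ℝ, p.natDegree ≤ 4 * n ∧
      ∀ t : ℝ, 0 ≤ t → extVal μ (f + t • g) = p.eval t := by
  let K : ℕ → ConvexBody (Eucl n) := fun i => bodyOf fun x => f x + (c + i) * ‖x‖
  let L : ConvexBody (Eucl n) := bodyOf fun x => g x + c' * ‖x‖
  refine ⟨∑ i ∈ Finset.range (2 * n + 1), (∑ j ∈ Finset.range (2 * n + 1),
    Polynomial.C (μ (K i + (j : ℝ) • L)) * lagBasis (2 * n) j) *
      (lagBasis (2 * n) i).comp (-Polynomial.C c' * Polynomial.X - Polynomial.C c), ?_, ?_⟩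
  · refine Polynomial.natDegree_sum_le_of_forall_le _ _ fun i hi => ?_
    refine Polynomial.natDegree_mul_le.trans ?_
    have h1 : (∑ j ∈ Finset.range (2 * n + 1),
        Polynomial.C (μ (K i + (j : ℝ) • L)) * lagBasis (2 * n) j).natDegree ≤ 2 * n :=
      Polynomial.natDegree_sum_le_of_forall_le _ _ fun j hj =>
        (Polynomial.natDegree_C_mul_le _ _).trans (natDegree_lagBasis_le _ _ hj)
    have h2 : ((lagBasis (2 * n) i).comp
        (-Polynomial.C c' * Polynomial.X - Polynomial.C c)).natDegree ≤ 2 * n := by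
      refine Polynomial.natDegree_comp_le.trans ?_
      have h3 : (-Polynomial.C c' * Polynomial.X - Polynomial.C c).natDegree ≤ 1 := by
        compute_degree
      calc _ ≤ (2 * n) * 1 := Nat.mul_le_mul (natDegree_lagBasis_le _ _ hi) h3
        _ = 2 * n := mul_one _
    omega
  · intro t ht
    rw [hμ.extVal_eq (hf.add (hg.smul ht)), extValAt]
    simp only [Polynomial.eval_finsetSum, Polynomial.eval_mul, Polynomial.eval_comp,
      Polynomial.eval_C, Polynomial.eval_sub, Polynomial.eval_neg, Polynomial.eval_X]
    refine Finset.sum_congr rfl fun i _ => ?_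
    have hi : c ≤ c + i := by linarith [(Nat.cast_nonneg i : (0 : ℝ) ≤ i)]
    rw [← hμ.add_smul_eq _ _ ht, ← bodyOf_mul hg ht,
      ← bodyOf_add (hf.mono hi) (IsSublinear.const_mul hg ht)]
    congr 3
    · funext x
      simp only [Pi.add_apply, Pi.smul_apply, smul_eq_mul]
      ring
    · ring

theorem IsVal.exists_polynomial_extVal (hμ : IsVal μ) {f g : Eucl n → ℝ} {c c' : ℝ}
    (hf : NormBound f c) (hg : NormBound g c') :
    ∃ p : Polynomial ℝ, p.natDegree ≤ 4 * n ∧ ∀ t : ℝ, extVal μ (f + t • g) = p.eval t := by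
  obtain ⟨p, hp, hpe⟩ := hμ.exists_polynomial_extVal_of_nonneg hf.pos hg.pos
  refine ⟨p, hp, fun t => ?_⟩
  obtain ⟨q, -, hqe⟩ := hμ.exists_polynomial_extVal_of_nonneg
    (hf.add (hg.smul (-|t|))).pos hg.pos
  have h : q.comp (Polynomial.X + Polynomial.C |t|) = p := by
    refine Polynomial.eq_of_eval_eq_of_nonneg fun s hs => ?_
    rw [← hpe s hs, Polynomial.eval_comp, Polynomial.eval_add, Polynomial.eval_X,
      Polynomial.eval_C, ← hqe _ (add_nonneg hs (abs_nonneg t))]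
    congr 1
    module
  rw [← h, Polynomial.eval_comp, Polynomial.eval_add, Polynomial.eval_X,
      Polynomial.eval_C, ← hqe _ (by linarith [neg_abs_le t])]
  congr 1
  module

theorem IsVal.extVal_add_smul_eq (hμ : IsVal μ) {f g : Eucl n → ℝ} {c c' : ℝ}
    (hf : NormBound f c) (hg : NormBound g c') (t : ℝ) :
    extVal μ (f + t • g) = ∑ i ∈ Finset.range (4 * n + 1),
      extVal μ (f + (i : ℝ) • g) * (lagBasis (4 * n) i).eval t := by
  obtain ⟨p, hp, hpe⟩ := hμ.exists_polynomial_extVal hf hg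
  rw [hpe, Polynomial.eval_eq_sum_lagBasis hp]
  exact Finset.sum_congr rfl fun i _ => by rw [hpe]

/-- The directional derivative of the extension of `μ` at `f` in direction `φ`. -/
def dExt (μ : ConvexBody (Eucl n) → ℝ) (f φ : Eucl n → ℝ) : ℝ :=
  ∑ i ∈ Finset.range (4 * n + 1),
    extVal μ (f + (i : ℝ) • φ) * (lagBasis (4 * n) i).derivative.eval 0

theorem IsVal.dExt_eq (hμ : IsVal μ) {f φ : Eucl n → ℝ} {c c' : ℝ}
    (hf : NormBound f c) (hφ : NormBound φ c') {p : Polynomial ℝ}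
    (hp : ∀ t, extVal μ (f + t • φ) = p.eval t) : dExt μ f φ = p.derivative.eval 0 := by
  have h : p = ∑ i ∈ Finset.range (4 * n + 1),
      Polynomial.C (extVal μ (f + (i : ℝ) • φ)) * lagBasis (4 * n) i := by
    refine Polynomial.funext fun t => ?_
    rw [← hp, hμ.extVal_add_smul_eq hf hφ]
    simp [Polynomial.eval_finsetSum]
  rw [h, dExt]
  simp [Polynomial.eval_finsetSum]

theorem IsVal.dExt_add (hμ : IsVal μ) {f φ ψ : Eucl n → ℝ} {c c' c'' : ℝ}
    (hf : NormBound f c) (hφ : NormBound φ c') (hψ : NormBound ψ c'') :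
    dExt μ f (φ + ψ) = dExt μ f φ + dExt μ f ψ := by
  have h : ∀ t, extVal μ (f + t • (φ + ψ)) = (∑ i ∈ Finset.range (4 * n + 1),
      ∑ j ∈ Finset.range (4 * n + 1),
        Polynomial.C (extVal μ (f + (i : ℝ) • φ + (j : ℝ) • ψ)) *
          (lagBasis (4 * n) i * lagBasis (4 * n) j)).eval t := by
    intro t
    rw [smul_add, ← add_assoc, hμ.extVal_add_smul_eq (hf.add (hφ.smul t)) hψ]
    simp only [Polynomial.eval_finsetSum, Polynomial.eval_mul, Polynomial.eval_C]
    rw [Finset.sum_comm]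
    refine Finset.sum_congr rfl fun j _ => ?_
    rw [add_right_comm, hμ.extVal_add_smul_eq (hf.add (hψ.smul j)) hφ, Finset.sum_mul]
    refine Finset.sum_congr rfl fun i _ => ?_
    rw [add_right_comm]
    ring
  rw [hμ.dExt_eq hf (hφ.add hψ) h]
  have h0 : ∀ i ∈ Finset.range (4 * n + 1),
      (lagBasis (4 * n) i).eval 0 = if i = 0 then 1 else 0 := by
    intro i _
    simpa using lagBasis_eval_nat (j := 0) (4 * n) (i := i) (by simp)
  simp only [Polynomial.derivative_sum, Polynomial.derivative_C_mul]
  simp only [Polynomial.derivative_mul,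
    Polynomial.eval_finsetSum, Polynomial.eval_mul, Polynomial.eval_C, Polynomial.eval_add,
    mul_add, Finset.sum_add_distrib]
  congr 1
  · rw [dExt]
    refine Finset.sum_congr rfl fun i _ => ?_
    rw [Finset.sum_eq_single 0]
    · rw [h0 0 (by simp)]; simp
    · intro j hj hj0
      rw [h0 j hj, if_neg hj0]; ring
    · simp
  · rw [dExt, Finset.sum_eq_single 0]
    · refine Finset.sum_congr rfl fun j _ => ?_
      rw [h0 0 (by simp)]; simp
    · intro j hj hj0
      refine Finset.sum_eq_zero fun i _ => ?_
      rw [h0 j hj, if_neg hj0]; ring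
    · simp

theorem IsVal.dExt_smul (hμ : IsVal μ) {f φ : Eucl n → ℝ} {c c' : ℝ}
    (hf : NormBound f c) (hφ : NormBound φ c') (a : ℝ) :
    dExt μ f (a • φ) = a * dExt μ f φ := by
  obtain ⟨p, -, hp⟩ := hμ.exists_polynomial_extVal hf hφ
  rw [hμ.dExt_eq hf hφ hp, hμ.dExt_eq hf (hφ.smul a)
    (p := p.comp (Polynomial.C a * Polynomial.X)) fun t => ?_]
  · simp [Polynomial.derivative_comp]
  · rw [smul_smul, mul_comm t a, hp]; simp

theorem IsVal.dExt_zero (hμ : IsVal μ) {f : Eucl n → ℝ} {c : ℝ} (hf : NormBound f c) :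
    dExt μ f 0 = 0 := by
  simpa using hμ.dExt_smul hf normBound_zero 0

theorem NormBound.eq_zero {f : Eucl n → ℝ} (h : NormBound f 0) : f = 0 :=
  funext fun x => by simpa using h.bound x

theorem NormBound.inv_smul {f : Eucl n → ℝ} {c : ℝ} (h : NormBound f c) :
    NormBound (c⁻¹ • f) 1 := by
  refine (h.smul c⁻¹).mono ?_
  rw [abs_inv, abs_of_nonneg h.nonneg]
  exact inv_mul_le_one

theorem NormBound.smul_inv_smul {f : Eucl n → ℝ} {c : ℝ} (h : NormBound f c) :
    c • c⁻¹ • f = f := by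
  rcases eq_or_ne c 0 with rfl | hc
  · rw [h.eq_zero]; simp
  · rw [smul_inv_smul₀ hc]

theorem IsVal.exists_bound_dExt (hμ : IsVal μ) (r : ℝ) : ∃ C, 0 ≤ C ∧
    ∀ f φ s, NormBound f r → NormBound φ s → |dExt μ f φ| ≤ C * s := by
  obtain ⟨C, hC, h⟩ := hμ.exists_bound_extVal (r + 4 * n)
  refine ⟨∑ i ∈ Finset.range (4 * n + 1), C * |(lagBasis (4 * n) i).derivative.eval 0|,
    by positivity, fun f φ s hf hφ => ?_⟩
  rw [← hφ.smul_inv_smul, hμ.dExt_smul hf hφ.inv_smul, abs_mul, abs_of_nonneg hφ.nonneg,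
    mul_comm]
  refine mul_le_mul_of_nonneg_right ?_ hφ.nonneg
  refine (Finset.abs_sum_le_sum_abs _ _).trans (Finset.sum_le_sum fun i hi => ?_)
  rw [abs_mul]
  gcongr
  refine h _ ((hf.add (hφ.inv_smul.smul i)).mono ?_)
  have : (i : ℝ) ≤ 4 * n := by
    exact_mod_cast Nat.lt_succ_iff.1 (Finset.mem_range.1 hi)
  rw [abs_of_nonneg (Nat.cast_nonneg i)]
  linarith

theorem Polynomial.exists_abs_eval_sub_le (p : Polynomial ℝ) :
    ∃ C, 0 ≤ C ∧ ∀ t ∈ Set.Icc (0 : ℝ) 1, |p.eval t - p.eval 0| ≤ C * t := by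
  obtain ⟨C, hC⟩ := (isCompact_Icc (a := (0 : ℝ)) (b := 1)).exists_bound_of_continuousOn
    p.divX.continuous.continuousOn
  refine ⟨C, (norm_nonneg _).trans (hC 0 (by simp)), fun t ht => ?_⟩
  have h : p.eval t - p.eval 0 = p.divX.eval t * t := by
    conv_lhs => rw [← Polynomial.divX_mul_X_add p]
    simp
  rw [h, abs_mul, abs_of_nonneg ht.1]
  exact mul_le_mul_of_nonneg_right (hC t ht) ht.1

theorem IsVal.dExt_add_smul_eq (hμ : IsVal μ) {f R φ : Eucl n → ℝ} {c c' c'' : ℝ}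
    (hf : NormBound f c) (hR : NormBound R c') (hφ : NormBound φ c'') (t : ℝ) :
    dExt μ (f + t • R) φ = ∑ j ∈ Finset.range (4 * n + 1),
      dExt μ (f + (j : ℝ) • R) φ * (lagBasis (4 * n) j).eval t := by
  simp only [dExt, Finset.sum_mul]
  rw [Finset.sum_comm]
  refine Finset.sum_congr rfl fun i _ => ?_
  rw [add_right_comm, hμ.extVal_add_smul_eq (hf.add (hφ.smul i)) hR, Finset.sum_mul]
  refine Finset.sum_congr rfl fun j _ => ?_
  rw [add_right_comm]
  ring

theorem IsVal.exists_bound_dExt_sub (hμ : IsVal μ) (r : ℝ) : ∃ C, 0 ≤ C ∧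
    ∀ f R φ ε s, NormBound f r → NormBound R ε → ε ≤ 1 → NormBound φ s →
      |dExt μ (f + R) φ - dExt μ f φ| ≤ C * ε * s := by
  obtain ⟨C, hC, h⟩ := hμ.exists_bound_dExt (r + 4 * n)
  choose B hB0 hB using fun j => Polynomial.exists_abs_eval_sub_le (lagBasis (4 * n) j)
  refine ⟨∑ j ∈ Finset.range (4 * n + 1), C * B j,
    Finset.sum_nonneg fun j _ => mul_nonneg hC (hB0 j), fun f R φ ε s hf hR hε hφ => ?_⟩
  have h0 : dExt μ f φ = dExt μ (f + (0 : ℝ) • ε⁻¹ • R) φ := by simp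
  have h1 : dExt μ (f + R) φ = dExt μ (f + ε • ε⁻¹ • R) φ := by rw [hR.smul_inv_smul]
  rw [h0, h1, hμ.dExt_add_smul_eq hf hR.inv_smul hφ, hμ.dExt_add_smul_eq hf hR.inv_smul hφ 0,
    ← Finset.sum_sub_distrib, Finset.sum_mul, Finset.sum_mul]
  refine (Finset.abs_sum_le_sum_abs _ _).trans (Finset.sum_le_sum fun j hj => ?_)
  rw [← mul_sub, abs_mul]
  have hj' : (j : ℝ) ≤ 4 * n := by
    exact_mod_cast Nat.lt_succ_iff.1 (Finset.mem_range.1 hj)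
  have h1 := h (f + (j : ℝ) • ε⁻¹ • R) φ s ((hf.add (hR.inv_smul.smul j)).mono (by
    rw [abs_of_nonneg (Nat.cast_nonneg j)]; linarith)) hφ
  calc _ ≤ (C * s) * (B j * ε) := by
        have := hφ.nonneg
        gcongr
        exact hB j ε ⟨hR.nonneg, hε⟩
    _ = _ := by ring

theorem IsVal.dExt_add_of_mul_eq_zero_of_nonneg (hμ : IsVal μ) {f φ R : Eucl n → ℝ} {c c' c'' : ℝ}
    (hf : NormBound f c) (hφ : NormBound φ c') (hR : NormBound R c'')
    (hφ0 : ∀ x, 0 ≤ φ x) (hR0 : ∀ x, 0 ≤ R x) (h : ∀ x, φ x = 0 ∨ R x = 0) :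
    dExt μ (f + R) φ = dExt μ f φ := by
  have key : ∀ i : ℕ, extVal μ (f + R + (i : ℝ) • φ) =
      extVal μ (f + (i : ℝ) • φ) + (extVal μ (f + R) - extVal μ f) := by
    intro i
    have hi := hφ.smul i
    have h1 := hi.nonneg
    have h2 := hR.nonneg
    have := hμ.extVal_add_add (hf.pos.mono (c' := c + |(i : ℝ)| * c' + c'') (by linarith))
      ((hf.add hi).pos.mono (c' := c + |(i : ℝ)| * c' + c'') (by linarith))
      ((hf.add hR).pos.mono (c' := c + |(i : ℝ)| * c' + c'') (by linarith))
      ((hf.add hi).add hR).pos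
      (fun x => mul_nonneg (Nat.cast_nonneg i) (hφ0 x)) hR0
      (fun x => (h x).imp (fun h => by simp [h]) id)
    rw [add_right_comm f R]
    linarith
  have hz : ∑ i ∈ Finset.range (4 * n + 1), (extVal μ (f + R) - extVal μ f) *
      (lagBasis (4 * n) i).derivative.eval 0 = 0 := by
    rw [← Finset.mul_sum]
    have : ∑ i ∈ Finset.range (4 * n + 1), lagBasis (4 * n) i = 1 := by
      refine Polynomial.funext fun t => ?_
      have := Polynomial.eval_eq_sum_lagBasis (p := 1) (d := 4 * n) (by simp) t
      rw [this, Polynomial.eval_finsetSum]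
      simp
    rw [← Polynomial.eval_finsetSum, ← Polynomial.derivative_sum, this]
    simp
  simp only [dExt, key, add_mul, Finset.sum_add_distrib, hz, add_zero]

open Filter Topology in
theorem IsVal.tendsto_dExt (hμ : IsVal μ) {f φ : Eucl n → ℝ} {φs : ℕ → Eucl n → ℝ} {c c' : ℝ}
    (hf : NormBound f c) (hφs : ∀ k, NormBound (φs k) c') (hφ : NormBound φ c')
    {ε : ℕ → ℝ} (hε : Tendsto ε atTop (𝓝 0)) (h : ∀ k x, |φs k x - φ x| ≤ ε k * ‖x‖) :
    Tendsto (fun k => dExt μ f (φs k)) atTop (𝓝 (dExt μ f φ)) := by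
  refine tendsto_finsetSum _ fun i _ => Tendsto.mul_const _ ?_
  refine hμ.tendsto_extVal (fun k => (hf.add ((hφs k).smul i)).pos) (hf.add (hφ.smul i)).pos
    (ε := fun k => i * ε k) (by simpa using hε.const_mul (i : ℝ)) fun k x => ?_
  simp only [Pi.add_apply, Pi.smul_apply, smul_eq_mul, add_sub_add_left_eq_sub, ← mul_sub,
    abs_mul, Nat.abs_cast, mul_assoc]
  exact mul_le_mul_of_nonneg_left (h k x) (Nat.cast_nonneg i)

theorem IsVal.dExt_linear_combination {ι : Type*} (s : Finset ι)
    {ν : ι → ConvexBody (Eucl n) → ℝ} (hν : ∀ i ∈ s, IsVal (ν i)) (a : ι → ℝ)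
    (hμ : IsVal fun K => ∑ i ∈ s, a i * ν i K) {f φ : Eucl n → ℝ} {c c' : ℝ}
    (hf : NormBound f c) (hφ : NormBound φ c') :
    dExt (fun K => ∑ i ∈ s, a i * ν i K) f φ = ∑ i ∈ s, a i * dExt (ν i) f φ := by
  simp only [dExt, Finset.mul_sum]
  rw [Finset.sum_comm]
  refine Finset.sum_congr rfl fun i _ => ?_
  rw [IsVal.extVal_linear_combination s hν a hμ (hf.add (hφ.smul i)).pos, Finset.sum_mul]
  exact Finset.sum_congr rfl fun _ _ => by ring

theorem IsVal.extVal_eq_extVal_zero (hμ : IsVal μ) {f : Eucl n → ℝ} {c : ℝ} (hf : NormBound f c)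
    (h : ∀ t : ℝ, dExt μ (t • f) (t • f) = 0) : extVal μ f = extVal μ 0 := by
  obtain ⟨p, -, hp⟩ := hμ.exists_polynomial_extVal normBound_zero hf
  have hd : p.derivative = 0 := by
    refine Polynomial.eq_zero_of_infinite_isRoot _
      ((Set.Ioi_infinite (0 : ℝ)).mono fun t (ht : 0 < t) => ?_)
    have h1 := h t
    rw [hμ.dExt_smul (hf.smul t) hf, mul_eq_zero] at h1
    rw [Set.mem_ofPred_eq, Polynomial.IsRoot, ← h1.resolve_left ht.ne',
      hμ.dExt_eq (hf.smul t) hf (p := p.comp (Polynomial.X + Polynomial.C t)) fun s => ?_]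
    · simp [Polynomial.derivative_comp]
    · rw [Polynomial.eval_comp, Polynomial.eval_add, Polynomial.eval_X, Polynomial.eval_C, ← hp]
      congr 1
      module
  have h1 := hp 1
  have h0 := hp 0
  rw [Polynomial.eq_C_of_derivative_eq_zero hd] at h0 h1
  simp only [Polynomial.eval_C, zero_add, one_smul, zero_smul] at h0 h1
  rw [h1, h0]

theorem IsVal.extVal_sum_smul_eq_zero (hμ : IsVal μ) {ι : Type*} (s : Finset ι)
    {g : ι → Eucl n → ℝ} {c : ι → ℝ} (hg : ∀ i, NormBound (g i) (c i))
    (h : ∀ b : ι → Fin (4 * n + 1), extVal μ (∑ i ∈ s, ((b i : ℕ) : ℝ) • g i) = 0)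
    (b : ι → ℝ) : extVal μ (∑ i ∈ s, b i • g i) = 0 := by
  classical
  have key : ∀ u : Finset ι, u ⊆ s → ∀ b : ι → ℝ,
      (∀ i ∈ s, i ∉ u → ∃ k ∈ Finset.range (4 * n + 1), b i = k) →
      extVal μ (∑ i ∈ s, b i • g i) = 0 := by
    intro u
    induction u using Finset.induction_on with
    | empty =>
      intro _ b hb
      choose! k hk hbk using hb
      have := h fun i => if hi : i ∈ s then
        ⟨k i, Finset.mem_range.1 (hk i hi (Finset.notMem_empty i))⟩ else 0
      rw [← this]
      congr 1
      refine Finset.sum_congr rfl fun i hi => ?_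
      rw [hbk i hi (Finset.notMem_empty i), dif_pos hi]
    | insert a u ha ih =>
      intro hu b hb
      have has : a ∈ s := hu (Finset.mem_insert_self a u)
      have hsplit : ∀ t : ℝ, ∑ i ∈ s, Function.update b a t i • g i =
          ∑ i ∈ s.erase a, b i • g i + t • g a := by
        intro t
        rw [← Finset.sum_erase_add _ _ has, Function.update_self]
        congr 1
        refine Finset.sum_congr rfl fun i hi => ?_
        rw [Function.update_of_ne (Finset.ne_of_mem_erase hi)]
      have hN : NormBound (∑ i ∈ s.erase a, b i • g i) (∑ i ∈ s.erase a, |b i| * c i) :=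
        NormBound.sum _ fun i _ => (hg i).smul (b i)
      have hself : Function.update b a (b a) = b := Function.update_eq_self a b
      have := hsplit (b a)
      rw [hself] at this
      rw [this, hμ.extVal_add_smul_eq hN (hg a)]
      refine Finset.sum_eq_zero fun k hk => ?_
      rw [← hsplit, ih ((Finset.subset_insert a u).trans hu) _ fun i hi hiu => ?_, zero_mul]
      by_cases hia : i = a
      · subst hia
        exact ⟨k, hk, Function.update_self ..⟩
      · rw [Function.update_of_ne hia]
        exact hb i hi (by simp [hia, hiu])
  exact key s le_rfl b fun i hi hi' => absurd hi hi'

end Derivative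

section SphereCalculus

variable {E : Type*} [NormedAddCommGroup E] [InnerProductSpace ℝ E]

theorem norm_inv_norm_smul {x : E} (hx : x ≠ 0) : ‖‖x‖⁻¹ • x‖ = 1 := by
  simpa using norm_smul_inv_norm (𝕜 := ℝ) hx

/-- The `1`-homogeneous extension of a function on the unit sphere. -/
def hom (F : E → ℝ) (x : E) : ℝ := ‖x‖ * F (‖x‖⁻¹ • x)

theorem hom_add (F G : E → ℝ) : hom (F + G) = hom F + hom G := by
  funext x; simp [hom, mul_add]

theorem hom_sub (F G : E → ℝ) : hom (F - G) = hom F - hom G := by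
  funext x; simp [hom, mul_sub]

theorem hom_smul (t : ℝ) (F : E → ℝ) : hom (t • F) = t • hom F := by
  funext x; simp [hom]; ring

theorem hom_neg (F : E → ℝ) : hom (-F) = -hom F := by
  funext x; simp [hom]

theorem hom_zero : hom (0 : E → ℝ) = 0 := by
  funext x; simp [hom]

theorem hom_sum {ι : Type*} (s : Finset ι) (F : ι → E → ℝ) :
    hom (∑ i ∈ s, F i) = ∑ i ∈ s, hom (F i) := by
  funext x; simp [hom, Finset.mul_sum]

theorem hom_congr {F G : E → ℝ} (h : ∀ x, ‖x‖ = 1 → F x = G x) : hom F = hom G := by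
  funext x
  rcases eq_or_ne x 0 with rfl | hx
  · simp [hom]
  · rw [hom, hom, h _ (norm_inv_norm_smul hx)]

theorem hom_eq_of_isSublinear {f : E → ℝ} (hf : IsSublinear f) : hom f = f := by
  funext x
  rcases eq_or_ne x 0 with rfl | hx
  · simp [hom, hf.map_zero]
  · rw [hom, hf.map_smul _ _ (by positivity), mul_inv_cancel_left₀ (norm_ne_zero_iff.2 hx)]

theorem abs_hom_sub_le {F G : E → ℝ} {ε : ℝ} (h : ∀ x, ‖x‖ = 1 → |F x - G x| ≤ ε) (x : E) :
    |hom F x - hom G x| ≤ ε * ‖x‖ := by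
  rcases eq_or_ne x 0 with rfl | hx
  · simp [hom]
  · rw [hom, hom, ← mul_sub, abs_mul, abs_norm, mul_comm]
    gcongr
    exact h _ (norm_inv_norm_smul hx)

/-- A scaled quantitative `C^{1,1}` bound for a function on the unit sphere. -/
def C11 (ρ : ℝ) (F : E → ℝ) (c : ℝ) : Prop :=
  ∀ w, ‖w‖ = 1 → |F w| ≤ c ∧ ∃ ξ : E, ρ * ‖ξ‖ ≤ c ∧
    ∀ u, ‖u‖ = 1 → |F u - F w - inner ℝ ξ (u - w)| ≤ c * (‖u - w‖ / ρ) ^ 2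

theorem C11.mono {ρ : ℝ} {F : E → ℝ} {c c' : ℝ} (h : C11 ρ F c) (hc : c ≤ c') : C11 ρ F c' := by
  intro w hw
  obtain ⟨h1, ξ, h2, h3⟩ := h w hw
  exact ⟨h1.trans hc, ξ, h2.trans hc, fun u hu => (h3 u hu).trans (by gcongr)⟩

theorem C11.congr {ρ : ℝ} {F G : E → ℝ} {c : ℝ} (h : C11 ρ F c)
    (hFG : ∀ x, ‖x‖ = 1 → F x = G x) : C11 ρ G c := by
  intro w hw
  obtain ⟨h1, ξ, h2, h3⟩ := h w hw
  refine ⟨by rwa [← hFG w hw], ξ, h2, fun u hu => ?_⟩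
  rw [← hFG w hw, ← hFG u hu]
  exact h3 u hu

theorem C11.rescale {ρ : ℝ} {F : E → ℝ} {c : ℝ} (h : C11 ρ F c) (hc : 0 ≤ c) (hρ : 0 < ρ)
    (hρ1 : ρ ≤ 1) : C11 1 F (c / ρ ^ 2) := by
  intro w hw
  obtain ⟨h1, ξ, h2, h3⟩ := h w hw
  have hc2 : c ≤ c / ρ ^ 2 := by
    rw [le_div_iff₀ (by positivity)]
    nlinarith [pow_le_one₀ (n := 2) hρ.le hρ1]
  refine ⟨h1.trans hc2, ξ, ?_, fun u hu => (h3 u hu).trans (le_of_eq ?_)⟩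
  · rw [one_mul, le_div_iff₀ (by positivity)]
    nlinarith [mul_le_mul_of_nonneg_right hρ1 (mul_nonneg hρ.le (norm_nonneg ξ))]
  · rw [div_one, div_pow, div_mul_eq_mul_div, mul_div_assoc]

theorem C11.add {ρ : ℝ} {F G : E → ℝ} {c c' : ℝ} (hρ : 0 ≤ ρ) (h : C11 ρ F c) (h' : C11 ρ G c') :
    C11 ρ (F + G) (c + c') := by
  intro w hw
  obtain ⟨h1, ξ, h2, h3⟩ := h w hw
  obtain ⟨h1', ξ', h2', h3'⟩ := h' w hw
  refine ⟨(abs_add_le _ _).trans (add_le_add h1 h1'), ξ + ξ', ?_, fun u hu => ?_⟩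
  · nlinarith [mul_le_mul_of_nonneg_left (norm_add_le ξ ξ') hρ]
  · have := (abs_add_le _ _).trans (add_le_add (h3 u hu) (h3' u hu))
    rw [add_mul]
    refine le_trans (le_of_eq ?_) this
    congr 1
    simp only [Pi.add_apply, inner_add_left]
    ring

theorem C11.smul {ρ : ℝ} {F : E → ℝ} {c : ℝ} (h : C11 ρ F c) (t : ℝ) :
    C11 ρ (t • F) (|t| * c) := by
  intro w hw
  obtain ⟨h1, ξ, h2, h3⟩ := h w hw
  refine ⟨?_, t • ξ, ?_, fun u hu => ?_⟩
  · rw [Pi.smul_apply, smul_eq_mul, abs_mul]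
    gcongr
  · rw [norm_smul, Real.norm_eq_abs, mul_left_comm]
    gcongr
  · have := mul_le_mul_of_nonneg_left (h3 u hu) (abs_nonneg t)
    rw [← abs_mul, ← mul_assoc] at this
    refine le_trans (le_of_eq ?_) this
    congr 1
    simp only [Pi.smul_apply, smul_eq_mul, real_inner_smul_left]
    ring

theorem C11.neg {ρ : ℝ} {F : E → ℝ} {c : ℝ} (h : C11 ρ F c) : C11 ρ (-F) c := by
  simpa using h.smul (-1)

theorem c11_zero (ρ : ℝ) : C11 ρ (0 : E → ℝ) 0 := fun _ _ =>
  ⟨by simp, 0, by simp, fun _ _ => by simp⟩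

theorem c11_const (ρ : ℝ) (a : ℝ) : C11 ρ (fun _ : E => a) |a| := fun _ _ =>
  ⟨le_rfl, 0, by simp, fun _ _ => by simp; positivity⟩

theorem C11.sum {ρ : ℝ} (hρ : 0 ≤ ρ) {ι : Type*} (s : Finset ι) {F : ι → E → ℝ} {c : ι → ℝ}
    (h : ∀ i ∈ s, C11 ρ (F i) (c i)) : C11 ρ (∑ i ∈ s, F i) (∑ i ∈ s, c i) := by
  classical
  induction s using Finset.induction_on with
  | empty => simpa using c11_zero ρ
  | insert a s ha ih =>
    rw [Finset.sum_insert ha, Finset.sum_insert ha]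
    exact (h a (Finset.mem_insert_self a s)).add hρ
      (ih fun i hi => h i (Finset.mem_insert_of_mem hi))

theorem C11.mul {ρ : ℝ} {F G : E → ℝ} {c c' : ℝ} (hρ : 0 < ρ) (hc : 0 ≤ c) (hc' : 0 ≤ c')
    (h : C11 ρ F c) (h' : C11 ρ G c') : C11 ρ (F * G) (6 * (c * c')) := by
  intro w hw
  obtain ⟨h1, ξ, h2, h3⟩ := h w hw
  obtain ⟨h1', ξ', h2', h3'⟩ := h' w hw
  have hcc := mul_nonneg hc hc'
  refine ⟨?_, F w • ξ' + G w • ξ, ?_, fun u hu => ?_⟩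
  · rw [Pi.mul_apply, abs_mul]
    nlinarith [mul_le_mul h1 h1' (abs_nonneg _) hc]
  · have ha : ρ * ‖F w • ξ'‖ ≤ c * c' := by
      rw [norm_smul, mul_left_comm]
      exact mul_le_mul h1 h2' (by positivity) hc
    have hb : ρ * ‖G w • ξ‖ ≤ c * c' := by
      rw [norm_smul, mul_left_comm, mul_comm c c']
      exact mul_le_mul h1' h2 (by positivity) hc'
    nlinarith [mul_le_mul_of_nonneg_left (norm_add_le (F w • ξ') (G w • ξ)) hρ.le]
  · set d := ‖u - w‖ / ρ with hd
    have hd0 : 0 ≤ d := by positivity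
    have hin : ∀ (ζ : E) (a : ℝ), ρ * ‖ζ‖ ≤ a → |inner ℝ ζ (u - w)| ≤ a * d := by
      intro ζ a ha
      refine (abs_real_inner_le_norm _ _).trans ?_
      have : ‖u - w‖ = ρ * d := by rw [hd]; field_simp
      rw [this]
      nlinarith
    have hl := hin ξ c h2
    have hl' := hin ξ' c' h2'
    have hr := h3 u hu
    have hr' := h3' u hu
    have hu1 := (h u hu).1
    have hu1' := (h' u hu).1
    simp only [Pi.mul_apply, inner_add_left, real_inner_smul_left]
    generalize inner ℝ ξ (u - w) = l at *
    generalize inner ℝ ξ' (u - w) = l' at *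
    generalize F u = A at *
    generalize G u = A' at *
    generalize F w = B at *
    generalize G w = B' at *
    have hm : ∀ {x y X Y : ℝ}, |x| ≤ X → |y| ≤ Y → |x * y| ≤ X * Y := fun hx hy => by
      rw [abs_mul]; exact mul_le_mul hx hy (abs_nonneg _) ((abs_nonneg _).trans hx)
    rcases le_total d 1 with hd1 | hd1
    · have hdd : d ^ 2 ≤ d := by nlinarith
      have e1 : |A - B| ≤ 2 * c * d := by
        have : A - B = (A - B - l) + l := by ring
        rw [this]
        exact (abs_add_le _ _).trans (by nlinarith [mul_le_mul_of_nonneg_left hdd hc])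
      have e1' : |A' - B'| ≤ 2 * c' * d := by
        have : A' - B' = (A' - B' - l') + l' := by ring
        rw [this]
        exact (abs_add_le _ _).trans (by nlinarith [mul_le_mul_of_nonneg_left hdd hc'])
      have : A * A' - B * B' - (B * l' + B' * l) =
          B * (A' - B' - l') + B' * (A - B - l) + (A - B) * (A' - B') := by ring
      rw [this]
      refine (abs_add_le _ _).trans ((add_le_add (abs_add_le _ _) le_rfl).trans ?_)
      nlinarith [hm h1 hr', hm h1' hr, hm e1 e1']
    · have hdd : d ≤ d ^ 2 := by nlinarith
      have hd2 : 1 ≤ d ^ 2 := by nlinarith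
      have : A * A' - B * B' - (B * l' + B' * l) =
          A * A' + -(B * B') + (-(B * l') + -(B' * l)) := by ring
      rw [this]
      refine (abs_add_le _ _).trans ((add_le_add (abs_add_le _ _) (abs_add_le _ _)).trans ?_)
      simp only [abs_neg]
      nlinarith [hm hu1 hu1', hm h1 h1', hm h1 hl', hm h1' hl,
        mul_le_mul_of_nonneg_left hdd hcc, mul_le_mul_of_nonneg_left hd2 hcc]

theorem C11.normBound {F : E → ℝ} {c : ℝ} (hc : 0 ≤ c) (h : C11 1 F c) :
    NormBound (hom F) (4 * c) := by
  have hb : ∀ x, |hom F x| ≤ c * ‖x‖ := by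
    intro x
    have := abs_hom_sub_le (F := F) (G := 0) (ε := c) (fun x hx => by simpa using (h x hx).1) x
    simpa [hom_zero] using this
  have key : ∀ F : E → ℝ, C11 1 F c → (∀ x, |hom F x| ≤ c * ‖x‖) →
      SemiSublinear (hom F) (4 * c) := by
    intro F h hb
    refine ⟨fun x y => ?_, fun t x ht => ?_⟩
    · rcases eq_or_ne x 0 with rfl | hx
      · simp [hom]
      rcases eq_or_ne y 0 with rfl | hy
      · simp [hom]
      rcases eq_or_ne (x + y) 0 with hxy | hxy
      · rw [hxy]
        have h0 : hom F (0 : E) = 0 := by simp [hom]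
        rw [h0, norm_zero]
        nlinarith [(abs_le.1 (hb x)).1, (abs_le.1 (hb y)).1, mul_nonneg hc (norm_nonneg x),
          mul_nonneg hc (norm_nonneg y)]
      have hx0 := norm_pos_iff.2 hx
      have hy0 := norm_pos_iff.2 hy
      have hr0 := norm_pos_iff.2 hxy
      have hu := norm_inv_norm_smul hx
      have hv := norm_inv_norm_smul hy
      have hw := norm_inv_norm_smul hxy
      have exu : x = ‖x‖ • ‖x‖⁻¹ • x := by rw [smul_inv_smul₀ hx0.ne']
      have eyv : y = ‖y‖ • ‖y‖⁻¹ • y := by rw [smul_inv_smul₀ hy0.ne']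
      have ew : x + y = ‖x + y‖ • ‖x + y‖⁻¹ • (x + y) := by rw [smul_inv_smul₀ hr0.ne']
      have htri := norm_add_le x y
      simp only [hom]
      set a := ‖x‖
      set b := ‖y‖
      set r := ‖x + y‖
      set u := a⁻¹ • x
      set v := b⁻¹ • y
      set w := r⁻¹ • (x + y)
      have hsum : a • u + b • v = r • w := by rw [← exu, ← eyv, ← ew]
      obtain ⟨h1, ξ, h2, h3⟩ := h w hw
      have hξ : |inner ℝ ξ w| ≤ c := by
        refine (abs_real_inner_le_norm _ _).trans ?_
        rw [hw, mul_one]; simpa using h2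
      have hnorm : ∀ z : E, ‖z‖ = 1 → ‖z - w‖ ^ 2 = 2 - 2 * inner ℝ z w := by
        intro z hz
        rw [norm_sub_sq_real, hz, hw]; ring
      have hlin : ∀ z : E, a * inner ℝ z u + b * inner ℝ z v = r * inner ℝ z w := by
        intro z
        rw [← real_inner_smul_right, ← real_inner_smul_right, ← real_inner_smul_right,
          ← inner_add_right, hsum]
      have hlw := hlin w
      rw [real_inner_self_eq_norm_sq, hw, real_inner_comm u w, real_inner_comm v w] at hlw
      have h3u := (abs_le.1 (h3 u hu)).1
      have h3v := (abs_le.1 (h3 v hv)).1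
      rw [div_one, hnorm u hu, inner_sub_right] at h3u
      rw [div_one, hnorm v hv, inner_sub_right] at h3v
      have hs := hlin ξ
      have hau := mul_le_mul_of_nonneg_left h3u hx0.le
      have hbv := mul_le_mul_of_nonneg_left h3v hy0.le
      have h4 : 0 ≤ (a + b - r) * (c + F w) :=
        mul_nonneg (by linarith) (by linarith [(abs_le.1 h1).1])
      have h5 : 0 ≤ (a + b - r) * (c - inner ℝ ξ w) :=
        mul_nonneg (by linarith) (by linarith [(abs_le.1 hξ).2])
      have h6 : c * (a * inner ℝ u w + b * inner ℝ v w) = c * r := by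
        rw [hlw]; ring
      nlinarith
    · rcases ht.eq_or_lt with rfl | ht
      · simp [hom]
      · have : ‖t • x‖⁻¹ • t • x = ‖x‖⁻¹ • x := by
          rw [norm_smul, Real.norm_of_nonneg ht.le, smul_smul, mul_inv, mul_right_comm,
            inv_mul_cancel₀ ht.ne', one_mul]
        simp only [hom, this]
        rw [norm_smul, Real.norm_of_nonneg ht.le]
        ring
  refine ⟨by positivity, fun x => (hb x).trans ?_, key F h hb, ?_⟩
  · nlinarith [mul_nonneg hc (norm_nonneg x)]
  · rw [← hom_neg]
    exact key _ h.neg fun x => by rw [hom_neg, Pi.neg_apply, abs_neg]; exact hb x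

theorem c11_inner {ρ : ℝ} (hρ1 : ρ ≤ 1) (a : E) :
    C11 ρ (fun x => inner ℝ a x) ‖a‖ := by
  refine fun w hw => ⟨?_, a, ?_, fun u hu => ?_⟩
  · simpa [hw] using abs_real_inner_le_norm a w
  · nlinarith [norm_nonneg a]
  · rw [inner_sub_right, sub_self, abs_zero]; positivity

theorem abs_sq_max_sub_le (s t : ℝ) :
    |max 0 s ^ 2 - max 0 t ^ 2 - 2 * max 0 t * (s - t)| ≤ (s - t) ^ 2 := by
  rcases le_total 0 s with hs | hs <;> rcases le_total 0 t with ht | ht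
  · rw [max_eq_right hs, max_eq_right ht, abs_le]; constructor <;> nlinarith
  · rw [max_eq_right hs, max_eq_left ht, abs_le]; constructor <;> nlinarith
  · rw [max_eq_left hs, max_eq_right ht, abs_le]; constructor <;> nlinarith
  · rw [max_eq_left hs, max_eq_left ht, abs_le]; constructor <;> nlinarith

/-- The square of the positive part of an affine function is `C^{1,1}` on the sphere. -/
theorem c11_sq_max {y : E} {a b : ℝ} (hy : ‖y‖ ≤ 1) (hb : 1 ≤ b)
    (h : ∀ x : E, ‖x‖ = 1 → inner ℝ y x + a ≤ b) :
    C11 1 (fun x => max 0 (inner ℝ y x + a) ^ 2) (2 * b ^ 2) := by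
  intro w hw
  have h1 : max 0 (inner ℝ y w + a) ≤ b := max_le (by linarith) (h w hw)
  have h0 : 0 ≤ max 0 (inner ℝ y w + a) := le_max_left _ _
  refine ⟨?_, (2 * max 0 (inner ℝ y w + a)) • y, ?_, fun u hu => ?_⟩
  · rw [abs_of_nonneg (by positivity)]; nlinarith
  · rw [norm_smul, Real.norm_of_nonneg (by positivity)]
    nlinarith [norm_nonneg y]
  · rw [real_inner_smul_left, inner_sub_right]
    have := abs_sq_max_sub_le (inner ℝ y u + a) (inner ℝ y w + a)
    rw [add_sub_add_right_eq_sub] at this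
    refine this.trans ?_
    rw [← inner_sub_right, div_one]
    have h3 := abs_real_inner_le_norm y (u - w)
    have h4 : (inner ℝ y (u - w)) ^ 2 ≤ ‖u - w‖ ^ 2 := by
      rw [← sq_abs]
      exact pow_le_pow_left₀ (abs_nonneg _) (h3.trans (mul_le_of_le_one_left (norm_nonneg _) hy)) 2
    nlinarith [sq_nonneg ‖u - w‖, mul_le_mul hb hb zero_le_one (by linarith)]

end SphereCalculus

section Clamp

variable {E : Type*} [NormedAddCommGroup E] [InnerProductSpace ℝ E]

theorem C11.pow {ρ : ℝ} (hρ : 0 < ρ) {F : E → ℝ} {c : ℝ} (hc : 0 ≤ c) (h : C11 ρ F c) (k : ℕ) :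
    C11 ρ (F ^ k) ((6 * c) ^ k) := by
  induction k with
  | zero =>
    rw [pow_zero, pow_zero]
    exact (c11_const (E := E) ρ 1).mono abs_one.le
  | succ k ih =>
    rw [pow_succ, pow_succ]
    exact (ih.mul hρ (by positivity) hc h).mono (by ring_nf; rfl)

theorem C11.prod {ρ : ℝ} (hρ : 0 < ρ) {ι : Type*} (s : Finset ι) {F : ι → E → ℝ} {c : ι → ℝ}
    (hc : ∀ i ∈ s, 0 ≤ c i) (h : ∀ i ∈ s, C11 ρ (F i) (c i)) :
    C11 ρ (∏ i ∈ s, F i) (∏ i ∈ s, 6 * c i) := by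
  classical
  induction s using Finset.induction_on with
  | empty =>
    rw [Finset.prod_empty, Finset.prod_empty]
    exact (c11_const (E := E) ρ 1).mono abs_one.le
  | insert a s ha ih =>
    rw [Finset.prod_insert ha, Finset.prod_insert ha]
    have h0 : 0 ≤ ∏ i ∈ s, 6 * c i := Finset.prod_nonneg fun i hi =>
      mul_nonneg (by norm_num) (hc i (Finset.mem_insert_of_mem hi))
    exact ((h a (Finset.mem_insert_self a s)).mul hρ (hc a (Finset.mem_insert_self a s)) h0
      (ih (fun i hi => hc i (Finset.mem_insert_of_mem hi))
        fun i hi => h i (Finset.mem_insert_of_mem hi))).mono (le_of_eq (by ring))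

/-- A `C^{1,1}` truncation which is the identity on `[-ρ, ρ]` and bounded by `2ρ`. -/
def clamp (ρ t : ℝ) : ℝ :=
  t + (-max 0 (t - ρ) ^ 2 + max 0 (t - 3 * ρ) ^ 2 + max 0 (-t - ρ) ^ 2
    - max 0 (-t - 3 * ρ) ^ 2) / (4 * ρ)

theorem clamp_of_abs_le {ρ t : ℝ} (h : |t| ≤ ρ) : clamp ρ t = t := by
  obtain ⟨h1, h2⟩ := abs_le.1 h
  rw [clamp, max_eq_left (by linarith), max_eq_left (by linarith), max_eq_left (by linarith),
    max_eq_left (by linarith)]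
  ring

theorem abs_clamp_le {ρ : ℝ} (hρ : 0 < ρ) (t : ℝ) : |clamp ρ t| ≤ 2 * ρ := by
  have h4 : 0 < 4 * ρ := by positivity
  have e : clamp ρ t = (4 * ρ * t + (-max 0 (t - ρ) ^ 2 + max 0 (t - 3 * ρ) ^ 2 +
      max 0 (-t - ρ) ^ 2 - max 0 (-t - 3 * ρ) ^ 2)) / (4 * ρ) := by
    rw [clamp]; field_simp
  rw [e, abs_div, abs_of_pos h4, div_le_iff₀ h4, abs_le]
  rcases le_total t (-ρ) with h1 | h1
  · rw [max_eq_left (by linarith : t - ρ ≤ 0), max_eq_left (by linarith : t - 3 * ρ ≤ 0),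
      max_eq_right (by linarith : 0 ≤ -t - ρ)]
    rcases le_total (-t - 3 * ρ) 0 with h2 | h2
    · rw [max_eq_left h2]; constructor <;> nlinarith
    · rw [max_eq_right h2]; constructor <;> nlinarith
  · rw [max_eq_left (by linarith : -t - ρ ≤ 0), max_eq_left (by linarith : -t - 3 * ρ ≤ 0)]
    rcases le_total (t - ρ) 0 with h2 | h2
    · rw [max_eq_left h2, max_eq_left (by linarith : t - 3 * ρ ≤ 0)]; constructor <;> nlinarith
    · rw [max_eq_right h2]
      rcases le_total (t - 3 * ρ) 0 with h3 | h3
      · rw [max_eq_left h3]; constructor <;> nlinarith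
      · rw [max_eq_right h3]; constructor <;> nlinarith

/-- The derivative of `clamp`. -/
def clampDeriv (ρ t : ℝ) : ℝ :=
  1 + (-max 0 (t - ρ) + max 0 (t - 3 * ρ) - max 0 (-t - ρ) + max 0 (-t - 3 * ρ)) / (2 * ρ)

theorem abs_clampDeriv_le {ρ : ℝ} (hρ : 0 < ρ) (t : ℝ) : |clampDeriv ρ t| ≤ 1 := by
  have h2 : 0 < 2 * ρ := by positivity
  have e : clampDeriv ρ t = (2 * ρ + (-max 0 (t - ρ) + max 0 (t - 3 * ρ) - max 0 (-t - ρ) +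
      max 0 (-t - 3 * ρ))) / (2 * ρ) := by
    rw [clampDeriv]; field_simp
  rw [e, abs_div, abs_of_pos h2, div_le_iff₀ h2, abs_le]
  rcases max_cases 0 (t - ρ) with h | h <;> rcases max_cases 0 (t - 3 * ρ) with h' | h' <;>
  rcases max_cases 0 (-t - ρ) with h'' | h'' <;> rcases max_cases 0 (-t - 3 * ρ) with h3 | h3 <;>
  constructor <;> linarith

theorem abs_clamp_sub_le {ρ : ℝ} (hρ : 0 < ρ) (s t : ℝ) :
    |clamp ρ s - clamp ρ t - clampDeriv ρ t * (s - t)| ≤ (s - t) ^ 2 / ρ := by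
  have h1 := abs_le.1 (abs_sq_max_sub_le (s - ρ) (t - ρ))
  have h2 := abs_le.1 (abs_sq_max_sub_le (s - 3 * ρ) (t - 3 * ρ))
  have h3 := abs_le.1 (abs_sq_max_sub_le (-s - ρ) (-t - ρ))
  have h4 := abs_le.1 (abs_sq_max_sub_le (-s - 3 * ρ) (-t - 3 * ρ))
  have h5 : 0 < 4 * ρ := by positivity
  have e : clamp ρ s - clamp ρ t - clampDeriv ρ t * (s - t) =
      (-(max 0 (s - ρ) ^ 2 - max 0 (t - ρ) ^ 2 - 2 * max 0 (t - ρ) * (s - t))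
       + (max 0 (s - 3 * ρ) ^ 2 - max 0 (t - 3 * ρ) ^ 2 - 2 * max 0 (t - 3 * ρ) * (s - t))
       + (max 0 (-s - ρ) ^ 2 - max 0 (-t - ρ) ^ 2 - 2 * max 0 (-t - ρ) * (t - s))
       - (max 0 (-s - 3 * ρ) ^ 2 - max 0 (-t - 3 * ρ) ^ 2
          - 2 * max 0 (-t - 3 * ρ) * (t - s))) / (4 * ρ) := by
    rw [clamp, clamp, clampDeriv]; field_simp; ring
  have e' : (s - t) ^ 2 / ρ = 4 * (s - t) ^ 2 / (4 * ρ) := by field_simp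
  rw [e, e', abs_div, abs_of_pos h5]
  gcongr
  rw [show s - ρ - (t - ρ) = s - t by ring] at h1
  rw [show s - 3 * ρ - (t - 3 * ρ) = s - t by ring] at h2
  rw [show -s - ρ - (-t - ρ) = t - s by ring, ← neg_sq, neg_sub] at h3
  rw [show -s - 3 * ρ - (-t - 3 * ρ) = t - s by ring, ← neg_sq, neg_sub] at h4
  rw [abs_le]
  constructor <;> linarith [h1.1, h1.2, h2.1, h2.2, h3.1, h3.2, h4.1, h4.2]

theorem c11_clamp {ρ : ℝ} (hρ : 0 < ρ) {a : E} (ha : ‖a‖ ≤ 1) (b : ℝ) :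
    C11 ρ (fun x => clamp ρ (inner ℝ a x + b)) (2 * ρ) := by
  refine fun w hw => ⟨abs_clamp_le hρ _, clampDeriv ρ (inner ℝ a w + b) • a, ?_, fun u hu => ?_⟩
  · rw [norm_smul, Real.norm_eq_abs]
    have := mul_le_mul (abs_clampDeriv_le hρ (inner ℝ a w + b)) ha (norm_nonneg _) zero_le_one
    nlinarith
  · have h1 := abs_clamp_sub_le hρ (inner ℝ a u + b) (inner ℝ a w + b)
    rw [add_sub_add_right_eq_sub, ← inner_sub_right] at h1
    rw [real_inner_smul_left]
    refine h1.trans ?_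
    have h2 : inner ℝ a (u - w) ^ 2 ≤ ‖u - w‖ ^ 2 := by
      rw [← sq_abs]
      exact pow_le_pow_left₀ (abs_nonneg _) ((abs_real_inner_le_norm a (u - w)).trans
        (mul_le_of_le_one_left (norm_nonneg _) ha)) 2
    have h3 : 2 * ρ * (‖u - w‖ / ρ) ^ 2 = 2 * ‖u - w‖ ^ 2 / ρ := by field_simp
    rw [h3]
    gcongr
    nlinarith [sq_nonneg ‖u - w‖]

end Clamp

section LocalTaylor

variable {n : ℕ}

/-- The monomial with exponents `s` in the coordinates centred at `e`. -/
def qMon (e : Eucl n) {d : ℕ} (s : Fin n → Fin d) (x : Eucl n) : ℝ :=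
  ∏ l, (x l - e l) ^ (s l : ℕ)

/-- The polynomial with coefficients `a` in the coordinates centred at `e`. -/
def qPoly (e : Eucl n) {d : ℕ} (a : (Fin n → Fin d) → ℝ) (x : Eucl n) : ℝ :=
  ∑ s, a s * qMon e s x

/-- Up to small `C^{1,1}` errors, `F` is near `e` a polynomial with coefficients bounded by `C`. -/
def IsLocal (k : ℕ) (e : Eucl n) (C : ℝ) (F : Eucl n → ℝ) : Prop :=
  ∃ a : (Fin n → Fin (k + 2)) → ℝ, ∑ s, |a s| ≤ C ∧ ∀ ρ : ℝ, 0 < ρ → ρ ≤ 1 →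
    ∃ R : Eucl n → ℝ, C11 1 R (C * ρ ^ k) ∧
      ∀ x, ‖x‖ = 1 → ‖x - e‖ ≤ ρ → F x = qPoly e a x + R x

variable {k : ℕ} {e : Eucl n}

theorem IsLocal.nonneg {C : ℝ} {F : Eucl n → ℝ} (h : IsLocal k e C F) : 0 ≤ C := by
  obtain ⟨a, ha, -⟩ := h
  exact (Finset.sum_nonneg fun s _ => abs_nonneg (a s)).trans ha

theorem IsLocal.mono {C C' : ℝ} {F : Eucl n → ℝ} (h : IsLocal k e C F) (hC : C ≤ C') :
    IsLocal k e C' F := by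
  obtain ⟨a, ha, h⟩ := h
  refine ⟨a, ha.trans hC, fun ρ hρ hρ1 => ?_⟩
  obtain ⟨R, hR, h⟩ := h ρ hρ hρ1
  exact ⟨R, hR.mono (by gcongr), h⟩

theorem IsLocal.add {C C' : ℝ} {F G : Eucl n → ℝ} (h : IsLocal k e C F) (h' : IsLocal k e C' G) :
    IsLocal k e (C + C') (F + G) := by
  obtain ⟨a, ha, h⟩ := h
  obtain ⟨a', ha', h'⟩ := h'
  refine ⟨a + a', ?_, fun ρ hρ hρ1 => ?_⟩
  · refine le_trans ?_ (add_le_add ha ha')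
    rw [← Finset.sum_add_distrib]
    exact Finset.sum_le_sum fun s _ => abs_add_le _ _
  obtain ⟨R, hR, h⟩ := h ρ hρ hρ1
  obtain ⟨R', hR', h'⟩ := h' ρ hρ hρ1
  refine ⟨R + R', by rw [add_mul]; exact hR.add zero_le_one hR', fun x hx hxe => ?_⟩
  rw [Pi.add_apply, Pi.add_apply, h x hx hxe, h' x hx hxe]
  simp only [qPoly, Pi.add_apply, add_mul, Finset.sum_add_distrib]
  ring

theorem IsLocal.smul {C : ℝ} {F : Eucl n → ℝ} (h : IsLocal k e C F) (t : ℝ) :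
    IsLocal k e (|t| * C) (t • F) := by
  obtain ⟨a, ha, h⟩ := h
  refine ⟨t • a, ?_, fun ρ hρ hρ1 => ?_⟩
  · simp only [Pi.smul_apply, smul_eq_mul, abs_mul, ← Finset.mul_sum]
    gcongr
  obtain ⟨R, hR, h⟩ := h ρ hρ hρ1
  refine ⟨t • R, by rw [mul_assoc]; exact hR.smul t, fun x hx hxe => ?_⟩
  rw [Pi.smul_apply, h x hx hxe]
  simp only [qPoly, Pi.smul_apply, smul_eq_mul, mul_add, Finset.mul_sum, mul_assoc]

theorem isLocal_zero : IsLocal k e 0 (0 : Eucl n → ℝ) :=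
  ⟨0, by simp, fun ρ _ _ => ⟨0, by simpa using c11_zero 1, fun x _ _ => by simp [qPoly]⟩⟩

theorem IsLocal.sum {ι : Type*} (s : Finset ι) {F : ι → Eucl n → ℝ} {C : ι → ℝ}
    (h : ∀ i ∈ s, IsLocal k e (C i) (F i)) : IsLocal k e (∑ i ∈ s, C i) (∑ i ∈ s, F i) := by
  classical
  induction s using Finset.induction_on with
  | empty => simpa using isLocal_zero
  | insert a s ha ih =>
    rw [Finset.sum_insert ha, Finset.sum_insert ha]
    exact (h a (Finset.mem_insert_self a s)).add
      (ih fun i hi => h i (Finset.mem_insert_of_mem hi))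

theorem isLocal_of_remainder {C : ℝ} (hC : 0 ≤ C) {F : Eucl n → ℝ} (h : ∀ ρ : ℝ, 0 < ρ → ρ ≤ 1 →
    ∃ R : Eucl n → ℝ, C11 1 R (C * ρ ^ k) ∧ ∀ x, ‖x‖ = 1 → ‖x - e‖ ≤ ρ → F x = R x) :
    IsLocal k e C F := by
  refine ⟨0, by simpa using hC, fun ρ hρ hρ1 => ?_⟩
  obtain ⟨R, hR, h⟩ := h ρ hρ hρ1
  exact ⟨R, hR, fun x hx hxe => by rw [h x hx hxe]; simp [qPoly]⟩

theorem isLocal_qMon (s : Fin n → Fin (k + 2)) : IsLocal k e 1 (qMon e s) := by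
  classical
  refine ⟨Pi.single s 1, ?_, fun ρ hρ hρ1 => ⟨0, (c11_zero 1).mono (by positivity), ?_⟩⟩
  · rw [Finset.sum_eq_single s]
    · simp
    · intro t _ ht; simp [ht]
    · simp
  · intro x _ _
    rw [qPoly, Finset.sum_eq_single s]
    · simp
    · intro t _ ht; simp [ht]
    · simp

theorem coord_sub_eq_inner (e x : Eucl n) (l : Fin n) :
    x l - e l = inner ℝ (EuclideanSpace.single l (1 : ℝ)) x + -e l := by
  rw [EuclideanSpace.inner_single_left]; simp [sub_eq_add_neg]

theorem abs_coord_sub_le (e x : Eucl n) (l : Fin n) : |x l - e l| ≤ ‖x - e‖ := by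
  have := PiLp.norm_apply_le (x - e) l
  simpa using this

theorem isLocal_coord_mul_qMon (l : Fin n) (s : Fin n → Fin (k + 2)) :
    IsLocal k e (12 * (6 * 12 ^ (k + 1)) ^ n + 1) (fun x => (x l - e l) * qMon e s x) := by
  classical
  rcases Nat.lt_or_ge (s l : ℕ) (k + 1) with hs | hs
  · have : (fun x => (x l - e l) * qMon e s x) =
        qMon e (Function.update s l ⟨s l + 1, by omega⟩) := by
      funext x
      rw [qMon, qMon, ← Finset.mul_prod_erase _ _ (Finset.mem_univ l),
        ← Finset.mul_prod_erase _ _ (Finset.mem_univ l), Function.update_self, ← mul_assoc,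
        ← pow_succ']
      congr 1
      refine Finset.prod_congr rfl fun i hi => ?_
      rw [Function.update_of_ne (Finset.ne_of_mem_erase hi)]
    rw [this]
    have h0 : (0 : ℝ) ≤ 12 * (6 * 12 ^ (k + 1)) ^ n := by positivity
    exact (isLocal_qMon _).mono (by linarith)
  · have hsl : (s l : ℕ) = k + 1 := by have := (s l).2; omega
    refine isLocal_of_remainder (by positivity) fun ρ hρ hρ1 => ?_
    let τ : Fin n → Eucl n → ℝ := fun i x =>
      clamp ρ (inner ℝ (EuclideanSpace.single i (1 : ℝ)) x + -e i)
    have hτ : ∀ i, C11 ρ (τ i) (2 * ρ) := fun i => c11_clamp hρ (by simp) _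
    refine ⟨τ l * ∏ i, τ i ^ (s i : ℕ), ?_, fun x _ hxe => ?_⟩
    · have h1 : C11 ρ (∏ i, τ i ^ (s i : ℕ)) (∏ i, 6 * (6 * (2 * ρ)) ^ (s i : ℕ)) :=
        C11.prod hρ _ (fun i _ => by positivity) fun i _ => (hτ i).pow hρ (by positivity) _
      have h2 : ∏ i, 6 * (6 * (2 * ρ)) ^ (s i : ℕ) ≤ (6 * 12 ^ (k + 1)) ^ n * ρ ^ (k + 1) := by
        have h3 : ∀ i, 6 * (6 * (2 * ρ)) ^ (s i : ℕ) ≤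
            6 * 12 ^ (k + 1) * (if i = l then ρ ^ (k + 1) else 1) := by
          intro i
          have e1 : 6 * (2 * ρ) = 12 * ρ := by ring
          have e2 : (12 : ℝ) ^ (s i : ℕ) ≤ 12 ^ (k + 1) :=
            pow_le_pow_right₀ (by norm_num) (by have := (s i).2; omega)
          rw [e1, mul_pow, mul_assoc]
          gcongr
          split_ifs with hi
          · rw [hi, hsl]
          · exact pow_le_one₀ hρ.le hρ1
        refine (Finset.prod_le_prod (fun i _ => by positivity) fun i _ => h3 i).trans ?_
        rw [Finset.prod_mul_distrib, Finset.prod_const, Finset.prod_ite_eq' Finset.univ l]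
        simp
      have h3 := ((hτ l).mul hρ (by positivity) (by positivity) (h1.mono h2)).rescale
        (by positivity) hρ hρ1
      refine h3.mono (le_trans (le_of_eq ?_)
        (mul_le_mul_of_nonneg_right (le_add_of_nonneg_right zero_le_one) (by positivity)))
      field_simp
      ring
    · have h1 : ∀ i, τ i x = x i - e i := by
        intro i
        simp only [τ]
        rw [← coord_sub_eq_inner, clamp_of_abs_le ((abs_coord_sub_le e x i).trans hxe)]
      simp [qMon, h1]

theorem c11_coord_sub (he : ‖e‖ = 1) (l : Fin n) : C11 1 (fun x : Eucl n => x l - e l) 2 := by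
  have h := (c11_inner (ρ := 1) le_rfl (EuclideanSpace.single l (1 : ℝ))).add zero_le_one
    (c11_const 1 (-e l))
  have h1 := PiLp.norm_apply_le e l
  refine (h.congr fun x _ => ?_).mono ?_
  · rw [coord_sub_eq_inner]; rfl
  · rw [he, Real.norm_eq_abs] at h1
    rw [abs_neg, PiLp.norm_single, norm_one]
    linarith

theorem c11_qMon (he : ‖e‖ = 1) {d : ℕ} (s : Fin n → Fin (d + 1)) :
    C11 1 (qMon e s) ((6 * 12 ^ d) ^ n) := by
  have h := C11.prod one_pos Finset.univ (F := fun l => (fun x : Eucl n => x l - e l) ^ (s l : ℕ))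
    (fun l _ => by positivity) fun l _ => (c11_coord_sub he l).pow one_pos zero_le_two _
  refine (h.congr fun x _ => by simp [qMon]).mono ?_
  refine (Finset.prod_le_prod (g := fun _ => 6 * 12 ^ d) (fun i _ => by positivity)
    fun i _ => ?_).trans (by simp)
  norm_num
  exact pow_le_pow_right₀ (by norm_num) (by have := (s i).2; omega)

theorem c11_qPoly (he : ‖e‖ = 1) {d : ℕ} {a : (Fin n → Fin (d + 1)) → ℝ} {C : ℝ}
    (ha : ∑ s, |a s| ≤ C) : C11 1 (qPoly e a) (C * (6 * 12 ^ d) ^ n) := by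
  have h := C11.sum zero_le_one Finset.univ fun s _ => (c11_qMon he s).smul (a s)
  refine (h.congr fun x _ => by simp [qPoly]).mono ?_
  rw [← Finset.sum_mul]
  gcongr

/-- Multiplying by an affine function with bounded coefficients preserves local polynomiality. -/
theorem IsLocal.mul_affine (he : ‖e‖ = 1) {C : ℝ} {F : Eucl n → ℝ} (h : IsLocal k e C F)
    {α : ℝ} {β : Fin n → ℝ} (hα : |α| ≤ 1) (hβ : ∀ l, |β l| ≤ 1) :
    IsLocal k e (C + C * (n * (12 * (6 * 12 ^ (k + 1)) ^ n + 1)) + 6 * (C * (1 + n * 2)))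
      (fun x => F x * (α + ∑ l, β l * (x l - e l))) := by
  have hC := h.nonneg
  obtain ⟨a, ha, h⟩ := h
  have h1 : IsLocal k e C (∑ s, (a s * α) • qMon e s) := by
    refine (IsLocal.sum _ fun s _ => (isLocal_qMon s).smul (a s * α)).mono ?_
    refine le_trans (Finset.sum_le_sum fun s _ => ?_) ha
    rw [mul_one, abs_mul]
    exact mul_le_of_le_one_right (abs_nonneg _) hα
  have h2 : IsLocal k e (C * (n * (12 * (6 * 12 ^ (k + 1)) ^ n + 1)))
      (∑ s, ∑ l, (a s * β l) • fun x => (x l - e l) * qMon e s x) := by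
    refine (IsLocal.sum _ fun s _ => IsLocal.sum _ fun l _ =>
      (isLocal_coord_mul_qMon l s).smul (a s * β l)).mono ?_
    simp only [← Finset.sum_mul, abs_mul, ← Finset.mul_sum, ← mul_assoc]
    gcongr
    · refine (Finset.sum_le_sum fun l _ => hβ l).trans ?_
      simp
  have h3 : IsLocal k e (6 * (C * (1 + n * 2))) (fun x => F x * (α + ∑ l, β l * (x l - e l)) -
      qPoly e a x * (α + ∑ l, β l * (x l - e l))) := by
    refine isLocal_of_remainder (by positivity) fun ρ hρ hρ1 => ?_
    obtain ⟨R, hR, h⟩ := h ρ hρ hρ1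
    have hL : C11 1 (fun x : Eucl n => α + ∑ l, β l * (x l - e l)) (1 + n * 2) := by
      have := (c11_const (E := Eucl n) 1 α).add zero_le_one
        (C11.sum zero_le_one Finset.univ fun l _ => (c11_coord_sub he l).smul (β l))
      refine (this.congr fun x _ => by simp).mono ?_
      rw [← Finset.sum_mul]
      gcongr
      refine (Finset.sum_le_sum fun l _ => hβ l).trans ?_
      simp
    refine ⟨R * fun x : Eucl n => α + ∑ l, β l * (x l - e l), ?_, fun x hx hxe => ?_⟩
    · exact (hR.mul one_pos (by positivity) (by positivity) hL).mono (le_of_eq (by ring))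
    · rw [h x hx hxe, Pi.mul_apply]; ring
  have := (h1.add h2).add h3
  convert this using 1
  funext x
  simp only [Pi.add_apply, Finset.sum_apply, Pi.smul_apply, smul_eq_mul]
  have e1 : qPoly e a x * (α + ∑ l, β l * (x l - e l)) = ∑ s, a s * α * qMon e s x +
      ∑ s, ∑ l, a s * β l * ((x l - e l) * qMon e s x) := by
    rw [mul_add, qPoly, Finset.sum_mul, Finset.sum_mul]
    congr 1
    · exact Finset.sum_congr rfl fun s _ => by ring
    · refine Finset.sum_congr rfl fun s _ => ?_
      rw [Finset.mul_sum]
      exact Finset.sum_congr rfl fun l _ => by ring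
  rw [← e1]
  ring

end LocalTaylor

section Caps

variable {n : ℕ} {μ : ConvexBody (Eucl n) → ℝ}

theorem IsVal.exists_bound_dExt_sub' (hμ : IsVal μ) (r M : ℝ) : ∃ C, 0 ≤ C ∧
    ∀ f R φ ε s, NormBound f r → NormBound R ε → ε ≤ M → NormBound φ s →
      |dExt μ (f + R) φ - dExt μ f φ| ≤ C * ε * s := by
  obtain ⟨C, hC, h⟩ := hμ.exists_bound_dExt_sub r
  obtain ⟨C', hC', h'⟩ := hμ.exists_bound_dExt (r + |M|)
  refine ⟨C + 2 * C', by positivity, fun f R φ ε s hf hR hε hφ => ?_⟩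
  have hs := hφ.nonneg
  have hε0 := hR.nonneg
  rcases le_total ε 1 with h1 | h1
  · refine (h f R φ ε s hf hR h1 hφ).trans ?_
    gcongr
    linarith
  · have e1 := h' f φ s (hf.mono (by linarith [abs_nonneg M])) hφ
    have e2 := h' (f + R) φ s ((hf.add hR).mono (by linarith [le_abs_self M])) hφ
    refine (abs_sub _ _).trans ?_
    have : C' * s ≤ C' * s * ε := le_mul_of_one_le_right (by positivity) h1
    nlinarith [mul_nonneg (mul_nonneg hC hε0) hs]

/-- A `C^{1,1}` bump supported in a small cap around the direction of `y`. -/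
def cap (ρ : ℝ) (y x : Eucl n) : ℝ := max 0 (inner ℝ y x + ‖y‖ * (ρ ^ 2 / 8 - 1)) ^ 2

theorem cap_nonneg (ρ : ℝ) (y x : Eucl n) : 0 ≤ cap ρ y x := sq_nonneg _

theorem c11_cap {ρ : ℝ} (hρ : 0 < ρ) (hρ1 : ρ ≤ 1) {y : Eucl n} (hy : ‖y‖ ≤ 1) :
    C11 1 (cap ρ y) 8 := by
  refine (c11_sq_max (b := 2) hy one_le_two fun x hx => ?_).mono (by norm_num)
  have := (abs_le.1 (abs_real_inner_le_norm y x)).2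
  rw [hx, mul_one] at this
  nlinarith [norm_nonneg y, pow_le_one₀ (n := 2) hρ.le hρ1]

theorem norm_sub_sq_of_unit {e x : Eucl n} (he : ‖e‖ = 1) (hx : ‖x‖ = 1) :
    ‖x - e‖ ^ 2 = 2 - 2 * inner ℝ e x := by
  rw [norm_sub_sq_real, hx, he, real_inner_comm]; ring

theorem cap_eq_zero {ρ : ℝ} {e x : Eucl n} (he : ‖e‖ = 1)
    (h : inner ℝ e x ≤ 1 - ρ ^ 2 / 8) : cap ρ e x = 0 := by
  rw [cap, he, max_eq_left (by linarith)]; norm_num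

theorem cap_eq_zero_of_lt_norm {ρ : ℝ} (hρ : 0 < ρ) {e x : Eucl n} (he : ‖e‖ = 1) (hx : ‖x‖ = 1)
    (h : ρ < ‖x - e‖) : cap ρ e x = 0 := by
  refine cap_eq_zero he ?_
  have := norm_sub_sq_of_unit he hx
  nlinarith

theorem IsVal.dExt_cap_congr (hμ : IsVal μ) {e : Eucl n} (he : ‖e‖ = 1) {ρ : ℝ} (hρ : 0 < ρ)
    (hρ1 : ρ ≤ 1) {F G q : Eucl n → ℝ} {c₁ c₂ c₃ : ℝ} (hc₁ : 0 ≤ c₁) (hc₂ : 0 ≤ c₂)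
    (hc₃ : 0 ≤ c₃) (hF : C11 1 F c₁) (hG : C11 1 G c₂) (hq : C11 1 q c₃)
    (hFG : ∀ x, ‖x‖ = 1 → ‖x - e‖ ≤ ρ → F x = G x) :
    dExt μ (hom F) (hom (cap ρ e * q)) = dExt μ (hom G) (hom (cap ρ e * q)) := by
  have hcap := c11_cap hρ hρ1 he.le
  have hn : ∀ q : Eucl n → ℝ, (∃ c, 0 ≤ c ∧ C11 1 q c) → (∀ x, ‖x‖ = 1 → 0 ≤ q x) →
      dExt μ (hom F) (hom (cap ρ e * q)) = dExt μ (hom G) (hom (cap ρ e * q)) := by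
    rintro q ⟨c₃, hc₃, hq⟩ hq0
    have hδ : 0 < 3 * ρ ^ 2 / 8 := by positivity
    let K := (c₁ + c₂) / (3 * ρ ^ 2 / 8) ^ 2
    let S : Eucl n → ℝ := K • fun x => max 0 (inner ℝ (-e) x + (1 - ρ ^ 2 / 8)) ^ 2
    have hK : 0 ≤ K := by positivity
    have hS : C11 1 S (|K| * 8) := by
      refine C11.smul ((c11_sq_max (b := 2) (by simp [he]) one_le_two fun x hx => ?_).mono
        (by norm_num)) K
      have := (abs_le.1 (abs_real_inner_le_norm (-e) x)).2
      rw [hx, mul_one, norm_neg, he] at this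
      nlinarith
    have hS0 : ∀ x, 0 ≤ S x := fun x => mul_nonneg hK (sq_nonneg _)
    have hScap : ∀ x, ‖x‖ = 1 → cap ρ e x = 0 ∨ S x = 0 := by
      intro x hx
      rcases le_total (inner ℝ e x) (1 - ρ ^ 2 / 8) with h | h
      · exact Or.inl (cap_eq_zero he h)
      · right
        simp only [S, Pi.smul_apply, inner_neg_left]
        rw [max_eq_left (by linarith)]; simp
    have hSbig : ∀ x, ‖x‖ = 1 → ρ < ‖x - e‖ → c₁ + c₂ ≤ S x := by
      intro x hx hxe
      have h1 := norm_sub_sq_of_unit he hx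
      have h2 : 3 * ρ ^ 2 / 8 ≤ inner ℝ (-e) x + (1 - ρ ^ 2 / 8) := by
        rw [inner_neg_left]; nlinarith
      have h3 : (3 * ρ ^ 2 / 8) ^ 2 ≤ max 0 (inner ℝ (-e) x + (1 - ρ ^ 2 / 8)) ^ 2 :=
        pow_le_pow_left₀ hδ.le (h2.trans (le_max_right _ _)) 2
      calc c₁ + c₂ = K * (3 * ρ ^ 2 / 8) ^ 2 := by simp only [K]; field_simp
        _ ≤ S x := mul_le_mul_of_nonneg_left h3 hK
    have hT0 : ∀ x, ‖x‖ = 1 → 0 ≤ (F - G + S) x := by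
      intro x hx
      rw [Pi.add_apply, Pi.sub_apply]
      rcases le_or_gt ‖x - e‖ ρ with h | h
      · rw [hFG x hx h]; simpa using hS0 x
      · have h1 := (abs_le.1 (hF x hx).1).1
        have h2 := (abs_le.1 (hG x hx).1).2
        linarith [hSbig x hx h]
    have hTcap : ∀ x, ‖x‖ = 1 → cap ρ e x = 0 ∨ (F - G + S) x = 0 := by
      intro x hx
      rcases le_or_gt ‖x - e‖ ρ with h | h
      · refine (hScap x hx).imp id fun h' => ?_
        rw [Pi.add_apply, Pi.sub_apply, hFG x hx h, h']; ring
      · exact Or.inl (cap_eq_zero_of_lt_norm hρ he hx h)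
    have homn : ∀ H : Eucl n → ℝ, (∀ x, ‖x‖ = 1 → 0 ≤ H x) → ∀ x, 0 ≤ hom H x := by
      intro H hH x
      rcases eq_or_ne x 0 with rfl | hx
      · simp [hom]
      · exact mul_nonneg (norm_nonneg _) (hH _ (norm_inv_norm_smul hx))
    have homz : ∀ H : Eucl n → ℝ, (∀ x, ‖x‖ = 1 → cap ρ e x = 0 ∨ H x = 0) →
        ∀ x, hom (cap ρ e * q) x = 0 ∨ hom H x = 0 := by
      intro H hH x
      rcases eq_or_ne x 0 with rfl | hx
      · simp [hom]
      · exact (hH _ (norm_inv_norm_smul hx)).imp (fun h => by simp [hom, h])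
          fun h => by simp [hom, h]
    have hφN := (hcap.mul one_pos (by norm_num) hc₃ hq).normBound (by positivity)
    have hφ0 := homn (cap ρ e * q) fun x hx => mul_nonneg (cap_nonneg _ _ _) (hq0 x hx)
    have hT : C11 1 (F - G + S) (c₁ + c₂ + |K| * 8) := by
      rw [sub_eq_add_neg]
      exact (hF.add zero_le_one hG.neg).add zero_le_one hS
    have e1 := hμ.dExt_add_of_mul_eq_zero_of_nonneg (hF.normBound hc₁) hφN
      (hS.normBound (by positivity)) hφ0 (homn S fun x _ => hS0 x) (homz S hScap)
    have e2 := hμ.dExt_add_of_mul_eq_zero_of_nonneg (hG.normBound hc₂) hφN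
      (hT.normBound (by positivity)) hφ0 (homn _ hT0) (homz _ hTcap)
    rw [← e1, ← e2, ← hom_add, ← hom_add]
    congr 2
    abel
  have hq1 : C11 1 (q + fun _ => c₃) (c₃ + |c₃|) := hq.add zero_le_one (c11_const 1 c₃)
  have hq2 : C11 1 (fun _ : Eucl n => c₃) |c₃| := c11_const 1 c₃
  have h1 := hn (q + fun _ => c₃) ⟨_, by positivity, hq1⟩ fun x hx => by
    rw [Pi.add_apply]; linarith [(abs_le.1 (hq x hx).1).1]
  have h2 := hn (fun _ => c₃) ⟨_, by positivity, hq2⟩ fun x _ => hc₃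
  have hN1 := (hcap.mul one_pos (by norm_num) hc₃ hq).normBound (by positivity)
  have hN2 := (hcap.mul one_pos (by norm_num) (abs_nonneg _) hq2).normBound (by positivity)
  rw [mul_add, hom_add, hμ.dExt_add (hF.normBound hc₁) hN1 hN2,
    hμ.dExt_add (hG.normBound hc₂) hN1 hN2, h2] at h1
  exact add_right_cancel h1

/-- Near a cap, a locally polynomial function may be replaced by its polynomial part. -/
theorem IsVal.exists_bound_dExt_cap (hμ : IsVal μ) (k : ℕ) {c C : ℝ} (hc : 0 ≤ c) (hC : 0 ≤ C) :
    ∃ B, 0 ≤ B ∧ ∀ (e : Eucl n) (F R : Eucl n → ℝ) (a : (Fin n → Fin (k + 2)) → ℝ) (ρ : ℝ),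
      ‖e‖ = 1 → 0 < ρ → ρ ≤ 1 → C11 1 F c → ∑ s, |a s| ≤ C → C11 1 R (C * ρ ^ k) →
      (∀ x, ‖x‖ = 1 → ‖x - e‖ ≤ ρ → F x = qPoly e a x + R x) →
      |dExt μ (hom F) (hom (cap ρ e * F)) -
        dExt μ (hom (qPoly e a)) (hom (cap ρ e * qPoly e a))| ≤ B * ρ ^ k := by
  obtain ⟨Q, hQ0, hQ⟩ : ∃ Q : ℝ, 0 ≤ Q ∧ ∀ (e : Eucl n) (a : (Fin n → Fin (k + 2)) → ℝ),
      ‖e‖ = 1 → ∑ s, |a s| ≤ C → C11 1 (qPoly e a) Q :=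
    ⟨C * (6 * 12 ^ (k + 1)) ^ n, by positivity, fun e a he ha => c11_qPoly he ha⟩
  obtain ⟨B₁, hB₁, h₁⟩ := hμ.exists_bound_dExt (4 * c)
  obtain ⟨B₂, hB₂, h₂⟩ := hμ.exists_bound_dExt_sub' (4 * Q) (4 * C)
  refine ⟨B₁ * (4 * (6 * (8 * C))) + B₂ * (4 * C) * (4 * (6 * (8 * Q))), by positivity, ?_⟩
  intro e F R a ρ he hρ hρ1 hF ha hR hloc
  have hp := hQ e a he ha
  have hcap := c11_cap hρ hρ1 he.le
  have hCρ : 0 ≤ C * ρ ^ k := by positivity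
  have hCρ1 : C * ρ ^ k ≤ C := mul_le_of_le_one_right hC (pow_le_one₀ hρ.le hρ1)
  have hcp := hcap.mul one_pos (by norm_num) hQ0 hp
  have hcR := hcap.mul one_pos (by norm_num) hCρ hR
  have hFN := hF.normBound hc
  have hpN := hp.normBound hQ0
  have hRN := hR.normBound hCρ
  have hcpN := hcp.normBound (by positivity)
  have hcRN := hcR.normBound (by positivity)
  have e1 : hom (cap ρ e * F) = hom (cap ρ e * qPoly e a) + hom (cap ρ e * R) := by
    rw [← hom_add]
    refine hom_congr fun x hx => ?_
    simp only [Pi.add_apply, Pi.mul_apply]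
    rcases le_or_gt ‖x - e‖ ρ with h | h
    · rw [hloc x hx h]; ring
    · rw [cap_eq_zero_of_lt_norm hρ he hx h]; ring
  have e2 := hμ.dExt_cap_congr he hρ hρ1 hc (by positivity) hQ0 hF (hp.add zero_le_one hR) hp hloc
  rw [e1, hμ.dExt_add hFN hcpN hcRN, e2, hom_add]
  have h3 := h₁ _ _ _ hFN hcRN
  have h4 := h₂ _ _ _ _ _ hpN hRN (by linarith) hcpN
  rw [add_sub_right_comm]
  refine (abs_add_le _ _).trans ((add_le_add h4 h3).trans (le_of_eq ?_))
  ring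

end Caps

section Invariance

variable {n : ℕ} {μ : ConvexBody (Eucl n) → ℝ}

theorem exists_linearIsometryEquiv {A : Matrix (Fin n) (Fin n) ℝ}
    (hA : A ∈ Matrix.orthogonalGroup (Fin n) ℝ) :
    ∃ U : Eucl n ≃ₗᵢ[ℝ] Eucl n, ∀ x, U x = Matrix.toEuclideanLin A x := by
  have h1 : A.transpose * A = 1 := by
    have := Matrix.mem_unitaryGroup_iff'.1 hA
    rwa [Matrix.star_eq_conjTranspose, Matrix.conjTranspose_eq_transpose_of_trivial] at this
  have hinner : ∀ x y : Eucl n,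
      inner ℝ (Matrix.toEuclideanLin A x) (Matrix.toEuclideanLin A y) = inner ℝ x y := by
    intro x y
    simp only [PiLp.inner_apply, RCLike.inner_apply, conj_trivial, Matrix.toLpLin_apply]
    change (A.mulVec y.ofLp) ⬝ᵥ (A.mulVec x.ofLp) = y.ofLp ⬝ᵥ x.ofLp
    rw [Matrix.dotProduct_mulVec, Matrix.vecMul_mulVec, h1, Matrix.vecMul_one]
  let L : Eucl n →ₗᵢ[ℝ] Eucl n := (Matrix.toEuclideanLin A).isometryOfInner hinner
  exact ⟨L.toLinearIsometryEquiv rfl, fun x => rfl⟩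

theorem supportFn_matBody {A : Matrix (Fin n) (Fin n) ℝ} {U : Eucl n ≃ₗᵢ[ℝ] Eucl n}
    (hU : ∀ x, U x = Matrix.toEuclideanLin A x) (K : ConvexBody (Eucl n)) (x : Eucl n) :
    supportFn (matBody A K) x = supportFn K (U.symm x) := by
  have key : ∀ y, inner ℝ x (Matrix.toEuclideanLin A y) = inner ℝ (U.symm x) y := by
    intro y
    rw [← hU, ← U.inner_map_map (U.symm x) y, U.apply_symm_apply]
  refine le_antisymm (supportFn_le ?_) (supportFn_le fun y hy => ?_)
  · rintro _ ⟨y, hy, rfl⟩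
    rw [key]
    exact inner_le_supportFn hy _
  · rw [← key]
    exact inner_le_supportFn (K := matBody A K) ⟨y, hy, rfl⟩ x

theorem SemiSublinear.comp {f : Eucl n → ℝ} {c : ℝ} (hf : SemiSublinear f c)
    (U : Eucl n ≃ₗᵢ[ℝ] Eucl n) : SemiSublinear (f ∘ U) c :=
  ⟨fun x y => by
      have := hf.add_le (U x) (U y)
      simp only [← map_add, U.norm_map] at this
      exact this,
    fun t x ht => by
      have := hf.map_smul t (U x) ht
      simp only [← map_smul, U.norm_map] at this
      exact this⟩

theorem IsVal.extVal_comp (hμ : IsVal μ) {A : Matrix (Fin n) (Fin n) ℝ} {U : Eucl n ≃ₗᵢ[ℝ] Eucl n}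
    (hU : ∀ x, U x = Matrix.toEuclideanLin A x) (hA : ∀ K, μ (matBody A K) = μ K)
    {f : Eucl n → ℝ} {c : ℝ} (hf : SemiSublinear f c) : extVal μ (f ∘ U) = extVal μ f := by
  rw [hμ.extVal_eq hf, hμ.extVal_eq (hf.comp U), extValAt, extValAt]
  refine Finset.sum_congr rfl fun i _ => ?_
  have hi : c ≤ c + i := by linarith [(Nat.cast_nonneg i : (0 : ℝ) ≤ i)]
  rw [← hA]
  congr 2
  refine supportFn_injective (funext fun x => ?_)
  rw [supportFn_matBody hU, supportFn_bodyOf ((hf.comp U).mono hi), supportFn_bodyOf (hf.mono hi)]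
  simp

theorem IsVal.dExt_comp (hμ : IsVal μ) {A : Matrix (Fin n) (Fin n) ℝ} {U : Eucl n ≃ₗᵢ[ℝ] Eucl n}
    (hU : ∀ x, U x = Matrix.toEuclideanLin A x) (hA : ∀ K, μ (matBody A K) = μ K)
    {f φ : Eucl n → ℝ} {c c' : ℝ} (hf : NormBound f c) (hφ : NormBound φ c') :
    dExt μ (f ∘ U) (φ ∘ U) = dExt μ f φ := by
  refine Finset.sum_congr rfl fun i _ => ?_
  rw [← hμ.extVal_comp hU hA (hf.add (hφ.smul i)).pos]
  rfl

theorem hom_comp (F : Eucl n → ℝ) (U : Eucl n ≃ₗᵢ[ℝ] Eucl n) : hom (F ∘ U) = hom F ∘ U := by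
  funext x; simp [hom]

theorem C11.comp {ρ : ℝ} {F : Eucl n → ℝ} {c : ℝ} (h : C11 ρ F c) (U : Eucl n ≃ₗᵢ[ℝ] Eucl n) :
    C11 ρ (F ∘ U) c := by
  intro w hw
  obtain ⟨h1, ξ, h2, h3⟩ := h (U w) (by simpa using hw)
  refine ⟨h1, U.symm ξ, by simpa using h2, fun u hu => ?_⟩
  have := h3 (U u) (by simpa using hu)
  rw [← map_sub, U.norm_map] at this
  rw [← U.inner_map_map (U.symm ξ), U.apply_symm_apply]
  exact this

theorem cap_comp (ρ : ℝ) (y : Eucl n) (U : Eucl n ≃ₗᵢ[ℝ] Eucl n) (x : Eucl n) :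
    cap ρ (U y) (U x) = cap ρ y x := by
  simp [cap]

end Invariance

section PolyGood

variable {n : ℕ}

/-- Functions on the sphere which are `C^{1,1}` and uniformly locally polynomial, in all
rotated coordinate systems. -/
def PolyGood (k : ℕ) (f : Eucl n → ℝ) : Prop :=
  ∃ C, 0 ≤ C ∧ C11 1 f C ∧ ∀ (U : Eucl n ≃ₗᵢ[ℝ] Eucl n) (e : Eucl n), ‖e‖ = 1 →
    IsLocal k e C (f ∘ U)

variable {k : ℕ}

theorem PolyGood.add {f g : Eucl n → ℝ} (hf : PolyGood k f) (hg : PolyGood k g) :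
    PolyGood k (f + g) := by
  obtain ⟨C, hC, h1, h2⟩ := hf
  obtain ⟨C', hC', h1', h2'⟩ := hg
  exact ⟨C + C', by positivity, h1.add zero_le_one h1',
    fun U e he => (h2 U e he).add (h2' U e he)⟩

theorem PolyGood.smul {f : Eucl n → ℝ} (hf : PolyGood k f) (t : ℝ) : PolyGood k (t • f) := by
  obtain ⟨C, hC, h1, h2⟩ := hf
  exact ⟨|t| * C, by positivity, h1.smul t, fun U e he => (h2 U e he).smul t⟩

theorem polyGood_one : PolyGood k (1 : Eucl n → ℝ) := by
  refine ⟨1, zero_le_one, (c11_const (E := Eucl n) 1 1).mono abs_one.le, fun U e _ => ?_⟩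
  have : (1 : Eucl n → ℝ) ∘ U = qMon e (fun _ => (0 : Fin (k + 2))) := by
    funext x; simp [qMon]
  rw [this]
  exact isLocal_qMon _

theorem abs_apply_le_of_unit {x : Eucl n} (hx : ‖x‖ = 1) (i : Fin n) : |x i| ≤ 1 := by
  have := PiLp.norm_apply_le x i
  rwa [hx] at this

theorem PolyGood.mul_coord {f : Eucl n → ℝ} (hf : PolyGood k f) (i : Fin n) :
    PolyGood k (fun x => f x * x i) := by
  obtain ⟨C, hC, h1, h2⟩ := hf
  have hi : C11 1 (fun x : Eucl n => x i) 1 := by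
    refine ((c11_inner (ρ := 1) le_rfl (EuclideanSpace.single i (1 : ℝ))).congr
      fun x _ => ?_).mono (by simp)
    rw [EuclideanSpace.inner_single_left]; simp
  set D := C + C * (n * (12 * (6 * 12 ^ (k + 1)) ^ n + 1)) + 6 * (C * (1 + n * 2)) with hD
  have hD0 : 0 ≤ D := by positivity
  refine ⟨6 * (C * 1) + D, by positivity,
    (h1.mul one_pos hC zero_le_one hi).mono (by linarith), fun U e he => ?_⟩
  have key : (fun x => f x * x i) ∘ U = fun x => (f ∘ U) x *
      ((U e) i + ∑ l, (U (EuclideanSpace.single l (1 : ℝ))) i * (x l - e l)) := by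
    funext x
    simp only [Function.comp_apply]
    congr 1
    have hx : x = e + ∑ l, (x l - e l) • EuclideanSpace.single l (1 : ℝ) := by
      ext j
      simp [Finset.sum_apply, Pi.single_apply]
    conv_lhs => rw [hx]
    simp [map_add, map_sum, mul_comm]
  rw [key]
  refine ((h2 U e he).mul_affine he (abs_apply_le_of_unit (by simpa using he) i) fun l => ?_).mono
    (by linarith [mul_nonneg (by norm_num : (0 : ℝ) ≤ 6) (mul_nonneg hC zero_le_one)])
  exact abs_apply_le_of_unit (by simp) i

end PolyGood

section Combination

variable {n : ℕ} {μ : ConvexBody (Eucl n) → ℝ}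

theorem IsVal.sum_mul {E : Type*} [NormedAddCommGroup E] [InnerProductSpace ℝ E] {ι : Type*}
    (s : Finset ι) {ν : ι → ConvexBody E → ℝ} (hν : ∀ i ∈ s, IsVal (ν i)) (a : ι → ℝ) :
    IsVal fun K => ∑ i ∈ s, a i * ν i K where
  val K L M I h h' := by
    simp only [← Finset.sum_add_distrib, ← mul_add]
    exact Finset.sum_congr rfl fun i hi => by rw [(hν i hi).val K L M I h h']
  cont := continuous_finsetSum _ fun i hi => continuous_const.mul (hν i hi).cont
  trans K x := Finset.sum_congr rfl fun i hi => by rw [(hν i hi).trans K x]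

/-- The finitely many functions testing a valuation near a cap. -/
def capTest (k : ℕ) (ρ : ℝ) (e : Eucl n) :
    (Fin n → Fin (k + 2)) ⊕ (Fin n → Fin (k + 2)) → Eucl n → ℝ :=
  Sum.elim (fun s => hom (qMon e s)) fun s => hom (cap ρ e * qMon e s)

theorem exists_normBound_capTest (k : ℕ) {ρ : ℝ} (hρ : 0 < ρ) (hρ1 : ρ ≤ 1) {e : Eucl n}
    (he : ‖e‖ = 1) : ∃ c : ℝ, ∀ i, NormBound (capTest k ρ e i) c := by
  have hQ0 : (0 : ℝ) ≤ (6 * 12 ^ (k + 1)) ^ n := by positivity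
  refine ⟨4 * ((6 * 12 ^ (k + 1)) ^ n + 6 * (8 * (6 * 12 ^ (k + 1)) ^ n)), ?_⟩
  rintro (s | s)
  · exact ((c11_qMon he s).normBound hQ0).mono (by linarith)
  · exact (((c11_cap hρ hρ1 he.le).mul one_pos (by norm_num) hQ0 (c11_qMon he s)).normBound
      (by positivity)).mono (by linarith)

theorem IsVal.dExt_qPoly_cap_eq_zero (hμ : IsVal μ) {k : ℕ} {ρ : ℝ} (hρ : 0 < ρ) (hρ1 : ρ ≤ 1)
    {e : Eucl n} (he : ‖e‖ = 1)
    (h : ∀ b : (Fin n → Fin (k + 2)) ⊕ (Fin n → Fin (k + 2)) → Fin (4 * n + 1),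
      extVal μ (∑ i, ((b i : ℕ) : ℝ) • capTest k ρ e i) = 0)
    (a : (Fin n → Fin (k + 2)) → ℝ) :
    dExt μ (hom (qPoly e a)) (hom (cap ρ e * qPoly e a)) = 0 := by
  obtain ⟨c, hc⟩ := exists_normBound_capTest k hρ hρ1 he
  refine Finset.sum_eq_zero fun j _ => ?_
  have := hμ.extVal_sum_smul_eq_zero Finset.univ hc h (Sum.elim a fun s => j * a s)
  have e1 : qPoly e a = ∑ s, a s • qMon e s := by
    funext x; simp [qPoly, Finset.sum_apply]
  have e2 : hom (qPoly e a) + (j : ℝ) • hom (cap ρ e * qPoly e a) =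
      ∑ i, Sum.elim a (fun s => j * a s) i • capTest k ρ e i := by
    rw [Fintype.sum_sum_type, e1, Finset.mul_sum, hom_sum, hom_sum, Finset.smul_sum]
    simp only [capTest, Sum.elim_inl, Sum.elim_inr, mul_smul_comm, hom_smul, mul_smul]
  rw [e2, this, zero_mul]

theorem exists_bound_dExt_cap_combination {ι : Type*} [Fintype ι]
    {μ : ι → ConvexBody (Eucl n) → ℝ} (hμ : ∀ j, IsVal (μ j)) {k : ℕ} {f : Eucl n → ℝ}
    (hf : PolyGood k f) :
    ∃ B, 0 ≤ B ∧ ∀ (c : ι → ℝ) (e : Eucl n) (ρ : ℝ), (∀ j, |c j| ≤ 1) → ‖e‖ = 1 → 0 < ρ → ρ ≤ 1 →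
      (∀ b : (Fin n → Fin (k + 2)) ⊕ (Fin n → Fin (k + 2)) → Fin (4 * n + 1),
        extVal (fun K => ∑ j, c j * μ j K) (∑ i, ((b i : ℕ) : ℝ) • capTest k ρ e i) = 0) →
      ∀ (A : Matrix (Fin n) (Fin n) ℝ) (U : Eucl n ≃ₗᵢ[ℝ] Eucl n),
        (∀ x, U x = Matrix.toEuclideanLin A x) →
        (∀ K, ∑ j, c j * μ j (matBody A K) = ∑ j, c j * μ j K) →
        |dExt (fun K => ∑ j, c j * μ j K) (hom f) (hom (cap ρ (U e) * f))| ≤ B * ρ ^ k := by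
  obtain ⟨C, hC, hf1, hf2⟩ := hf
  choose B hB0 hB using fun j => (hμ j).exists_bound_dExt_cap k hC hC
  refine ⟨∑ j, B j, Finset.sum_nonneg fun j _ => hB0 j,
    fun c e ρ hc he hρ hρ1 hdata A U hU hinv => ?_⟩
  have hν := IsVal.sum_mul Finset.univ (fun j _ => hμ j) c
  obtain ⟨a, ha, hloc⟩ := hf2 U e he
  obtain ⟨R, hR, hFR⟩ := hloc ρ hρ hρ1
  have hfU := hf1.comp U
  have hcap := c11_cap hρ hρ1 he.le
  have hcap' : C11 1 (cap ρ (U e)) 8 := c11_cap hρ hρ1 (by simp [he])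
  have hq : C11 1 (qPoly e a) (C * (6 * 12 ^ (k + 1)) ^ n) := c11_qPoly he ha
  have hq0 : 0 ≤ C * (6 * 12 ^ (k + 1)) ^ n := by positivity
  have e1 : hom (cap ρ (U e) * f) ∘ U = hom (cap ρ e * (f ∘ U)) := by
    rw [← hom_comp]
    congr 1
    funext x
    simp [cap_comp]
  rw [← hν.dExt_comp hU hinv (hf1.normBound hC)
    ((hcap'.mul one_pos (by norm_num) hC hf1).normBound (by positivity)), e1, ← hom_comp,
    ← sub_zero (dExt _ _ _), ← hν.dExt_qPoly_cap_eq_zero hρ hρ1 he hdata a,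
    IsVal.dExt_linear_combination _ (fun j _ => hμ j) c hν (hfU.normBound hC)
      ((hcap.mul one_pos (by norm_num) hC hfU).normBound (by positivity)),
    IsVal.dExt_linear_combination _ (fun j _ => hμ j) c hν (hq.normBound hq0)
      ((hcap.mul one_pos (by norm_num) hq0 hq).normBound (by positivity)),
    ← Finset.sum_sub_distrib, Finset.sum_mul]
  refine (Finset.abs_sum_le_sum_abs _ _).trans (Finset.sum_le_sum fun j _ => ?_)
  rw [← mul_sub, abs_mul]
  refine (mul_le_of_le_one_left (abs_nonneg _) (hc j)).trans ?_
  exact hB j e (f ∘ U) R a ρ he hρ hρ1 hfU ha hR hFR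

end Combination

section Averaging

open Filter Topology

variable {n : ℕ} {μ : ConvexBody (Eucl n) → ℝ}

theorem normBound_of_tendsto {E : Type*} [NormedAddCommGroup E] [InnerProductSpace ℝ E]
    {f : ℕ → E → ℝ} {g : E → ℝ} {c : ℝ}
    (hf : ∀ k, NormBound (f k) c) (h : ∀ x, Tendsto (fun k => f k x) atTop (𝓝 (g x))) :
    NormBound g c := by
  have key : ∀ {f : ℕ → E → ℝ} {g : E → ℝ}, (∀ k, SemiSublinear (f k) c) →
      (∀ x, Tendsto (fun k => f k x) atTop (𝓝 (g x))) → SemiSublinear g c := by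
    intro f g hf h
    have h' : ∀ x, Tendsto (fun k => f k x + c * ‖x‖) atTop (𝓝 (g x + c * ‖x‖)) :=
      fun x => (h x).add_const _
    exact ⟨fun x y => le_of_tendsto_of_tendsto' (h' (x + y)) ((h' x).add (h' y))
        fun k => (hf k).add_le x y,
      fun t x ht => tendsto_nhds_unique (h' (t • x)) (((h' x).const_mul t).congr
        fun k => ((hf k).map_smul t x ht).symm)⟩
  exact ⟨(hf 0).nonneg, fun x => le_of_tendsto' (h x).abs fun k => (hf k).bound x,
    key (fun k => (hf k).pos) h, key (fun k => (hf k).neg) fun x => (h x).neg⟩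

/-- Extension by zero of a function on the sphere. -/
def sphereExt (φ : C(Metric.sphere (0 : Eucl n) 1, ℝ)) (x : Eucl n) : ℝ :=
  if h : ‖x‖ = 1 then φ ⟨x, by simpa using h⟩ else 0

theorem sphereExt_apply (φ : C(Metric.sphere (0 : Eucl n) 1, ℝ)) {x : Eucl n} (h : ‖x‖ = 1) :
    sphereExt φ x = φ ⟨x, by simpa using h⟩ := dif_pos h

theorem sphereExt_combination (a b : ℝ) (φ ψ : C(Metric.sphere (0 : Eucl n) 1, ℝ)) :
    sphereExt (a • φ + b • ψ) = a • sphereExt φ + b • sphereExt ψ := by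
  funext x
  by_cases h : ‖x‖ = 1 <;> simp [sphereExt, h]

theorem convex_setOf_dExt_le (hμ : IsVal μ) {f : Eucl n → ℝ} {C r b : ℝ}
    (hf : NormBound (hom f) C) :
    Convex ℝ {φ : C(Metric.sphere (0 : Eucl n) 1, ℝ) | NormBound (hom (sphereExt φ * f)) r ∧
      |dExt μ (hom f) (hom (sphereExt φ * f))| ≤ b} := by
  rintro φ ⟨h1, h2⟩ ψ ⟨h1', h2'⟩ a c ha hc hac
  have e : hom (sphereExt (a • φ + c • ψ) * f) =
      a • hom (sphereExt φ * f) + c • hom (sphereExt ψ * f) := by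
    rw [sphereExt_combination, add_mul, smul_mul_assoc, smul_mul_assoc, hom_add, hom_smul,
      hom_smul]
  rw [Set.mem_ofPred_eq, e]
  refine ⟨((h1.smul a).add (h1'.smul c)).mono ?_, ?_⟩
  · rw [abs_of_nonneg ha, abs_of_nonneg hc, ← add_mul, hac, one_mul]
  · rw [hμ.dExt_add hf (h1.smul a) (h1'.smul c), hμ.dExt_smul hf h1, hμ.dExt_smul hf h1']
    refine (abs_add_le _ _).trans ?_
    rw [abs_mul, abs_mul, abs_of_nonneg ha, abs_of_nonneg hc]
    calc _ ≤ a * b + c * b := by gcongr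
      _ = b := by rw [← add_mul, hac, one_mul]

theorem isClosed_setOf_dExt_le (hμ : IsVal μ) {f : Eucl n → ℝ} {C M r b : ℝ}
    (hf : NormBound (hom f) C) (hM : ∀ x, ‖x‖ = 1 → |f x| ≤ M) :
    IsClosed {φ : C(Metric.sphere (0 : Eucl n) 1, ℝ) | NormBound (hom (sphereExt φ * f)) r ∧
      |dExt μ (hom f) (hom (sphereExt φ * f))| ≤ b} := by
  refine IsSeqClosed.isClosed fun φ ψ hφ hlim => ?_
  have hdist : ∀ k x, |hom (sphereExt (φ k) * f) x - hom (sphereExt ψ * f) x| ≤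
      dist (φ k) ψ * M * ‖x‖ := by
    intro k
    refine abs_hom_sub_le fun x hx => ?_
    rw [Pi.mul_apply, Pi.mul_apply, ← sub_mul, abs_mul, sphereExt_apply _ hx,
      sphereExt_apply _ hx, ← Real.dist_eq]
    exact mul_le_mul (ContinuousMap.dist_apply_le_dist _) (hM x hx) (abs_nonneg _) dist_nonneg
  have hε : Tendsto (fun k => dist (φ k) ψ * M) atTop (𝓝 0) := by
    simpa using (tendsto_iff_dist_tendsto_zero.1 hlim).mul_const M
  have hN : NormBound (hom (sphereExt ψ * f)) r := by
    refine normBound_of_tendsto (fun k => (hφ k).1) fun x => ?_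
    rw [tendsto_iff_dist_tendsto_zero]
    exact squeeze_zero (fun _ => dist_nonneg) (fun k => hdist k x) (by simpa using hε.mul_const ‖x‖)
  exact ⟨hN, le_of_tendsto' (hμ.tendsto_dExt hf (fun k => (hφ k).1) hN hε hdist).abs
    fun k => (hφ k).2⟩

theorem continuous_cap (ρ : ℝ) : Continuous fun p : Eucl n × Eucl n => cap ρ p.1 p.2 := by
  unfold cap
  fun_prop

theorem integrableOn_cap (ρ : ℝ) (x : Eucl n) :
    IntegrableOn (fun y => cap ρ y x) (Metric.closedBall 0 1) :=
  ((continuous_cap ρ).comp (.prodMk_left x)).continuousOn.integrableOn_compact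
    (isCompact_closedBall _ _)

theorem integral_cap_eq (ρ : ℝ) {x x' : Eucl n} (hx : ‖x‖ = 1) (hx' : ‖x'‖ = 1) :
    ∫ y in Metric.closedBall 0 1, cap ρ y x = ∫ y in Metric.closedBall 0 1, cap ρ y x' := by
  let U : Eucl n ≃ₗᵢ[ℝ] Eucl n := (Submodule.span ℝ {x - x'})ᗮ.reflection
  have hU : U x = x' := Submodule.reflection_sub (by rw [hx, hx'])
  have := U.measurePreserving.setIntegral_preimage_emb U.toMeasurableEquiv.measurableEmbedding
    (fun y => cap ρ y x') (Metric.closedBall 0 1)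
  rw [← this, U.preimage_closedBall, map_zero, ← hU]
  simp only [cap_comp]

theorem le_integral_cap {ρ : ℝ} (hρ : 0 < ρ) (hρ1 : ρ ≤ 1) {x : Eucl n} (hx : ‖x‖ = 1) :
    (ρ ^ 2 / 64) ^ n * (ρ ^ 4 / 1024) * volume.real (Metric.closedBall (0 : Eucl n) 1) ≤
      ∫ y in Metric.closedBall 0 1, cap ρ y x := by
  have hδ : 0 ≤ ρ ^ 2 / 64 := by positivity
  have hρ2 : ρ ^ 2 ≤ 1 := pow_le_one₀ hρ.le hρ1
  let z : Eucl n := (1 / 2 : ℝ) • x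
  have hz : ‖z‖ = 1 / 2 := by simp [z, norm_smul, hx]
  have hsub : Metric.closedBall z (ρ ^ 2 / 64) ⊆ Metric.closedBall 0 1 := by
    refine Metric.closedBall_subset_closedBall' ?_
    rw [dist_zero_right, hz]; linarith
  have hvol : volume.real (Metric.closedBall z (ρ ^ 2 / 64)) =
      (ρ ^ 2 / 64) ^ n * volume.real (Metric.closedBall (0 : Eucl n) 1) := by
    rw [Measure.real, Measure.real, Measure.addHaar_closedBall _ _ hδ,
      Measure.addHaar_closedBall _ _ zero_le_one, finrank_euclideanSpace_fin]
    simp [ENNReal.toReal_ofReal, hδ]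
  have hle : ∀ y ∈ Metric.closedBall z (ρ ^ 2 / 64), ρ ^ 4 / 1024 ≤ cap ρ y x := by
    intro y hy
    rw [mem_closedBall_iff_norm] at hy
    have h1 : 1 / 2 - ρ ^ 2 / 64 ≤ inner ℝ y x := by
      have e : inner ℝ y x = inner ℝ (y - z) x + 1 / 2 := by
        simp [z, inner_sub_left, real_inner_smul_left, hx]
      have := (abs_le.1 (abs_real_inner_le_norm (y - z) x)).1
      rw [hx, mul_one] at this
      linarith
    have h2 : ‖y‖ ≤ 1 / 2 + ρ ^ 2 / 64 := by
      have := norm_add_le (y - z) z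
      rw [sub_add_cancel, hz] at this
      linarith
    have h3 : ρ ^ 2 / 32 ≤ inner ℝ y x + ‖y‖ * (ρ ^ 2 / 8 - 1) := by
      nlinarith [mul_nonneg hδ hδ, norm_nonneg y]
    have h4 := pow_le_pow_left₀ (by positivity) (h3.trans (le_max_right 0 _)) 2
    refine le_trans (le_of_eq ?_) h4
    ring
  calc _ = ∫ y in Metric.closedBall z (ρ ^ 2 / 64), ρ ^ 4 / 1024 := by
        rw [setIntegral_const, hvol, smul_eq_mul]; ring
    _ ≤ ∫ y in Metric.closedBall z (ρ ^ 2 / 64), cap ρ y x :=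
        setIntegral_mono_on (integrableOn_const (by
          exact (isCompact_closedBall _ _).measure_lt_top.ne))
              ((integrableOn_cap ρ x).mono_set hsub)
          measurableSet_closedBall hle
    _ ≤ _ := setIntegral_mono_set (integrableOn_cap ρ x)
        (Eventually.of_forall fun y => cap_nonneg _ _ _) hsub.eventuallyLE

theorem IsVal.abs_dExt_hom_le (hμ : IsVal μ) {f : Eucl n → ℝ} {C : ℝ} (hC : 0 ≤ C)
    (hf : C11 1 f C) {ρ b : ℝ} (hρ : 0 < ρ) (hρ1 : ρ ≤ 1) (hb : 0 ≤ b)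
    (h : ∀ y : Eucl n, ‖y‖ = 1 → |dExt μ (hom f) (hom (cap ρ y * f))| ≤ b)
    {x₀ : Eucl n} (hx₀ : ‖x₀‖ = 1) :
    (ρ ^ 2 / 64) ^ n * (ρ ^ 4 / 1024) * |dExt μ (hom f) (hom f)| ≤ b := by
  have hfN := hf.normBound hC
  have hcont : Continuous fun p : Eucl n × Metric.sphere (0 : Eucl n) 1 =>
      cap ρ p.1 (p.2 : Eucl n) := by
    unfold cap
    fun_prop
  let Φ : C(Eucl n, C(Metric.sphere (0 : Eucl n) 1, ℝ)) := ContinuousMap.curry ⟨_, hcont⟩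
  have hΦ : ∀ y, hom (sphereExt (Φ y) * f) = hom (cap ρ y * f) := fun y =>
    hom_congr fun x hx => by rw [Pi.mul_apply, Pi.mul_apply, sphereExt_apply _ hx]; rfl
  have hcapN : ∀ y : Eucl n, ‖y‖ ≤ 1 → NormBound (hom (cap ρ y * f)) (4 * (6 * (8 * C))) :=
    fun y hy => ((c11_cap hρ hρ1 hy).mul one_pos (by norm_num) hC hf).normBound (by positivity)
  have hball : ∀ y : Eucl n, ‖y‖ ≤ 1 → |dExt μ (hom f) (hom (cap ρ y * f))| ≤ b := by
    intro y hy
    rcases eq_or_ne y 0 with rfl | hy0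
    · have e : hom (cap ρ (0 : Eucl n) * f) = 0 := by
        rw [← hom_zero]
        exact hom_congr fun x _ => by simp [cap]
      rw [e, hμ.dExt_zero hfN, abs_zero]; exact hb
    · have hu := norm_inv_norm_smul hy0
      have e : cap ρ y * f = ‖y‖ ^ 2 • (cap ρ (‖y‖⁻¹ • y) * f) := by
        funext x
        have hp := norm_pos_iff.2 hy0
        have : inner ℝ y x + ‖y‖ * (ρ ^ 2 / 8 - 1) =
            ‖y‖ * (inner ℝ (‖y‖⁻¹ • y) x + ‖‖y‖⁻¹ • y‖ * (ρ ^ 2 / 8 - 1)) := by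
          rw [hu, real_inner_smul_left]; field_simp
        simp only [Pi.mul_apply, Pi.smul_apply, smul_eq_mul, cap]
        rw [this, ← mul_assoc, ← mul_pow, mul_max_of_nonneg _ _ hp.le, mul_zero]
      rw [e, hom_smul, hμ.dExt_smul hfN (hcapN _ hu.le), abs_mul, abs_of_nonneg (sq_nonneg _)]
      exact (mul_le_of_le_one_left (abs_nonneg _) (pow_le_one₀ (norm_nonneg _) hy)).trans (h _ hu)
  have hint : IntegrableOn Φ (Metric.closedBall 0 1) :=
    Φ.continuous.continuousOn.integrableOn_compact (isCompact_closedBall _ _)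
  have hpos : 0 < volume.real (Metric.closedBall (0 : Eucl n) 1) :=
    ENNReal.toReal_pos (Metric.measure_closedBall_pos _ _ one_pos).ne'
      (isCompact_closedBall _ _).measure_lt_top.ne
  have hmem := Convex.set_average_mem (μ := volume)
    (convex_setOf_dExt_le (r := 4 * (6 * (8 * C))) (b := b) hμ hfN)
    (isClosed_setOf_dExt_le hμ hfN fun x hx => (hf x hx).1)
    (Metric.measure_closedBall_pos _ _ one_pos).ne'
    (isCompact_closedBall (0 : Eucl n) 1).measure_lt_top.ne
    ((ae_restrict_iff' measurableSet_closedBall).2 (Eventually.of_forall fun y hy => by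
      rw [mem_closedBall_zero_iff] at hy
      rw [Set.mem_ofPred_eq, hΦ]
      exact ⟨hcapN y hy, hball y hy⟩)) hint
  set κ : ℝ := (volume.real (Metric.closedBall (0 : Eucl n) 1))⁻¹ *
    ∫ y in Metric.closedBall 0 1, cap ρ y x₀ with hκ
  have hκle : (ρ ^ 2 / 64) ^ n * (ρ ^ 4 / 1024) ≤ κ := by
    rw [hκ, inv_mul_eq_div, le_div_iff₀ hpos]
    exact le_integral_cap hρ hρ1 hx₀
  have hav : hom (sphereExt (⨍ y in Metric.closedBall 0 1, Φ y) * f) = κ • hom f := by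
    rw [← hom_smul]
    refine hom_congr fun x hx => ?_
    rw [Pi.mul_apply, Pi.smul_apply, sphereExt_apply _ hx, smul_eq_mul, hκ,
      integral_cap_eq ρ hx₀ hx, setAverage_eq]
    congr 1
    rw [ContinuousMap.smul_apply, smul_eq_mul]
    congr 1
    exact (ContinuousLinearMap.integral_comp_comm
      (ContinuousMap.evalCLM ℝ (⟨x, by simpa using hx⟩ : Metric.sphere (0 : Eucl n) 1)) hint).symm
  have h2 := hmem.2
  rw [hav, hμ.dExt_smul hfN hfN, abs_mul] at h2
  exact (mul_le_mul_of_nonneg_right (hκle.trans (le_abs_self κ)) (abs_nonneg _)).trans h2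

end Averaging

section Compactness

open Filter Topology

variable {n : ℕ}

/-- The exponent for which the local estimates beat the averaging constant. -/
def localDeg (n : ℕ) : ℕ := 2 * n + 5

/-- The number of linear conditions killing all local tests of a valuation. -/
def numTests (n : ℕ) : ℕ :=
  Fintype.card ((Fin n → Fin (localDeg n + 2)) ⊕ (Fin n → Fin (localDeg n + 2)) →
    Fin (4 * n + 1))

theorem exists_norm_eq_one_forall_sum_eq_zero {ι J : Type*} [Fintype ι] [Fintype J]
    (h : Fintype.card J < Fintype.card ι) (M : J → ι → ℝ) :
    ∃ c : ι → ℝ, ‖c‖ = 1 ∧ ∀ b, ∑ j, c j * M b j = 0 := by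
  let L : (ι → ℝ) →ₗ[ℝ] (J → ℝ) := LinearMap.pi fun b => ∑ j, M b j • LinearMap.proj j
  have hker : LinearMap.ker L ≠ ⊥ := LinearMap.ker_ne_bot_of_finrank_lt (by simpa using h)
  obtain ⟨c, hc, hc0⟩ := Submodule.exists_mem_ne_zero_of_ne_bot hker
  refine ⟨‖c‖⁻¹ • c, by rw [norm_smul, norm_inv, norm_norm,
      inv_mul_cancel₀ (norm_ne_zero_iff.2 hc0)], fun b => ?_⟩
  have h1 := congrFun (LinearMap.mem_ker.1 hc) b
  simp only [L, LinearMap.pi_apply, LinearMap.sum_apply, LinearMap.smul_apply,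
    LinearMap.proj_apply, smul_eq_mul, Pi.zero_apply] at h1
  simp only [Pi.smul_apply, smul_eq_mul, mul_assoc]
  rw [← Finset.mul_sum]
  simp only [mul_comm (c _), h1, mul_zero]

theorem IsVal.extVal_hom_eq_extVal_zero {μ : ConvexBody (Eucl n) → ℝ} (hμ : IsVal μ)
    {f : Eucl n → ℝ}
    (hf : ∀ t : ℝ, dExt μ (hom (t • f)) (hom (t • f)) = 0) {c : ℝ} (hfN : NormBound (hom f) c) :
    extVal μ (hom f) = extVal μ 0 :=
  hμ.extVal_eq_extVal_zero hfN fun t => by rw [← hom_smul]; exact hf t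

/-- Many valuations invariant under a transitive group have a nontrivial combination which
vanishes on all polynomially good functions. -/
theorem exists_combination_extVal_eq_zero {G : Set (Matrix (Fin n) (Fin n) ℝ)}
    (hG : ∀ A ∈ G, A ∈ Matrix.orthogonalGroup (Fin n) ℝ) (htrans : ActsTransitively G)
    {e : Eucl n} (he : ‖e‖ = 1) {ι : Type*} [Fintype ι] (hι : numTests n < Fintype.card ι)
    {μ : ι → ConvexBody (Eucl n) → ℝ} (hμ : ∀ j, IsVal (μ j)) (hinv : ∀ j, GInv G (μ j)) :
    ∃ c : ι → ℝ, c ≠ 0 ∧ ∀ f, PolyGood (localDeg n) f →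
      extVal (fun K => ∑ j, c j * μ j K) (hom f) = 0 := by
  obtain ⟨ρ, hρ, hρ1, hρ0⟩ : ∃ ρ : ℕ → ℝ, (∀ m, 0 < ρ m) ∧ (∀ m, ρ m ≤ 1) ∧
      Tendsto ρ atTop (𝓝 0) :=
    ⟨fun m => 1 / ((m : ℝ) + 1), fun m => by positivity, fun m => by
      rw [div_le_one (by positivity)]; linarith [(Nat.cast_nonneg m : (0 : ℝ) ≤ m)],
      tendsto_one_div_add_atTop_nhds_zero_nat⟩
  have hν := fun c : ι → ℝ => IsVal.sum_mul Finset.univ (fun j _ => hμ j) c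
  choose c hc1 hc using fun m => exists_norm_eq_one_forall_sum_eq_zero hι
    fun b j => extVal (μ j) (∑ i, ((b i : ℕ) : ℝ) • capTest (localDeg n) (ρ m) e i)
  have hdata : ∀ m (b : (Fin n → Fin (localDeg n + 2)) ⊕ (Fin n → Fin (localDeg n + 2)) →
      Fin (4 * n + 1)), extVal (fun K => ∑ j, c m j * μ j K)
      (∑ i, ((b i : ℕ) : ℝ) • capTest (localDeg n) (ρ m) e i) = 0 := by
    intro m b
    obtain ⟨r, hr⟩ := exists_normBound_capTest (localDeg n) (hρ m) (hρ1 m) he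
    rw [IsVal.extVal_linear_combination _ (fun j _ => hμ j) _ (hν _)
      (NormBound.sum _ fun i _ => (hr i).smul _).pos, hc]
  have hcle : ∀ m j, |c m j| ≤ 1 := fun m j => (norm_le_pi_norm (c m) j).trans (hc1 m).le
  obtain ⟨a, ha, φ, hφ, hlim⟩ := (isCompact_sphere (0 : ι → ℝ) 1).tendsto_subseq
    (x := c) fun m => by simp [hc1]
  have ha1 : ‖a‖ = 1 := by simpa using ha
  have hcoord : ∀ j, Tendsto (fun m => c (φ m) j) atTop (𝓝 (a j)) :=
    fun j => (tendsto_pi_nhds.1 hlim) j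
  refine ⟨a, fun h => by simp [h] at ha1, fun f hf => ?_⟩
  have hzero : extVal (fun K => ∑ j, a j * μ j K) 0 = 0 := by
    rw [IsVal.extVal_linear_combination _ (fun j _ => hμ j) _ (hν _) normBound_zero.pos]
    refine tendsto_nhds_unique (tendsto_finsetSum _ fun j _ => (hcoord j).mul_const _) ?_
    refine tendsto_const_nhds.congr fun m => ?_
    have := hdata (φ m) fun _ => 0
    simp only [Fin.val_zero, Nat.cast_zero, zero_smul, Finset.sum_const_zero] at this
    rw [← IsVal.extVal_linear_combination _ (fun j _ => hμ j) _ (hν _) normBound_zero.pos, this]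
  have hD : ∀ f, PolyGood (localDeg n) f →
      dExt (fun K => ∑ j, a j * μ j K) (hom f) (hom f) = 0 := by
    intro f hf
    obtain ⟨B, hB0, hB⟩ := exists_bound_dExt_cap_combination hμ hf
    obtain ⟨C, hC, hfC, -⟩ := hf
    have hfN := hfC.normBound hC
    have hbound : ∀ m, |dExt (fun K => ∑ j, c m j * μ j K) (hom f) (hom f)| ≤
        B * 64 ^ n * 1024 * ρ m := by
      intro m
      have hpos := hρ m
      have hcap : ∀ y : Eucl n, ‖y‖ = 1 → |dExt (fun K => ∑ j, c m j * μ j K) (hom f)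
          (hom (cap (ρ m) y * f))| ≤ B * ρ m ^ localDeg n := by
        intro y hy
        obtain ⟨A, hA, hAe⟩ := htrans e y he hy
        obtain ⟨U, hU⟩ := exists_linearIsometryEquiv (hG A hA)
        rw [← hAe, ← hU]
        exact hB (c m) e (ρ m) (hcle m) he (hρ m) (hρ1 m) (hdata m) A U hU
          fun K => Finset.sum_congr rfl fun j _ => by rw [hinv j A hA K]
      have h1 := (hν (c m)).abs_dExt_hom_le hC hfC (hρ m) (hρ1 m) (by positivity) hcap he
      have h2 : B * ρ m ^ localDeg n =
          (ρ m ^ 2 / 64) ^ n * (ρ m ^ 4 / 1024) * (B * 64 ^ n * 1024 * ρ m) := by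
        rw [div_pow, ← pow_mul, localDeg]
        field_simp
        ring
      rw [h2] at h1
      exact le_of_mul_le_mul_left h1 (by positivity)
    have h3 : Tendsto (fun m => dExt (fun K => ∑ j, c (φ m) j * μ j K) (hom f) (hom f)) atTop
        (𝓝 0) := by
      refine squeeze_zero_norm (fun m => hbound (φ m)) ?_
      simpa using (hρ0.comp hφ.tendsto_atTop).const_mul (B * 64 ^ n * 1024)
    rw [IsVal.dExt_linear_combination _ (fun j _ => hμ j) _ (hν _) hfN hfN]
    refine tendsto_nhds_unique (tendsto_finsetSum _ fun j _ => (hcoord j).mul_const _)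
      (h3.congr fun m => ?_)
    rw [IsVal.dExt_linear_combination _ (fun j _ => hμ j) _ (hν _) hfN hfN]
  obtain ⟨C, hC, hfC, -⟩ := id hf
  rw [(hν a).extVal_hom_eq_extVal_zero (fun t => hD _ (hf.smul t)) (hfC.normBound hC), hzero]

end Compactness

section SmoothApprox

open Filter Topology

theorem exists_polynomial_derivative_eq (p : Polynomial ℝ) :
    ∃ q : Polynomial ℝ, Polynomial.derivative q = p := by
  induction p using Polynomial.induction_on' with
  | add p q hp hq =>
    obtain ⟨P, rfl⟩ := hp
    obtain ⟨Q, rfl⟩ := hq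
    exact ⟨P + Q, Polynomial.derivative_add⟩
  | monomial k a =>
    refine ⟨Polynomial.monomial (k + 1) (a / (k + 1)), ?_⟩
    rw [Polynomial.derivative_monomial, Nat.add_sub_cancel]
    congr 1
    push_cast
    field_simp

/-- An approximation of the derivative by a polynomial integrates to an approximation
of the function. -/
theorem exists_polynomial_near_of_derivative_near {a b : ℝ} (hab : a ≤ b) {f f' : ℝ → ℝ}
    (hf : ∀ t ∈ Set.Icc a b, HasDerivAt f (f' t) t) {p : Polynomial ℝ} {ε : ℝ}
    (h : ∀ t ∈ Set.Icc a b, |p.eval t - f' t| ≤ ε) :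
    ∃ q : Polynomial ℝ, Polynomial.derivative q = p ∧
      ∀ t ∈ Set.Icc a b, |q.eval t - f t| ≤ ε * (b - a) := by
  obtain ⟨Q, hQ⟩ := exists_polynomial_derivative_eq p
  refine ⟨Q + Polynomial.C (f a - Q.eval a), by simp [hQ], fun t ht => ?_⟩
  have ha : a ∈ Set.Icc a b := Set.left_mem_Icc.2 hab
  have hε : 0 ≤ ε := (abs_nonneg _).trans (h a ha)
  have key := (convex_Icc a b).norm_image_sub_le_of_norm_hasDerivWithin_le
    (f := fun t => Q.eval t - f t) (f' := fun t => p.eval t - f' t) (C := ε)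
    (fun x hx => by
      have := (Q.hasDerivAt x).sub (hf x hx)
      rw [hQ] at this
      exact this.hasDerivWithinAt) (fun x hx => h x hx) ha ht
  rw [Real.norm_eq_abs, Real.norm_eq_abs, abs_of_nonneg (sub_nonneg.2 ht.1)] at key
  simp only [Polynomial.eval_add, Polynomial.eval_C]
  calc |Q.eval t + (f a - Q.eval a) - f t| = |Q.eval t - f t - (Q.eval a - f a)| := by
        congr 1; ring
    _ ≤ ε * (t - a) := key
    _ ≤ ε * (b - a) := by gcongr; exact ht.2

/-- Polynomials approximating a `C²` function uniformly with bounded first two derivatives. -/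
theorem exists_polynomial_approx {a b : ℝ} (hab : a ≤ b) {f f' f'' : ℝ → ℝ}
    (hf : ∀ t ∈ Set.Icc a b, HasDerivAt f (f' t) t)
    (hf' : ∀ t ∈ Set.Icc a b, HasDerivAt f' (f'' t) t) (hc : ContinuousOn f'' (Set.Icc a b)) :
    ∃ M, ∀ ε, 0 < ε → ∃ r : Polynomial ℝ, ∀ t ∈ Set.Icc a b, |r.eval t - f t| ≤ ε ∧
      |r.eval t| ≤ M ∧ |r.derivative.eval t| ≤ M ∧ |r.derivative.derivative.eval t| ≤ M := by
  obtain ⟨M, hM⟩ : ∃ M, ∀ t ∈ Set.Icc a b, |f t| ≤ M ∧ |f' t| ≤ M ∧ |f'' t| ≤ M := by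
    have h1 : ContinuousOn f (Set.Icc a b) := fun t ht => (hf t ht).continuousAt.continuousWithinAt
    have h2 : ContinuousOn f' (Set.Icc a b) :=
      fun t ht => (hf' t ht).continuousAt.continuousWithinAt
    obtain ⟨M1, h1⟩ := isCompact_Icc.exists_bound_of_continuousOn h1
    obtain ⟨M2, h2⟩ := isCompact_Icc.exists_bound_of_continuousOn h2
    obtain ⟨M3, h3⟩ := isCompact_Icc.exists_bound_of_continuousOn hc
    exact ⟨max M1 (max M2 M3), fun t ht => ⟨(h1 t ht).trans (le_max_left _ _),
      (h2 t ht).trans ((le_max_left _ _).trans (le_max_right _ _)),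
      (h3 t ht).trans ((le_max_right _ _).trans (le_max_right _ _))⟩⟩
  refine ⟨M + 1, fun ε hε => ?_⟩
  set d := b - a with hd
  have hd0 : 0 ≤ d := sub_nonneg.2 hab
  set δ := min 1 ε / (1 + d) ^ 2 with hδ
  have hm : 0 < min 1 ε := lt_min one_pos hε
  have hδ0 : 0 < δ := by positivity
  have e : δ * (1 + d) ^ 2 = min 1 ε := by rw [hδ]; field_simp
  obtain ⟨p, hp⟩ := exists_polynomial_near_of_continuousOn a b f'' hc δ hδ0
  obtain ⟨q, rfl, hq⟩ := exists_polynomial_near_of_derivative_near hab hf'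
    fun t ht => (hp t ht).le
  obtain ⟨r, rfl, hr⟩ := exists_polynomial_near_of_derivative_near hab hf hq
  have l1 : δ ≤ min 1 ε := by
    rw [← e]
    nlinarith [mul_nonneg hδ0.le hd0, mul_nonneg hδ0.le (mul_nonneg hd0 hd0)]
  have l2 : δ * d ≤ min 1 ε := by
    rw [← e]
    nlinarith [mul_nonneg hδ0.le hd0, mul_nonneg hδ0.le (mul_nonneg hd0 hd0)]
  have l3 : δ * d * d ≤ min 1 ε := by
    rw [← e]
    nlinarith [mul_nonneg hδ0.le hd0, mul_nonneg hδ0.le (mul_nonneg hd0 hd0)]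
  have near : ∀ {x y η : ℝ}, |x - y| ≤ η → η ≤ min 1 ε → |y| ≤ M → |x| ≤ M + 1 := by
    intro x y η h1 h2 h3
    have := abs_add_le y (x - y)
    rw [add_sub_cancel] at this
    linarith [min_le_left 1 ε]
  refine ⟨r, fun t ht => ⟨(hr t ht).trans (l3.trans (min_le_right _ _)),
      near (hr t ht) l3 (hM t ht).1,
    near (hq t ht) l2 (hM t ht).2.1, near (hp t ht).le l1 (hM t ht).2.2⟩⟩

theorem abs_eval_sub_sub_le {a b M : ℝ} {r : Polynomial ℝ}
    (h : ∀ t ∈ Set.Icc a b, |r.derivative.derivative.eval t| ≤ M) {s t : ℝ}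
    (hs : s ∈ Set.Icc a b) (ht : t ∈ Set.Icc a b) :
    |r.eval t - r.eval s - r.derivative.eval s * (t - s)| ≤ M * (t - s) ^ 2 := by
  have hsub : Set.uIcc s t ⊆ Set.Icc a b := Set.ordConnected_Icc.uIcc_subset hs ht
  have hM : 0 ≤ M := (abs_nonneg _).trans (h s hs)
  have h1 : ∀ x ∈ Set.uIcc s t, ‖r.derivative.eval x - r.derivative.eval s‖ ≤ M * |t - s| := by
    intro x hx
    have := (convex_uIcc s t).norm_image_sub_le_of_norm_hasDerivWithin_le
      (f := fun t => r.derivative.eval t) (C := M)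
      (fun y _ => (r.derivative.hasDerivAt y).hasDerivWithinAt) (fun y hy => h y (hsub hy))
      Set.left_mem_uIcc hx
    refine this.trans ?_
    gcongr
    exact Set.abs_sub_left_of_mem_uIcc hx
  have h2 := (convex_uIcc s t).norm_image_sub_le_of_norm_hasDerivWithin_le
    (f := fun x => r.eval x - r.derivative.eval s * x)
    (f' := fun x => r.derivative.eval x - r.derivative.eval s) (C := M * |t - s|)
    (fun y _ => by
      have := (r.hasDerivAt y).sub ((hasDerivAt_id y).const_mul (r.derivative.eval s))
      rw [mul_one] at this
      exact this.hasDerivWithinAt) h1 Set.left_mem_uIcc Set.right_mem_uIcc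
  rw [Real.norm_eq_abs, Real.norm_eq_abs, mul_assoc, ← sq, sq_abs] at h2
  refine (le_of_eq ?_).trans h2
  congr 1; ring

variable {E : Type*} [NormedAddCommGroup E] [InnerProductSpace ℝ E]

theorem C11.comp_polynomial {q : E → ℝ} {C a b M : ℝ} (hC : 0 ≤ C) (hq : C11 1 q C)
    (hab : ∀ x, ‖x‖ = 1 → q x ∈ Set.Icc a b) (hM : 0 ≤ M) {r : Polynomial ℝ}
    (hr : ∀ t ∈ Set.Icc a b, |r.eval t| ≤ M ∧ |r.derivative.eval t| ≤ M ∧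
      |r.derivative.derivative.eval t| ≤ M) :
    C11 1 (fun x => r.eval (q x)) (M * (1 + C + 9 * C ^ 2)) := by
  intro w hw
  obtain ⟨-, ξ, hξ, h⟩ := hq w hw
  rw [one_mul] at hξ
  obtain ⟨r0, r1, -⟩ := hr _ (hab w hw)
  refine ⟨r0.trans (by nlinarith [mul_nonneg hM hC, mul_nonneg hM (sq_nonneg C)]),
    r.derivative.eval (q w) • ξ, ?_, fun u hu => ?_⟩
  · rw [one_mul, norm_smul, Real.norm_eq_abs]
    have := mul_le_mul r1 hξ (norm_nonneg _) hM
    nlinarith [mul_nonneg hM (sq_nonneg C)]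
  · have hu1 := h u hu
    rw [div_one] at hu1 ⊢
    set d := ‖u - w‖ with hd
    have hd0 : 0 ≤ d := norm_nonneg _
    have hd2 : d ≤ 2 := (norm_sub_le _ _).trans (by rw [hu, hw]; norm_num)
    have hin : |inner ℝ ξ (u - w)| ≤ C * d :=
      (abs_real_inner_le_norm _ _).trans (by gcongr)
    have hdiff : |q u - q w| ≤ 3 * C * d := by
      have := abs_add_le (q u - q w - inner ℝ ξ (u - w)) (inner ℝ ξ (u - w))
      rw [sub_add_cancel] at this
      nlinarith [mul_nonneg hC hd0]
    have hsq : (q u - q w) ^ 2 ≤ 9 * C ^ 2 * d ^ 2 := by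
      rw [← sq_abs]
      calc |q u - q w| ^ 2 ≤ (3 * C * d) ^ 2 := by gcongr
        _ = _ := by ring
    have ht := abs_eval_sub_sub_le (fun t ht => (hr t ht).2.2) (hab w hw) (hab u hu)
    rw [inner_smul_left, conj_trivial]
    calc |r.eval (q u) - r.eval (q w) - r.derivative.eval (q w) * inner ℝ ξ (u - w)|
        = |(r.eval (q u) - r.eval (q w) - r.derivative.eval (q w) * (q u - q w)) +
          r.derivative.eval (q w) * (q u - q w - inner ℝ ξ (u - w))| := by congr 1; ring
      _ ≤ M * (q u - q w) ^ 2 + M * (C * d ^ 2) := by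
          refine (abs_add_le _ _).trans (add_le_add ht ?_)
          rw [abs_mul]
          gcongr
      _ ≤ M * (9 * C ^ 2 * d ^ 2) + M * (C * d ^ 2) := by gcongr
      _ ≤ M * (1 + C + 9 * C ^ 2) * d ^ 2 := by nlinarith [mul_nonneg hM (sq_nonneg d)]

variable {n k : ℕ}

/-- The algebra of polynomial functions. -/
def polyFun (n : ℕ) : Subalgebra ℝ (Eucl n → ℝ) :=
  Algebra.adjoin ℝ (Set.range fun (i : Fin n) (x : Eucl n) => x i)

theorem coord_mem_polyFun (i : Fin n) : (fun x : Eucl n => x i) ∈ polyFun n :=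
  Algebra.subset_adjoin ⟨i, rfl⟩

theorem polyGood_of_mem_polyFun {f : Eucl n → ℝ} (hf : f ∈ polyFun n) : PolyGood k f := by
  rw [polyFun, Algebra.adjoin_range_eq_range_aeval] at hf
  obtain ⟨P, rfl⟩ := hf
  induction P using MvPolynomial.induction_on with
  | C a =>
    have : PolyGood k (a • (1 : Eucl n → ℝ)) := polyGood_one.smul a
    convert this
    simp [Algebra.algebraMap_eq_smul_one]
  | add p q hp hq => simpa using hp.add hq
  | mul_X p i hp =>
    have := hp.mul_coord i
    convert this using 1
    funext x; simp

theorem eval_mem_polyFun {f : Eucl n → ℝ} (hf : f ∈ polyFun n) (r : Polynomial ℝ) :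
    (fun x => r.eval (f x)) ∈ polyFun n := by
  have h : (fun x => r.eval (f x)) = Polynomial.aeval f r := by
    funext x
    induction r using Polynomial.induction_on' with
    | add p q hp hq => rw [Polynomial.eval_add, map_add, Pi.add_apply, hp, hq]
    | monomial m a => simp
  rw [h]
  exact Algebra.adjoin_le (Set.singleton_subset_iff.2 hf)
    (Polynomial.aeval_mem_adjoin_singleton ℝ f)

theorem inner_mem_polyFun (v : Eucl n) : (fun x : Eucl n => inner ℝ v x) ∈ polyFun n := by
  have : (fun x : Eucl n => inner ℝ v x) = ∑ i, v i • fun x : Eucl n => x i := by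
    funext x
    simp [PiLp.inner_apply, mul_comm]
  rw [this]
  exact sum_mem fun i _ => Subalgebra.smul_mem _ (coord_mem_polyFun i) _

end SmoothApprox

section Density

open Filter Topology

variable {n : ℕ}

theorem IsVal.extVal_hom_eq_zero_of_approx {k : ℕ} {ν : ConvexBody (Eucl n) → ℝ} (hν : IsVal ν)
    (h0 : ∀ f, PolyGood k f → extVal ν (hom f) = 0) {q : Eucl n → ℝ} (hq : q ∈ polyFun n)
    {a b : ℝ} (hab : ∀ x, ‖x‖ = 1 → q x ∈ Set.Icc a b) (hab' : a ≤ b) {f f' f'' : ℝ → ℝ}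
    (hf : ∀ t ∈ Set.Icc a b, HasDerivAt f (f' t) t)
    (hf' : ∀ t ∈ Set.Icc a b, HasDerivAt f' (f'' t) t) (hc : ContinuousOn f'' (Set.Icc a b))
    {c : ℝ} (hs : SemiSublinear (hom fun x => f (q x)) c) :
    extVal ν (hom fun x => f (q x)) = 0 := by
  obtain ⟨C, hC, hqC, -⟩ := polyGood_of_mem_polyFun (k := k) hq
  obtain ⟨M, hM⟩ := exists_polynomial_approx hab' hf hf' hc
  have hM0 : 0 ≤ M := by
    obtain ⟨r, hr⟩ := hM 1 one_pos
    exact (abs_nonneg _).trans (hr a (Set.left_mem_Icc.2 hab')).2.1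
  choose r hr using fun m : ℕ => hM (1 / ((m : ℝ) + 1)) (by positivity)
  set D := M * (1 + C + 9 * C ^ 2) with hD
  have hD0 : 0 ≤ D := by positivity
  have hgood : ∀ m, C11 1 (fun x => (r m).eval (q x)) D := fun m =>
    hqC.comp_polynomial hC hab hM0 fun t ht => (hr m t ht).2
  have key := hν.tendsto_extVal (c := max (4 * D) c)
    (fun m => ((hgood m).normBound hD0).pos.mono (le_max_left _ _)) (hs.mono (le_max_right _ _))
    tendsto_one_div_add_atTop_nhds_zero_nat
    (fun m x => abs_hom_sub_le (fun x hx => (hr m _ (hab x hx)).1) x)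
  have hz : ∀ m, extVal ν (hom fun x => (r m).eval (q x)) = 0 := fun m =>
    h0 _ (polyGood_of_mem_polyFun (eval_mem_polyFun hq (r m)))
  simp only [hz] at key
  exact (tendsto_nhds_unique tendsto_const_nhds key).symm

theorem isSublinear_rpow_sum {ι E : Type*} [NormedAddCommGroup E] [InnerProductSpace ℝ E]
    [Fintype ι]
    {L : ι → E → ℝ} (hL : ∀ i, IsSublinear (L i)) (h0 : ∀ i x, 0 ≤ L i x) {p : ℝ} (hp : 1 ≤ p) :
    IsSublinear fun x => (∑ i, L i x ^ p) ^ (1 / p) := by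
  have hp0 : 0 < p := by linarith
  refine ⟨fun x y => ?_, fun t x ht => ?_⟩
  · refine le_trans ?_ (Real.Lp_add_le_of_nonneg (s := Finset.univ) (f := fun i => L i x)
      (g := fun i => L i y) hp (fun i _ => h0 i x) (fun i _ => h0 i y))
    have hs : ∀ z, 0 ≤ ∑ i, L i z ^ p := fun z =>
      Finset.sum_nonneg fun i _ => Real.rpow_nonneg (h0 i z) _
    refine Real.rpow_le_rpow (hs _) (Finset.sum_le_sum fun i _ => ?_) (by positivity)
    exact Real.rpow_le_rpow (h0 i _) ((hL i).add_le x y) hp0.le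
  · have : ∀ i, L i (t • x) ^ p = t ^ p * L i x ^ p := fun i => by
      rw [(hL i).map_smul t x ht, Real.mul_rpow ht (h0 i x)]
    simp only [this]
    rw [← Finset.mul_sum, Real.mul_rpow (Real.rpow_nonneg ht _)
      (Finset.sum_nonneg fun i _ => Real.rpow_nonneg (h0 i x) _), ← Real.rpow_mul ht,
      mul_one_div_cancel hp0.ne', Real.rpow_one]

/-- A polytope is the limit of bodies whose support functions are powers of polynomials. -/
theorem IsVal.polyBody_eq_zero {k : ℕ} {ν : ConvexBody (Eucl n) → ℝ} (hν : IsVal ν)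
    (h0 : ∀ f, PolyGood k f → extVal ν (hom f) = 0) {N : ℕ} [NeZero N] (v : Fin N → Eucl n) :
    ν (polyBody v) = 0 := by
  set c := 1 + ∑ i, ‖v i‖ with hc
  have hvc : ∀ i, ‖v i‖ + 1 ≤ c := fun i => by
    have := Finset.single_le_sum (f := fun i => ‖v i‖)
      (fun i _ => norm_nonneg _) (Finset.mem_univ i)
    linarith
  have hc1 : 1 ≤ c := by
    have : 0 ≤ ∑ i, ‖v i‖ := Finset.sum_nonneg fun i _ => norm_nonneg _
    linarith
  set h := supportFn (polyBody v) with hh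
  have hsub : IsSublinear h := isSublinear_supportFn _
  set L : Fin N → Eucl n → ℝ := fun i x => inner ℝ (v i) x + c * ‖x‖ with hL
  have hLs : ∀ i, IsSublinear (L i) := fun i =>
    ⟨fun x y => by
      have := norm_add_le x y
      simp only [hL, inner_add_right]
      nlinarith, fun t x ht => by
      simp only [hL, inner_smul_right, norm_smul, Real.norm_eq_abs, abs_of_nonneg ht]; ring⟩
  have hin : ∀ i x, |inner ℝ (v i) x| ≤ (c - 1) * ‖x‖ := fun i x =>
    (abs_real_inner_le_norm _ _).trans (by gcongr; linarith [hvc i])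
  have hL1 : ∀ i x, ‖x‖ ≤ L i x := fun i x => by
    have := (abs_le.1 (hin i x)).1
    simp only [hL]; linarith
  have hL2 : ∀ i x, L i x ≤ 2 * c * ‖x‖ := fun i x => by
    have := (abs_le.1 (hin i x)).2
    have := norm_nonneg x
    simp only [hL]; linarith
  have hL0 : ∀ i x, 0 ≤ L i x := fun i x => (norm_nonneg x).trans (hL1 i x)
  have hLh : ∀ i x, L i x ≤ h x + c * ‖x‖ := fun i x => by
    have : v i ∈ (polyBody v : Set (Eucl n)) := by
      rw [coe_polyBody_eq_convexHull]
      exact subset_convexHull ℝ _ ⟨i, rfl⟩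
    have := inner_le_supportFn (K := polyBody v) this x
    rw [real_inner_comm] at this
    simp only [hL]; linarith
  have hex : ∀ x, ∃ i, h x + c * ‖x‖ ≤ L i x := fun x => by
    obtain ⟨i, -, hi⟩ := Finset.exists_max_image Finset.univ (fun i => inner ℝ (v i) x)
      ⟨0, Finset.mem_univ _⟩
    refine ⟨i, ?_⟩
    have : h x ≤ inner ℝ (v i) x := by
      have hsub : (polyBody v : Set (Eucl n)) ⊆ {y | inner ℝ x y ≤ inner ℝ (v i) x} := by
        rw [coe_polyBody_eq_convexHull]
        refine convexHull_min ?_ (convex_halfSpace_le (innerₛₗ ℝ x).isLinear _)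
        rintro _ ⟨j, rfl⟩
        rw [Set.mem_ofPred_eq, real_inner_comm]
        exact hi j (Finset.mem_univ j)
      exact supportFn_le fun y hy => hsub hy
    simp only [hL]; linarith
  have hN1 : (1 : ℝ) ≤ N := by exact_mod_cast NeZero.one_le
  set F : ℕ → Eucl n → ℝ := fun m x => (∑ i, L i x ^ ((m + 1 : ℕ) : ℝ)) ^ (1 / ((m + 1 : ℕ) : ℝ))
    with hF
  have hFs : ∀ m, IsSublinear (F m) := fun m => isSublinear_rpow_sum hLs hL0 (by simp)
  have hlow : ∀ m x, h x + c * ‖x‖ ≤ F m x := fun m x => by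
    obtain ⟨i, hi⟩ := hex x
    refine hi.trans ?_
    have hp : ((m + 1 : ℕ) : ℝ) ≠ 0 := by positivity
    calc L i x = (L i x ^ ((m + 1 : ℕ) : ℝ)) ^ (1 / ((m + 1 : ℕ) : ℝ)) := by
          rw [← Real.rpow_mul (hL0 i x), mul_one_div_cancel hp, Real.rpow_one]
      _ ≤ _ := by
          refine Real.rpow_le_rpow (Real.rpow_nonneg (hL0 i x) _) ?_ (by positivity)
          exact Finset.single_le_sum (f := fun i => L i x ^ ((m + 1 : ℕ) : ℝ))
            (fun j _ => Real.rpow_nonneg (hL0 j x) _) (Finset.mem_univ i)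
  have hup : ∀ m x, F m x ≤ (N : ℝ) ^ (1 / ((m + 1 : ℕ) : ℝ)) * (h x + c * ‖x‖) := fun m x => by
    have hp : ((m + 1 : ℕ) : ℝ) ≠ 0 := by positivity
    have hpos : 0 ≤ h x + c * ‖x‖ := (hL0 0 x).trans (hLh 0 x)
    calc F m x ≤ (N * (h x + c * ‖x‖) ^ ((m + 1 : ℕ) : ℝ)) ^ (1 / ((m + 1 : ℕ) : ℝ)) := by
          refine Real.rpow_le_rpow (Finset.sum_nonneg fun j _ => Real.rpow_nonneg (hL0 j x) _) ?_
            (by positivity)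
          have := Finset.sum_le_card_nsmul Finset.univ (fun i => L i x ^ ((m + 1 : ℕ) : ℝ))
            ((h x + c * ‖x‖) ^ ((m + 1 : ℕ) : ℝ)) fun i _ =>
              Real.rpow_le_rpow (hL0 i x) (hLh i x) (by positivity)
          simpa using this
      _ = _ := by
          rw [Real.mul_rpow (by positivity) (Real.rpow_nonneg hpos _), ← Real.rpow_mul hpos,
            mul_one_div_cancel hp, Real.rpow_one]
  have hh2 : ∀ x, h x + c * ‖x‖ ≤ 2 * c * ‖x‖ := fun x => by
    obtain ⟨i, hi⟩ := hex x
    exact hi.trans (hL2 i x)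
  have hN0 : ∀ m : ℕ, 1 ≤ (N : ℝ) ^ (1 / ((m + 1 : ℕ) : ℝ)) := fun m =>
    Real.one_le_rpow hN1 (by positivity)
  have hlim : Tendsto (fun m : ℕ => ((N : ℝ) ^ (1 / ((m + 1 : ℕ) : ℝ)) - 1) * (2 * c)) atTop
      (𝓝 0) := by
    have h1 : Tendsto (fun m : ℕ => (N : ℝ) ^ (1 / ((m + 1 : ℕ) : ℝ))) atTop
        (𝓝 ((N : ℝ) ^ (0 : ℝ))) := by
      have : Tendsto (fun m : ℕ => 1 / ((m + 1 : ℕ) : ℝ)) atTop (𝓝 0) := by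
        simpa using tendsto_one_div_add_atTop_nhds_zero_nat (𝕜 := ℝ)
      exact ((Real.continuous_const_rpow (a := (N : ℝ)) (by positivity)).tendsto 0).comp this
    rw [Real.rpow_zero] at h1
    simpa using (h1.sub_const 1).mul_const (2 * c)
  have hzero : ∀ m, extVal ν (fun x => F m x - c * ‖x‖) = 0 := by
    intro m
    set q : Eucl n → ℝ := fun x => ∑ i, (inner ℝ (v i) x + c) ^ (m + 1) with hq
    have hqm : q ∈ polyFun n := by
      have : q = ∑ i, ((fun x => inner ℝ (v i) x) + algebraMap ℝ (Eucl n → ℝ) c) ^ (m + 1) := by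
        funext x
        simp [hq]
      rw [this]
      exact sum_mem fun i _ =>
        pow_mem (add_mem (inner_mem_polyFun _) (Subalgebra.algebraMap_mem _ _)) _
    have hqx : ∀ x, ‖x‖ = 1 → q x = ∑ i, L i x ^ ((m + 1 : ℕ) : ℝ) := fun x hx => by
      simp only [hq, hL, Real.rpow_natCast, hx, mul_one]
    have hqab : ∀ x, ‖x‖ = 1 → q x ∈ Set.Icc (1 : ℝ) (1 + N * (2 * c) ^ (m + 1)) := by
      intro x hx
      constructor
      · have h1 : (1 : ℝ) ≤ L 0 x ^ (m + 1) := one_le_pow₀ (by simpa [hx] using hL1 0 x)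
        rw [hqx x hx]
        simp only [Real.rpow_natCast]
        exact h1.trans (Finset.single_le_sum (f := fun i => L i x ^ (m + 1))
            (fun j _ => pow_nonneg (hL0 j x) _) (Finset.mem_univ 0))
      · rw [hqx x hx]
        simp only [Real.rpow_natCast]
        have := Finset.sum_le_card_nsmul Finset.univ (fun i => L i x ^ (m + 1))
            ((2 * c) ^ (m + 1)) fun i _ =>
              pow_le_pow_left₀ (hL0 i x) (by simpa [hx] using hL2 i x) _
        simp only [Finset.card_univ, Fintype.card_fin, nsmul_eq_mul] at this
        linarith
    set p : ℝ := 1 / ((m + 1 : ℕ) : ℝ) with hp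
    have hhom : (fun x => F m x - c * ‖x‖) = hom fun x => q x ^ p - c := by
      have e : (hom fun x => q x ^ p - c) = hom (F m) - hom (fun _ => c) := by
        rw [← hom_sub]
        refine hom_congr fun x hx => ?_
        rw [hqx x hx]
        rfl
      rw [e, hom_eq_of_isSublinear (hFs m)]
      funext x
      simp [hom, mul_comm]
    have hs : SemiSublinear (fun x => F m x - c * ‖x‖) c := by
      have := hFs m
      simpa [SemiSublinear] using this
    rw [hhom] at hs ⊢
    have hpos : ∀ t ∈ Set.Icc (1 : ℝ) (1 + N * (2 * c) ^ (m + 1)), t ≠ 0 := fun t ht => by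
      linarith [ht.1]
    refine hν.extVal_hom_eq_zero_of_approx h0 hqm hqab ?_ (f := fun t => t ^ p - c)
      (f' := fun t => p * t ^ (p - 1)) (f'' := fun t => p * ((p - 1) * t ^ (p - 1 - 1))) ?_ ?_ ?_ hs
    · have : 0 ≤ (N : ℝ) * (2 * c) ^ (m + 1) := by positivity
      linarith
    · exact fun t ht => (Real.hasDerivAt_rpow_const (Or.inl (hpos t ht))).sub_const c
    · exact fun t ht => (Real.hasDerivAt_rpow_const (Or.inl (hpos t ht))).const_mul p
    · refine continuousOn_const.mul (continuousOn_const.mul ?_)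
      exact continuousOn_id.rpow_const fun t ht => Or.inl (hpos t ht)
  have hcsub : ∀ m, SemiSublinear (fun x => F m x - c * ‖x‖) c := fun m => by
    have := hFs m
    simpa [SemiSublinear] using this
  have hhs : SemiSublinear h 0 := by simpa [SemiSublinear] using hsub
  have key := hν.tendsto_extVal hcsub (hhs.mono (by linarith)) hlim fun m x => by
    have h1 := hlow m x
    have h2 := hup m x
    have h3 := mul_le_mul_of_nonneg_left (hh2 x) (sub_nonneg.2 (hN0 m))
    rw [abs_le]
    constructor <;> nlinarith
  simp only [hzero] at key
  rw [hν.extVal_of_isSublinear hsub, bodyOf_supportFn] at key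
  exact (tendsto_nhds_unique tendsto_const_nhds key).symm

theorem IsVal.eq_zero_of_forall_polyGood {k : ℕ} {ν : ConvexBody (Eucl n) → ℝ} (hν : IsVal ν)
    (h0 : ∀ f, PolyGood k f → extVal ν (hom f) = 0) (K : ConvexBody (Eucl n)) : ν K = 0 := by
  choose N hN v hv using fun m : ℕ => exists_polyBody_dist_le K
    (ε := 1 / ((m : ℝ) + 1)) (by positivity)
  have hlim : Tendsto (fun m => polyBody (v m)) atTop (𝓝 K) :=
    tendsto_iff_dist_tendsto_zero.2 (squeeze_zero (fun _ => dist_nonneg) hv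
      tendsto_one_div_add_atTop_nhds_zero_nat)
  have key := (hν.cont.tendsto K).comp hlim
  have : (ν ∘ fun m => polyBody (v m)) = fun _ => 0 :=
    funext fun m => hν.polyBody_eq_zero h0 (v m)
  rw [this] at key
  exact (tendsto_nhds_unique tendsto_const_nhds key).symm

end Density

section Finiteness

variable {n : ℕ}

/-- The space `Val^G`. -/
def valG (G : Set (Matrix (Fin n) (Fin n) ℝ)) : Submodule ℝ (ConvexBody (Eucl n) → ℝ) where
  carrier := {μ | IsVal μ ∧ GInv G μ}
  zero_mem' := ⟨⟨fun _ _ _ _ _ _ => by simp, continuous_const, fun _ _ => rfl⟩,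
    fun _ _ _ => rfl⟩
  add_mem' := by
    rintro μ ν ⟨hμ, hμG⟩ ⟨hν, hνG⟩
    refine ⟨⟨fun K L M I hM hI => ?_, hμ.cont.add hν.cont, fun K x => ?_⟩, fun A hA K => ?_⟩
    · have h1 := hμ.val K L M I hM hI
      have h2 := hν.val K L M I hM hI
      simp only [Pi.add_apply]
      linarith
    · rw [Pi.add_apply, Pi.add_apply, hμ.trans, hν.trans]
    · rw [Pi.add_apply, Pi.add_apply, hμG A hA, hνG A hA]
  smul_mem' := by
    rintro t μ ⟨hμ, hμG⟩
    refine ⟨⟨fun K L M I hM hI => ?_, hμ.cont.const_smul t, fun K x => ?_⟩, fun A hA K => ?_⟩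
    · simp only [Pi.smul_apply, smul_eq_mul]
      rw [← mul_add, ← mul_add, hμ.val K L M I hM hI]
    · rw [Pi.smul_apply, Pi.smul_apply, hμ.trans]
    · rw [Pi.smul_apply, Pi.smul_apply, hμG A hA]

theorem mem_valG {G : Set (Matrix (Fin n) (Fin n) ℝ)} {μ : ConvexBody (Eucl n) → ℝ} :
    μ ∈ valG G ↔ IsVal μ ∧ GInv G μ := Iff.rfl

/-- The invariant valuations of a transitive group form a finite-dimensional space. -/
theorem finite_valG_of_transitive (hn : n ≠ 0) {G : Set (Matrix (Fin n) (Fin n) ℝ)}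
    (hG : ∀ A ∈ G, A ∈ Matrix.orthogonalGroup (Fin n) ℝ) (htrans : ActsTransitively G) :
    Module.Finite ℝ (valG G) := by
  have hrank : Module.rank ℝ (valG G) ≤ numTests n := by
    refine rank_le fun s hs => ?_
    by_contra! hcard
    have : NeZero n := ⟨hn⟩
    obtain ⟨c, hc0, hc⟩ := exists_combination_extVal_eq_zero hG htrans
      (e := EuclideanSpace.single (0 : Fin n) (1 : ℝ)) (by simp) (ι := s) (by simpa using hcard)
      (μ := fun j => (j : valG G)) (fun j => (mem_valG.1 j.1.2).1) (fun j => (mem_valG.1 j.1.2).2)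
    have hν := IsVal.sum_mul Finset.univ
      (fun (j : s) _ => (mem_valG.1 j.1.2).1) c
    have hzero := hν.eq_zero_of_forall_polyGood hc
    refine hc0 (funext fun j => Fintype.linearIndependent_iff.1 hs c ?_ j)
    ext K
    simpa using hzero K
  exact Module.rank_lt_aleph0_iff.1 (hrank.trans_lt Cardinal.natCast_lt_aleph0)

theorem finite_valG_iff {G : Set (Matrix (Fin n) (Fin n) ℝ)} :
    (∃ (d : ℕ) (b : Fin d → ConvexBody (Eucl n) → ℝ),
      ∀ μ : ConvexBody (Eucl n) → ℝ,
        IsValuation μ → Continuous μ → TransInv μ → GInv G μ →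
          ∃ c : Fin d → ℝ, ∀ K : ConvexBody (Eucl n), μ K = ∑ i, c i * b i K) ↔
      Module.Finite ℝ (valG G) := by
  constructor
  · rintro ⟨d, b, hb⟩
    have hle : valG G ≤ Submodule.span ℝ (Set.range b) := by
      rintro μ ⟨hμ, hμG⟩
      obtain ⟨c, hc⟩ := hb μ hμ.val hμ.cont hμ.trans hμG
      have : μ = ∑ i, c i • b i := by
        funext K
        simpa using hc K
      rw [this]
      exact sum_mem fun i _ => Submodule.smul_mem _ _ (Submodule.subset_span ⟨i, rfl⟩)
    have : Module.Finite ℝ (Submodule.span ℝ (Set.range b)) :=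
      Module.Finite.span_of_finite ℝ (Set.finite_range b)
    exact Submodule.finiteDimensional_of_le hle
  · intro hfin
    let B := Module.finBasis ℝ (valG G)
    refine ⟨_, fun i => (B i : ConvexBody (Eucl n) → ℝ), fun μ h1 h2 h3 h4 => ?_⟩
    let μ' : valG G := ⟨μ, ⟨h1, h2, h3⟩, h4⟩
    refine ⟨fun i => B.repr μ' i, fun K => ?_⟩
    have : μ K = ((∑ i, B.repr μ' i • B i : valG G) : ConvexBody (Eucl n) → ℝ) K := by
      rw [B.sum_repr]
    rw [this]
    simp only [Submodule.coe_sum, Finset.sum_apply, Submodule.coe_smul, Pi.smul_apply, smul_eq_mul]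

end Finiteness

section WeightedMean

variable {n : ℕ}

/-- The integral of the support function over the unit ball with respect to a density depending
only on the direction. -/
def weightedMean (f : Eucl n → ℝ) (K : ConvexBody (Eucl n)) : ℝ :=
  ∫ x in Metric.closedBall (0 : Eucl n) 1, supportFn K x * f (‖x‖⁻¹ • x)

theorem norm_inv_norm_smul_le {E : Type*} [NormedAddCommGroup E] [NormedSpace ℝ E] (x : E) :
    ‖‖x‖⁻¹ • x‖ ≤ 1 := by
  rw [norm_smul, norm_inv, norm_norm]
  exact inv_mul_le_one

theorem exists_bound_apply_dir {f : Eucl n → ℝ} (hf : Continuous f) :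
    ∃ M, 0 ≤ M ∧ ∀ x : Eucl n, |f (‖x‖⁻¹ • x)| ≤ M := by
  obtain ⟨M, hM⟩ := (isCompact_closedBall (0 : Eucl n) 1).exists_bound_of_continuousOn
      hf.continuousOn
  have h : ∀ x : Eucl n, |f (‖x‖⁻¹ • x)| ≤ M := fun x =>
    hM _ (mem_closedBall_zero_iff.2 (norm_inv_norm_smul_le x))
  exact ⟨M, (abs_nonneg _).trans (h 0), h⟩

theorem integrableOn_mul_dir {f g : Eucl n → ℝ} (hf : Continuous f) (hg : Continuous g) :
    IntegrableOn (fun x => g x * f (‖x‖⁻¹ • x)) (Metric.closedBall 0 1) := by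
  obtain ⟨M, hM0, hM⟩ := exists_bound_apply_dir hf
  obtain ⟨C, hC⟩ := (isCompact_closedBall (0 : Eucl n) 1).exists_bound_of_continuousOn
      hg.continuousOn
  refine IntegrableOn.of_bound measure_closedBall_lt_top ?_ (C * M) ?_
  · refine (hg.measurable.mul (hf.measurable.comp ?_)).aestronglyMeasurable
    exact measurable_norm.inv.smul measurable_id
  · refine (ae_restrict_iff' measurableSet_closedBall).2
      (Filter.Eventually.of_forall fun x hx => ?_)
    rw [norm_mul]
    have := hC x hx
    gcongr
    · exact (norm_nonneg _).trans this
    · exact hM x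

theorem weightedMean_add {f g : Eucl n → ℝ} (hf : Continuous f) (hg : Continuous g) :
    weightedMean (f + g) = weightedMean f + weightedMean g := by
  funext K
  simp only [weightedMean, Pi.add_apply, mul_add]
  exact integral_add (integrableOn_mul_dir hf (continuous_supportFn K))
    (integrableOn_mul_dir hg (continuous_supportFn K))

theorem weightedMean_smul (t : ℝ) (f : Eucl n → ℝ) :
    weightedMean (t • f) = t • weightedMean f := by
  funext K
  simp only [weightedMean, Pi.smul_apply, smul_eq_mul, mul_left_comm _ t]
  exact integral_const_mul _ _

theorem weightedMean_sub_body {f : Eucl n → ℝ} (hf : Continuous f) (K L : ConvexBody (Eucl n)) :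
    weightedMean f K - weightedMean f L = ∫ x in Metric.closedBall (0 : Eucl n) 1,
      (supportFn K x - supportFn L x) * f (‖x‖⁻¹ • x) := by
  simp only [weightedMean, sub_mul]
  exact (integral_sub (integrableOn_mul_dir hf (continuous_supportFn K))
    (integrableOn_mul_dir hf (continuous_supportFn L))).symm

theorem isValuation_weightedMean {f : Eucl n → ℝ} (hf : Continuous f) :
    IsValuation (weightedMean f) := by
  intro K L M I hM hI
  have h := fun K => integrableOn_mul_dir hf (continuous_supportFn K)
  simp only [weightedMean]
  rw [← integral_add (h M) (h I), ← integral_add (h K) (h L)]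
  simp only [← add_mul, supportFn_union_add_inter hM hI]

theorem continuous_weightedMean {f : Eucl n → ℝ} (hf : Continuous f) :
    Continuous (weightedMean f) := by
  obtain ⟨M, hM0, hM⟩ := exists_bound_apply_dir hf
  set v := (volume : Measure (Eucl n)).real (Metric.closedBall 0 1) with hv
  refine (LipschitzWith.of_dist_le_mul (K := Real.toNNReal (M * v)) fun K L => ?_).continuous
  rw [Real.coe_toNNReal _ (mul_nonneg hM0 measureReal_nonneg), Real.dist_eq,
    weightedMean_sub_body hf]
  have := norm_setIntegral_le_of_norm_le_const (μ := (volume : Measure (Eucl n)))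
    (s := Metric.closedBall 0 1) (C := dist K L * M)
    (f := fun x => (supportFn K x - supportFn L x) * f (‖x‖⁻¹ • x)) measure_closedBall_lt_top
    fun x hx => by
      rw [norm_mul]
      have h1 := abs_supportFn_sub_le K L x
      have h2 : dist K L * ‖x‖ ≤ dist K L :=
        mul_le_of_le_one_right dist_nonneg (mem_closedBall_zero_iff.1 hx)
      gcongr
      · exact h1.trans h2
      · exact hM x
  refine this.trans (le_of_eq ?_)
  ring

/-- A point as a convex body. -/
def pointBody (v : Eucl n) : ConvexBody (Eucl n) :=
  ⟨{v}, convex_singleton v, isCompact_singleton, Set.singleton_nonempty v⟩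

theorem supportFn_pointBody (v x : Eucl n) : supportFn (pointBody v) x = inner ℝ x v := by
  refine le_antisymm (supportFn_le fun y hy => ?_) (inner_le_supportFn ?_ x)
  · obtain rfl : y = v := hy
    exact le_rfl
  · exact Set.mem_singleton v

theorem weightedMean_translate {f : Eucl n → ℝ} (hf : Continuous f) (K : ConvexBody (Eucl n))
    (v : Eucl n) : weightedMean f (K.translate v) = weightedMean f K +
      ∑ i, v i * weightedMean f (pointBody (EuclideanSpace.single i 1)) := by
  have h := fun K => integrableOn_mul_dir hf (continuous_supportFn K)
  have e : K.translate v = K + pointBody v := rfl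
  simp only [weightedMean]
  simp only [← integral_const_mul]
  rw [← integral_finsetSum _ fun i _ => (h _).const_mul (v i), ← integral_add (h K)
    (integrable_finsetSum _ fun i _ => (h _).const_mul (v i))]
  congr 1
  funext x
  rw [e, supportFn_add, add_mul]
  congr 1
  simp only [← mul_assoc]
  rw [← Finset.sum_mul]
  congr 1
  simp only [supportFn_pointBody, EuclideanSpace.inner_single_right, conj_trivial, one_mul]
  simp [PiLp.inner_apply]

theorem weightedMean_matBody {f : Eucl n → ℝ} {A : Matrix (Fin n) (Fin n) ℝ}
    (hA : A ∈ Matrix.orthogonalGroup (Fin n) ℝ)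
    (hf : ∀ x, f (Matrix.toEuclideanLin A x) = f x) (K : ConvexBody (Eucl n)) :
    weightedMean f (matBody A K) = weightedMean f K := by
  obtain ⟨U, hU⟩ := exists_linearIsometryEquiv hA
  have key := U.measurePreserving.setIntegral_preimage_emb
    U.toMeasurableEquiv.measurableEmbedding
    (fun x => supportFn (matBody A K) x * f (‖x‖⁻¹ • x)) (Metric.closedBall 0 1)
  rw [U.preimage_closedBall, map_zero] at key
  rw [weightedMean, weightedMean, ← key]
  congr 1
  funext x
  rw [supportFn_matBody hU, U.symm_apply_apply, U.norm_map, ← map_smul, hU, hf]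

theorem isSublinear_max {E : Type*} [NormedAddCommGroup E] [InnerProductSpace ℝ E] {f g : E → ℝ}
    (hf : IsSublinear f) (hg : IsSublinear g) : IsSublinear fun x => max (f x) (g x) where
  add_le x y := max_le ((hf.add_le x y).trans (add_le_add (le_max_left _ _) (le_max_left _ _)))
    ((hg.add_le x y).trans (add_le_add (le_max_right _ _) (le_max_right _ _)))
  map_smul t x ht := by rw [hf.map_smul t x ht, hg.map_smul t x ht, mul_max_of_nonneg _ _ ht]

theorem apply_nonpos_of_weightedMean_eq_zero {f : Eucl n → ℝ} (hf : Continuous f)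
    (h : ∀ K, weightedMean f K = 0) {e : Eucl n} (he : ‖e‖ = 1) : f e ≤ 0 := by
  by_contra! hpos
  obtain ⟨r, hr, hfr⟩ := Metric.eventually_nhds_iff.1
    (hf.continuousAt.eventually (lt_mem_nhds hpos))
  set δ := min (r ^ 2 / 2) (1 / 2) with hδ
  have hδ0 : 0 < δ := by positivity
  have hδ1 : δ ≤ 1 / 2 := min_le_right _ _
  have hδr : δ ≤ r ^ 2 / 2 := min_le_left _ _
  set a := 1 - δ with ha
  have ha0 : 0 ≤ a := by linarith
  have hball : IsSublinear fun x : Eucl n => a * ‖x‖ := isSublinear_norm.const_mul ha0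
  have hcone : IsSublinear fun x : Eucl n => max (a * ‖x‖) (inner ℝ e x) :=
    isSublinear_max hball ⟨fun x y => (inner_add_right _ _ _).le, fun t x _ => by
      rw [inner_smul_right]⟩
  set g : Eucl n → ℝ := fun x => (max (a * ‖x‖) (inner ℝ e x) - a * ‖x‖) * f (‖x‖⁻¹ • x) with hg
  have hint : ∫ x in Metric.closedBall (0 : Eucl n) 1, g x = 0 := by
    have := weightedMean_sub_body hf (bodyOf fun x => max (a * ‖x‖) (inner ℝ e x))
      (bodyOf fun x => a * ‖x‖)
    rw [h, h, sub_zero, supportFn_bodyOf hcone, supportFn_bodyOf hball] at this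
    exact this.symm
  have hg0 : ∀ x, 0 ≤ g x := by
    intro x
    rcases le_or_gt (inner ℝ e x) (a * ‖x‖) with hx | hx
    · simp only [hg, max_eq_left hx, sub_self, zero_mul, le_refl]
    · refine mul_nonneg (sub_nonneg.2 (le_max_left _ _)) (hfr ?_).le
      have hx0 : x ≠ 0 := by
        rintro rfl
        simp at hx
      have hu := norm_inv_norm_smul hx0
      have hin : a < inner ℝ e (‖x‖⁻¹ • x) := by
        rw [inner_smul_right, inv_mul_eq_div, lt_div_iff₀ (norm_pos_iff.2 hx0)]
        exact hx
      rw [dist_eq_norm]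
      have h2 := norm_sub_sq_real (‖x‖⁻¹ • x) e
      rw [hu, he, real_inner_comm] at h2
      refine lt_of_pow_lt_pow_left₀ 2 hr.le ?_
      rw [h2]
      linarith
  have hae := (setIntegral_eq_zero_iff_of_nonneg_ae (Filter.Eventually.of_forall hg0)
    (integrableOn_mul_dir hf (by fun_prop))).1 hint
  have hU : IsOpen (Metric.ball (0 : Eucl n) 1 \ {0}) := Metric.isOpen_ball.sdiff isClosed_singleton
  have hae' : g =ᵐ[volume.restrict (Metric.ball (0 : Eucl n) 1 \ {0})] 0 :=
    ae_restrict_of_ae_restrict_of_subset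
      (Set.sdiff_subset.trans Metric.ball_subset_closedBall) hae
  have hcont : ContinuousOn g (Metric.ball (0 : Eucl n) 1 \ {0}) := by
    refine ContinuousOn.mul (by fun_prop) (hf.comp_continuousOn ?_)
    exact (continuous_norm.continuousOn.inv₀ fun x hx => norm_ne_zero_iff.2 hx.2).smul
      continuousOn_id
  have heq := Measure.eqOn_open_of_ae_eq hae' hU hcont continuousOn_const
  have he0 : e ≠ 0 := norm_ne_zero_iff.1 (by rw [he]; exact one_ne_zero)
  have hn2 : ‖(1 / 2 : ℝ) • e‖ = 1 / 2 := by rw [norm_smul, he]; norm_num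
  have hmem : (1 / 2 : ℝ) • e ∈ Metric.ball (0 : Eucl n) 1 \ {0} := by
    refine ⟨by rw [mem_ball_zero_iff, hn2]; norm_num, ?_⟩
    exact smul_ne_zero (by norm_num) he0
  have h0 := heq hmem
  simp only [hg, hn2, inner_smul_right, real_inner_self_eq_norm_sq, he, smul_smul,
      Pi.zero_apply] at h0
  rw [max_eq_right (by linarith)] at h0
  norm_num at h0
  rcases h0 with h0 | h0
  · linarith
  · linarith

theorem apply_eq_zero_of_weightedMean_eq_zero {f : Eucl n → ℝ} (hf : Continuous f)
    (h : ∀ K, weightedMean f K = 0) {e : Eucl n} (he : ‖e‖ = 1) : f e = 0 := by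
  refine le_antisymm (apply_nonpos_of_weightedMean_eq_zero hf h he) ?_
  have := apply_nonpos_of_weightedMean_eq_zero (f := (-1 : ℝ) • f) (hf.const_smul _)
    (fun K => by rw [weightedMean_smul, Pi.smul_apply, h, smul_zero]) he
  simp only [Pi.smul_apply, smul_eq_mul] at this
  linarith

end WeightedMean

section NotTransitive

variable {n : ℕ}

theorem toEuclideanLin_mul_apply (A B : Matrix (Fin n) (Fin n) ℝ) (x : Eucl n) :
    Matrix.toEuclideanLin (A * B) x = Matrix.toEuclideanLin A (Matrix.toEuclideanLin B x) := by
  simp [Matrix.toLpLin_apply, Matrix.mulVec_mulVec]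

theorem IsClosedSubgroupO.isCompact {G : Set (Matrix (Fin n) (Fin n) ℝ)}
    (hG : IsClosedSubgroupO G) : IsCompact G := by
  have hK : IsCompact (Set.univ.pi fun _ : Fin n => Set.univ.pi fun _ : Fin n =>
      Set.Icc (-1 : ℝ) 1) :=
    isCompact_univ_pi fun _ => isCompact_univ_pi fun _ => isCompact_Icc
  refine hK.of_isClosed_subset hG.2.2.2.2 fun A hA i _ j _ => ?_
  exact abs_le.1 (entry_norm_bound_of_unitary (hG.1 A hA) i j)

/-- A continuous invariant function separating two orbits. -/
theorem IsClosedSubgroupO.exists_separating {G : Set (Matrix (Fin n) (Fin n) ℝ)}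
    (hG : IsClosedSubgroupO G) {u v : Eucl n} (h : ∀ A ∈ G, Matrix.toEuclideanLin A u ≠ v) :
    ∃ d : Eucl n → ℝ, Continuous d ∧
      (∀ A ∈ G, ∀ x, d (Matrix.toEuclideanLin A x) = d x) ∧ d u = 0 ∧ 0 < d v := by
  set O : Set (Eucl n) := (fun A => Matrix.toEuclideanLin A u) '' G with hO
  have hcont : Continuous fun A : Matrix (Fin n) (Fin n) ℝ => Matrix.toEuclideanLin A u := by
    simp only [Matrix.toLpLin_apply]
    exact (PiLp.continuous_toLp 2 _).comp (continuous_id.matrix_mulVec continuous_const)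
  have hu : u ∈ O := ⟨1, hG.2.1, by simp⟩
  have hclosed : IsClosed O := (hG.isCompact.image hcont).isClosed
  have hv : v ∉ O := by
    rintro ⟨A, hA, hAv⟩
    exact h A hA hAv
  refine ⟨fun x => Metric.infDist x O, Metric.continuous_infDist_pt O, fun A hA x => ?_,
    Metric.infDist_zero_of_mem hu, (hclosed.notMem_iff_infDist_pos ⟨u, hu⟩).1 hv⟩
  obtain ⟨U, hU⟩ := exists_linearIsometryEquiv (hG.1 A hA)
  have himage : U '' O = O := by
    refine Set.Subset.antisymm ?_ ?_
    · rintro _ ⟨_, ⟨B, hB, rfl⟩, rfl⟩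
      exact ⟨A * B, hG.2.2.1 A hA B hB, by simp only [hU, toEuclideanLin_mul_apply]⟩
    · rintro _ ⟨B, hB, rfl⟩
      refine ⟨_, ⟨A⁻¹ * B, hG.2.2.1 _ (hG.2.2.2.1 A hA) B hB, rfl⟩, ?_⟩
      have hdet : IsUnit A.det := (Matrix.isUnit_iff_isUnit_det A).1 (by
        exact IsUnit.of_mul_eq_one _ (Matrix.mem_unitaryGroup_iff.1 (hG.1 A hA)))
      simp only [hU]
      rw [← toEuclideanLin_mul_apply, ← mul_assoc, Matrix.mul_nonsing_inv _ hdet, one_mul]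
  have := Metric.infDist_image U.isometry (x := x) (t := O)
  rwa [himage, hU] at this

/-- Weighted means whose density is a polynomial in a fixed function. -/
def polyMean {d : Eucl n → ℝ} (hd : Continuous d) :
    Polynomial ℝ →ₗ[ℝ] (ConvexBody (Eucl n) → ℝ) where
  toFun p := weightedMean fun x => p.eval (d x)
  map_add' p q := by
    refine Eq.trans ?_ (weightedMean_add (p.continuous.comp hd) (q.continuous.comp hd))
    congr 1
    funext x
    simp
  map_smul' t p := by
    rw [RingHom.id_apply, ← weightedMean_smul]
    congr 1
    funext x
    simp

theorem polyMean_injective (hn : 2 ≤ n) {d : Eucl n → ℝ} (hd : Continuous d) {u v : Eucl n}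
    (hu : ‖u‖ = 1) (hv : ‖v‖ = 1) (huv : d u < d v) : Function.Injective (polyMean hd) := by
  refine (injective_iff_map_eq_zero _).2 fun p hp => ?_
  have hroot : ∀ e : Eucl n, ‖e‖ = 1 → p.eval (d e) = 0 := fun e he =>
    apply_eq_zero_of_weightedMean_eq_zero (p.continuous.comp hd) (fun K => congrFun hp K) he
  have hrank : 1 < Module.rank ℝ (Eucl n) := by
    rw [← Module.finrank_eq_rank, finrank_euclideanSpace_fin]
    exact_mod_cast hn
  have hsub := (isPreconnected_sphere hrank (0 : Eucl n) 1).intermediate_value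
    (mem_sphere_zero_iff_norm.2 hu) (mem_sphere_zero_iff_norm.2 hv) hd.continuousOn
  refine Polynomial.eq_zero_of_infinite_isRoot p ((Set.Icc_infinite huv).mono fun t ht => ?_)
  obtain ⟨e, he, rfl⟩ := hsub ht
  exact hroot e (mem_sphere_zero_iff_norm.1 he)

/-- The values of a functional on the unit coordinate points. -/
def pointMoments (n : ℕ) : (ConvexBody (Eucl n) → ℝ) →ₗ[ℝ] (Fin n → ℝ) where
  toFun μ i := μ (pointBody (EuclideanSpace.single i 1))
  map_add' _ _ := rfl
  map_smul' _ _ := rfl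

theorem polyMean_mem_valG {G : Set (Matrix (Fin n) (Fin n) ℝ)}
    (hG : ∀ A ∈ G, A ∈ Matrix.orthogonalGroup (Fin n) ℝ) {d : Eucl n → ℝ} (hd : Continuous d)
    (hinv : ∀ A ∈ G, ∀ x, d (Matrix.toEuclideanLin A x) = d x) {p : Polynomial ℝ}
    (hp : pointMoments n (polyMean hd p) = 0) : polyMean hd p ∈ valG G := by
  have hf : Continuous fun x => p.eval (d x) := p.continuous.comp hd
  refine mem_valG.2 ⟨⟨isValuation_weightedMean hf, continuous_weightedMean hf, fun K v => ?_⟩,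
    fun A hA K => weightedMean_matBody (f := fun x => p.eval (d x)) (hG A hA)
      (fun x => congrArg (fun t => p.eval t) (hinv A hA x)) K⟩
  refine (weightedMean_translate hf K v).trans (add_eq_left.2 ?_)
  exact Finset.sum_eq_zero fun i _ => mul_eq_zero_of_right _ (congrFun hp i)

/-- If the invariant valuations form a finite-dimensional space, the group is transitive. -/
theorem actsTransitively_of_finite_valG (hn : 2 ≤ n) {G : Set (Matrix (Fin n) (Fin n) ℝ)}
    (hG : IsClosedSubgroupO G) (hfin : Module.Finite ℝ (valG G)) : ActsTransitively G := by
  intro u v hu hv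
  by_contra! h
  obtain ⟨d, hd, hinv, hdu, hdv⟩ := hG.exists_separating h
  have hinj := polyMean_injective hn hd hu hv (hdu ▸ hdv)
  set M := (pointMoments n).comp (polyMean hd) with hM
  let W : LinearMap.ker M →ₗ[ℝ] valG G :=
    ((polyMean hd).comp (LinearMap.ker M).subtype).codRestrict (valG G)
      fun p => polyMean_mem_valG hG.1 hd hinv (LinearMap.mem_ker.1 p.2)
  have hker : Module.Finite ℝ (LinearMap.ker M) :=
    Module.Finite.of_injective W fun p q hpq =>
      Subtype.ext (hinj (congrArg Subtype.val hpq))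
  refine Polynomial.not_finite (R := ℝ) (Module.finite_def.2 ?_)
  refine Submodule.fg_of_fg_map_of_fg_inf_ker M (IsNoetherian.noetherian _) ?_
  rw [top_inf_eq]
  exact Module.Finite.iff_fg.1 hker

end NotTransitive

/-- The space `Val^G` of continuous translation invariant `G`-invariant valuations on `ℝⁿ`
is finite-dimensional (i.e. spanned by finitely many functions) if and only if the closed
subgroup `G ≤ O(n)` acts transitively on the unit sphere. -/
theorem valG_finiteDimensional_iff_transitive (n : ℕ) (hn : 2 ≤ n)
    (G : Set (Matrix (Fin n) (Fin n) ℝ)) (hG : IsClosedSubgroupO G) :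
    (∃ (d : ℕ) (b : Fin d → ConvexBody (Eucl n) → ℝ),
      ∀ μ : ConvexBody (Eucl n) → ℝ,
        IsValuation μ → Continuous μ → TransInv μ → GInv G μ →
          ∃ c : Fin d → ℝ, ∀ K : ConvexBody (Eucl n), μ K = ∑ i, c i * b i K) ↔
      ActsTransitively G := by
  rw [finite_valG_iff]
  exact ⟨actsTransitively_of_finite_valG hn hG, finite_valG_of_transitive (by omega) hG.1⟩
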